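/- Let (R, m) be a complete noetherian local domain of dimension n, and let a, b ⊆ R be ideals such that min{ dim R/a, dim R/b } > dim R/(a + b). Then cd(R, a ∩ b) ≥ n − dim R/(a + b) − 1. -/

import Mathlib

/-!
Auxiliary definitions: integer-valued topological (Krull) dimension, connectivity
dimension, subdimension, local cohomological dimension and depth.
-/

open TopologicalSpace

/-- The (topological Krull) dimension of a topological space, as an integer:
the supremum of the lengths of strictly increasing chains of irreducible closed subsets,
with the convention that the empty space has dimension `-1`. -/
noncomputable def topDim (T : Type*) [TopologicalSpace T] : ℤ :=
  sSup ({-1} ∪ {d : ℤ | ∃ n : ℕ, d = (n : ℤ) ∧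
    ∃ c : Fin (n + 1) → IrreducibleCloseds T, StrictMono c})

/-- The connectivity dimension `c(T)` of a topological space `T`: the minimum of `topDim Z`
over the closed subsets `Z ⊆ T` such that `T \ Z` is disconnected, the empty space counting
as disconnected (of dimension `-1`). -/
noncomputable def connDim (T : Type*) [TopologicalSpace T] : ℤ :=
  sInf {d : ℤ | ∃ Z : Set T, IsClosed Z ∧ ¬ ConnectedSpace ↥(Zᶜ) ∧ d = topDim ↥Z}

/-- The subdimension `sdim T` of a topological space: the minimum of the dimensions of its
irreducible components. -/
noncomputable def subDim (T : Type*) [TopologicalSpace T] : ℤ :=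
  sInf {d : ℤ | ∃ C ∈ irreducibleComponents T, d = topDim ↥C}

/-- The connectivity dimension `c(R)` of a commutative ring `R`, i.e. that of `Spec R`. -/
noncomputable def ringConnDim (R : Type) [CommRing R] : ℤ :=
  connDim (PrimeSpectrum R)

/-- The cohomological dimension `cd(M, a) = sup { i ∈ ℕ | H^i_a(M) ≠ 0 }` of an ideal `a`
with respect to a module `M`, where `H^i_a` is local cohomology with support in `a`. -/
noncomputable def cohDim (R : Type) [CommRing R] (a : Ideal R)
    (M : Type) [AddCommGroup M] [Module R M] : ℤ :=
  sSup {d : ℤ | ∃ i : ℕ, d = (i : ℤ) ∧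
    Nontrivial ((localCohomology a i).obj (ModuleCat.of R M))}

/-- `depth(a, M)`: the supremum of the lengths of `M`-regular sequences contained in the
ideal `a`. -/
noncomputable def idealDepth (R : Type) [CommRing R] (a : Ideal R)
    (M : Type) [AddCommGroup M] [Module R M] : ℤ :=
  sSup {d : ℤ | ∃ rs : List R, d = (rs.length : ℤ) ∧ (∀ r ∈ rs, r ∈ a) ∧
    RingTheory.Sequence.IsRegular M rs}


section
open CategoryTheory CategoryTheory.Limits Opposite

namespace LC

lemma hom_rep {R : Type} [CommRing R] (K : CochainComplex (ModuleCat.{0} R) ℕ) (n : ℕ) :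
    (∀ e : K.homology (n+1), ∃ g : K.X (n+1), K.d (n+1) (n+2) g = 0 ∧
      ∀ (L : CochainComplex (ModuleCat.{0} R) ℕ) (ψ : K ⟶ L),
        HomologicalComplex.homologyMap ψ (n+1) e = 0 ↔ ∃ h : L.X n, L.d n (n+1) h = ψ.f (n+1) g) ∧
    (∀ g : K.X (n+1), K.d (n+1) (n+2) g = 0 → ∃ e : K.homology (n+1),
      ∀ (L : CochainComplex (ModuleCat.{0} R) ℕ) (ψ : K ⟶ L),
        HomologicalComplex.homologyMap ψ (n+1) e = 0 ↔ ∃ h : L.X n, L.d n (n+1) h = ψ.f (n+1) g)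
    := by
  have key : ∀ z : K.cycles (n+1), ∀ (L : CochainComplex (ModuleCat.{0} R) ℕ) (ψ : K ⟶ L),
        HomologicalComplex.homologyMap ψ (n+1) (K.homologyπ (n+1) z) = 0 ↔
          ∃ h : L.X n, L.d n (n+1) h = ψ.f (n+1) (K.iCycles (n+1) z) := by
    intro z L ψ
    have h1 : HomologicalComplex.homologyMap ψ (n+1) (K.homologyπ (n+1) z) =
        L.homologyπ (n+1) (HomologicalComplex.cyclesMap ψ (n+1) z) := by
      rw [← ModuleCat.comp_apply, ← ModuleCat.comp_apply,
        HomologicalComplex.homologyπ_naturality]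
    have h2 : L.iCycles (n+1) (HomologicalComplex.cyclesMap ψ (n+1) z) =
        ψ.f (n+1) (K.iCycles (n+1) z) := by
      rw [← ModuleCat.comp_apply, ← ModuleCat.comp_apply, HomologicalComplex.cyclesMap_i]
    have inj : Function.Injective (L.iCycles (n+1)) :=
      (ModuleCat.mono_iff_injective _).1 inferInstance
    rw [h1, ← h2]
    let S : ShortComplex (ModuleCat.{0} R) :=
      ShortComplex.mk (L.toCycles n (n+1)) (L.homologyπ (n+1)) (by simp)
    have hS : S.Exact := S.exact_of_g_is_cokernel
      (L.homologyIsCokernel n (n+1) (by simp))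
    rw [ShortComplex.moduleCat_exact_iff] at hS
    constructor
    · intro h
      obtain ⟨w, hw⟩ := hS _ h
      refine ⟨w, ?_⟩
      rw [← hw]
      change _ = (L.iCycles (n+1)) (L.toCycles n (n+1) w)
      rw [← ModuleCat.comp_apply, HomologicalComplex.toCycles_i]
    · rintro ⟨w, hw⟩
      have : L.toCycles n (n+1) w = (HomologicalComplex.cyclesMap ψ (n+1) z) := by
        apply inj
        rw [← hw, ← ModuleCat.comp_apply, HomologicalComplex.toCycles_i]
      rw [← this]
      rw [← ModuleCat.comp_apply]
      simp
  constructor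
  · intro e
    have : Function.Surjective (K.homologyπ (n+1)) :=
      (ModuleCat.epi_iff_surjective _).1 inferInstance
    obtain ⟨z, rfl⟩ := this e
    refine ⟨K.iCycles (n+1) z, ?_, key z⟩
    rw [← ModuleCat.comp_apply]
    simp
  · intro g hg
    let S : ShortComplex (ModuleCat.{0} R) :=
      ShortComplex.mk (K.iCycles (n+1)) (K.d (n+1) (n+2)) (by simp)
    have hS : S.Exact := S.exact_of_f_is_kernel
      (K.cyclesIsKernel (n+1) (n+2) (by simp))
    rw [ShortComplex.moduleCat_exact_iff] at hS
    obtain ⟨z, hz⟩ := hS g hg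
    refine ⟨K.homologyπ (n+1) z, fun L ψ => ?_⟩
    rw [key z L ψ]
    rw [← hz]

/-- induced map on Hom complexes -/
noncomputable def homMap {R : Type} [CommRing R] {P Q : ChainComplex (ModuleCat.{0} R) ℕ} (φ : P ⟶ Q)
    (Y : ModuleCat.{0} R) : Q.linearYonedaObj R Y ⟶ P.linearYonedaObj R Y :=
  (HomologicalComplex.unopFunctor _ _).map
   ((((linearYoneda R (ModuleCat.{0} R)).obj Y).rightOp.mapHomologicalComplex _).map φ).op

lemma abs_iso {C : Type*} [Category C] {A H K A' H' K' : C} (p : H ≅ A) (p' : H' ≅ A') (q : K ≅ H)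
    (q' : K' ≅ H') (E : A ⟶ A') (M : H ⟶ H') (N : K ⟶ K') (h1 : p.hom ≫ E = M ≫ p'.hom)
    (h2 : q.hom ≫ M = N ≫ q'.hom) :
    E ≫ (p'.symm ≪≫ q'.symm).hom = (p.symm ≪≫ q.symm).hom ≫ N := by
  rw [← cancel_mono (q' ≪≫ p').hom, ← cancel_epi p.hom, ← cancel_epi q.hom]
  simp [← h1, ← reassoc_of% h2]

lemma isoExt_nat {R : Type} [CommRing R] {X X' : ModuleCat.{0} R}
    (P : ProjectiveResolution X) (P' : ProjectiveResolution X') (f : X' ⟶ X)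
    (φ : P'.complex ⟶ P.complex) (comm : φ.f 0 ≫ P.π.f 0 = P'.π.f 0 ≫ f) (n : ℕ)
    (Y : ModuleCat.{0} R) (e : ((Ext R (ModuleCat.{0} R) n).obj (op X)).obj Y) :
    (P'.isoExt (R := R) n Y).hom ((((Ext R (ModuleCat.{0} R) n).map f.op).app Y) e) =
     HomologicalComplex.homologyMap (homMap φ Y) n ((P.isoExt (R := R) n Y).hom e) := by
  rw [← ModuleCat.comp_apply, ← ModuleCat.comp_apply]
  congr 2
  have h1 := congrArg Quiver.Hom.unop
    (P'.isoLeftDerivedObj_hom_naturality f P φ comm ((linearYoneda R (ModuleCat.{0} R)).obj Y).rightOp n)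
  have h2 := congrArg Quiver.Hom.unop
    (HomologicalComplex.homologyOp_hom_naturality (homMap φ Y) n)
  have e1 : ((Ext R (ModuleCat.{0} R) n).map f.op).app Y =
    ((((linearYoneda R (ModuleCat.{0} R)).obj Y).rightOp.leftDerived n).map f).unop := rfl
  exact abs_iso (P.isoLeftDerivedObj ((linearYoneda R (ModuleCat R)).obj Y).rightOp n).unop
    (P'.isoLeftDerivedObj ((linearYoneda R (ModuleCat R)).obj Y).rightOp n).unop
    ((P.complex.linearYonedaObj R Y).homologyOp n).unop
    ((P'.complex.linearYonedaObj R Y).homologyOp n).unop _ _ _ h1 h2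

lemma ext_rep {R : Type} [CommRing R] {X : ModuleCat.{0} R}
    (P : ProjectiveResolution X) (n : ℕ) (Y : ModuleCat.{0} R) :
    (∀ e : ((Ext R (ModuleCat.{0} R) (n+1)).obj (op X)).obj Y, ∃ g : P.complex.X (n+1) ⟶ Y,
      P.complex.d (n+2) (n+1) ≫ g = 0 ∧
      ∀ (X' : ModuleCat.{0} R) (P' : ProjectiveResolution X') (f : X' ⟶ X)
        (φ : P'.complex ⟶ P.complex), φ.f 0 ≫ P.π.f 0 = P'.π.f 0 ≫ f →
        ((((Ext R (ModuleCat.{0} R) (n+1)).map f.op).app Y) e = 0 ↔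
          ∃ h : P'.complex.X n ⟶ Y, P'.complex.d (n+1) n ≫ h = φ.f (n+1) ≫ g)) ∧
    (∀ g : P.complex.X (n+1) ⟶ Y, P.complex.d (n+2) (n+1) ≫ g = 0 →
      ∃ e : ((Ext R (ModuleCat.{0} R) (n+1)).obj (op X)).obj Y,
      ∀ (X' : ModuleCat.{0} R) (P' : ProjectiveResolution X') (f : X' ⟶ X)
        (φ : P'.complex ⟶ P.complex), φ.f 0 ≫ P.π.f 0 = P'.π.f 0 ≫ f →
        ((((Ext R (ModuleCat.{0} R) (n+1)).map f.op).app Y) e = 0 ↔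
          ∃ h : P'.complex.X n ⟶ Y, P'.complex.d (n+1) n ≫ h = φ.f (n+1) ≫ g)) := by
  obtain ⟨h1, h2⟩ := hom_rep (P.complex.linearYonedaObj R Y) n
  have key : ∀ (e : ((Ext R (ModuleCat.{0} R) (n+1)).obj (op X)).obj Y)
    (X' : ModuleCat.{0} R) (P' : ProjectiveResolution X') (f : X' ⟶ X)
        (φ : P'.complex ⟶ P.complex), φ.f 0 ≫ P.π.f 0 = P'.π.f 0 ≫ f →
        ((((Ext R (ModuleCat.{0} R) (n+1)).map f.op).app Y) e = 0 ↔
        HomologicalComplex.homologyMap (homMap φ Y) (n+1)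
          ((P.isoExt (R := R) (n+1) Y).hom e) = 0) := by
    intro e X' P' f φ h
    rw [← isoExt_nat P P' f φ h]
    have inj : Function.Injective (P'.isoExt (R := R) (n+1) Y).hom :=
      (ModuleCat.mono_iff_injective _).1 inferInstance
    constructor
    · intro h; rw [h, map_zero]
    · intro h; exact inj (by rw [h, map_zero])
  constructor
  · intro e
    obtain ⟨g, hg, hg2⟩ := h1 ((P.isoExt (R := R) (n+1) Y).hom e)
    exact ⟨g, hg, fun X' P' f φ h => (key e X' P' f φ h).trans (hg2 _ _)⟩
  · intro g hg
    obtain ⟨e, he⟩ := h2 g hg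
    refine ⟨(P.isoExt (R := R) (n+1) Y).inv e, fun X' P' f φ h => (key _ X' P' f φ h).trans ?_⟩
    have h4 : (P.isoExt (R := R) (n+1) Y).hom ((P.isoExt (R := R) (n+1) Y).inv e) = e := by
      rw [← ModuleCat.comp_apply, Iso.inv_hom_id]; rfl
    rw [h4]
    exact he _ _

lemma lc_iff {R : Type} [CommRing R] (c : Ideal R) (i : ℕ) (M : ModuleCat.{0} R) :
    Subsingleton ((localCohomology c i).obj M) ↔
    ∀ (t : ℕ) (e : ((Ext R (ModuleCat.{0} R) i).obj (op (ModuleCat.of R (R ⧸ c ^ t)))).obj M),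
      ∃ (s : ℕ) (hs : t ≤ s), (((Ext R (ModuleCat.{0} R) i).map (ModuleCat.ofHom
        (Submodule.mapQ (c ^ s) (c ^ t) LinearMap.id (Ideal.pow_le_pow_right hs))).op).app M) e = 0 := by
  let D := localCohomology.diagram (localCohomology.idealPowersDiagram c) i
  let F := D ⋙ (evaluation _ _).obj M
  let α : (localCohomology c i).obj M ≅ colimit F := colimitObjIsoColimitCompEvaluation D M
  have h0 : Subsingleton ((localCohomology c i).obj M) ↔ Subsingleton (colimit F : ModuleCat R) :=
    α.toLinearEquiv.toEquiv.subsingleton_congr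
  rw [h0]
  constructor
  · intro h t e
    obtain ⟨j, k, hk⟩ := Concrete.colimit_rep_eq_zero R F (op (op t)) e (Subsingleton.elim _ _)
    exact ⟨j.unop.unop, k.unop.unop.down.down, hk⟩
  · intro h
    refine ⟨fun x y => ?_⟩
    suffices H : ∀ x : (colimit F : ModuleCat R), x = 0 by rw [H x, H y]
    intro x
    obtain ⟨j, e, rfl⟩ := Concrete.colimit_exists_rep F x
    obtain ⟨s, hs, he⟩ := h j.unop.unop e
    let k : j ⟶ op (op s) := (homOfLE hs).op.op
    have : F.map k e = 0 := he
    have h3 := congrArg (fun z => z.hom e) (colimit.w F k)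
    simp only [ModuleCat.hom_comp, LinearMap.comp_apply] at h3
    rw [show (colimit.ι F j) e = _ from h3.symm]
    erw [this, map_zero]
end LC
end

section
open CategoryTheory CategoryTheory.Limits Opposite

namespace LC

noncomputable def Pr {R : Type} [CommRing R] (c : Ideal R) (t : ℕ) :
    ProjectiveResolution (ModuleCat.of R (R ⧸ c ^ t)) := ProjectiveResolution.of _

noncomputable def qq {R : Type} [CommRing R] (c : Ideal R) {t s : ℕ} (h : t ≤ s) :
    ModuleCat.of R (R ⧸ c ^ s) ⟶ ModuleCat.of R (R ⧸ c ^ t) :=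
  ModuleCat.ofHom (Submodule.mapQ (c ^ s) (c ^ t) LinearMap.id (Ideal.pow_le_pow_right h))

noncomputable def ph {R : Type} [CommRing R] (c : Ideal R) {t s : ℕ} (h : t ≤ s) :
    (Pr c s).complex ⟶ (Pr c t).complex := ProjectiveResolution.lift (qq c h) _ _

noncomputable def pi0 {R : Type} [CommRing R] (c : Ideal R) (t : ℕ) :
    (Pr c t).complex.X 0 ⟶ ModuleCat.of R (R ⧸ c ^ t) := (Pr c t).π.f 0

instance {R : Type} [CommRing R] (c : Ideal R) (t : ℕ) : Epi (pi0 c t) :=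
  inferInstanceAs (Epi ((Pr c t).π.f 0))

lemma d_pi0 {R : Type} [CommRing R] (c : Ideal R) (t : ℕ) :
    (Pr c t).complex.d 1 0 ≫ pi0 c t = 0 := (Pr c t).complex_d_comp_π_f_zero

lemma pi0_fac {R : Type} [CommRing R] (c : Ideal R) (t : ℕ) {Y : ModuleCat.{0} R}
    (g : (Pr c t).complex.X 0 ⟶ Y) (hg : (Pr c t).complex.d 1 0 ≫ g = 0) :
    ∃ ω, pi0 c t ≫ ω = g :=
  ⟨(Pr c t).exact₀.gIsCokernel.desc (CokernelCofork.ofπ g hg),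
    (Pr c t).exact₀.gIsCokernel.fac _ .one⟩

lemma ph_comm' {R : Type} [CommRing R] (c : Ideal R) {t s : ℕ} (h : t ≤ s) :
    (ph c h).f 0 ≫ (Pr c t).π.f 0 = (Pr c s).π.f 0 ≫ qq c h :=
  ProjectiveResolution.lift_commutes_zero _ _ _

lemma ph_comm {R : Type} [CommRing R] (c : Ideal R) {t s : ℕ} (h : t ≤ s) :
    (ph c h).f 0 ≫ pi0 c t = pi0 c s ≫ qq c h := ph_comm' c h

def ZZ {R : Type} [CommRing R] (c : Ideal R) (n : ℕ) (Y : ModuleCat.{0} R) : Prop :=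
  ∀ (t : ℕ) (g : (Pr c t).complex.X (n+1) ⟶ Y), (Pr c t).complex.d (n+2) (n+1) ≫ g = 0 →
    ∃ (s : ℕ) (hs : t ≤ s) (h : (Pr c s).complex.X n ⟶ Y),
      (Pr c s).complex.d (n+1) n ≫ h = (ph c hs).f (n+1) ≫ g

lemma lc_ZZ {R : Type} [CommRing R] (c : Ideal R) (n : ℕ) (Y : ModuleCat.{0} R) :
    Subsingleton ((localCohomology c (n+1)).obj Y) ↔ ZZ c n Y := by
  rw [lc_iff]
  constructor
  · intro H t g hg
    obtain ⟨e, he⟩ := (ext_rep (Pr c t) n Y).2 g hg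
    obtain ⟨s, hs, h⟩ := H t e
    exact ⟨s, hs, (he _ (Pr c s) (qq c hs) (ph c hs) (ph_comm' c hs)).1 h⟩
  · intro H t e
    obtain ⟨g, hg, he⟩ := (ext_rep (Pr c t) n Y).1 e
    obtain ⟨s, hs, h⟩ := H t g hg
    exact ⟨s, hs, (he _ (Pr c s) (qq c hs) (ph c hs) (ph_comm' c hs)).2 h⟩

variable {R : Type} [CommRing R] (c : Ideal R) (T : ShortComplex (ModuleCat.{0} R))

lemma ZZ_succ (hT : T.ShortExact) [Injective T.X₂] (n : ℕ) :
    ZZ c (n+1) T.X₁ ↔ ZZ c n T.X₃ := by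
  have := hT.mono_f
  have := hT.epi_g
  constructor
  · intro H t ζ hζ
    let γ := Projective.factorThru ζ T.g
    have hγ : γ ≫ T.g = ζ := Projective.factorThru_comp _ _
    let η := hT.exact.liftFromProjective ((Pr c t).complex.d (n+2) (n+1) ≫ γ) (by simp [hγ, hζ])
    have hη : η ≫ T.f = (Pr c t).complex.d (n+2) (n+1) ≫ γ := hT.exact.liftFromProjective_comp _ _
    obtain ⟨s, hs, h, hh⟩ := H t η (by
      rw [← cancel_mono T.f]; simp [hη])
    let k := ((Pr c s).exact_succ n).descToInjective ((ph c hs).f (n+1) ≫ γ - h ≫ T.f) (by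
      simp only [Preadditive.comp_sub, ← HomologicalComplex.Hom.comm_assoc]
      rw [← Category.assoc _ h, hh, Category.assoc, hη]; simp)
    have hk : (Pr c s).complex.d (n+1) n ≫ k = (ph c hs).f (n+1) ≫ γ - h ≫ T.f :=
      ((Pr c s).exact_succ n).comp_descToInjective _ _
    refine ⟨s, hs, k ≫ T.g, ?_⟩
    rw [← Category.assoc, hk]; simp [hγ]
  · intro H t η hη
    let γ := ((Pr c t).exact_succ (n+1)).descToInjective (η ≫ T.f) (by
      simp [reassoc_of% hη])
    have hγ : (Pr c t).complex.d (n+2) (n+1) ≫ γ = η ≫ T.f :=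
      ((Pr c t).exact_succ (n+1)).comp_descToInjective _ _
    obtain ⟨s, hs, h, hh⟩ := H t (γ ≫ T.g) (by simp [reassoc_of% hγ])
    let k := Projective.factorThru h T.g
    have hk : k ≫ T.g = h := Projective.factorThru_comp _ _
    let κ := hT.exact.liftFromProjective
      ((ph c hs).f (n+1) ≫ γ - (Pr c s).complex.d (n+1) n ≫ k) (by simp [hk, hh])
    have hκ : κ ≫ T.f = (ph c hs).f (n+1) ≫ γ - (Pr c s).complex.d (n+1) n ≫ k :=
      hT.exact.liftFromProjective_comp _ _
    refine ⟨s, hs, κ, ?_⟩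
    rw [← cancel_mono T.f]
    simp [hκ, ← hγ]

/-- torsion by a power of `c` -/
def Gam (c : Ideal R) {M : Type} [AddCommGroup M] [Module R M] (x : M) : Prop :=
  ∃ t : ℕ, ∀ a ∈ c ^ t, a • x = 0

lemma exists_of_tors {M : ModuleCat.{0} R} (t : ℕ) (w : M) (hw : ∀ a ∈ c ^ t, a • w = 0) :
    ∃ ω : ModuleCat.of R (R ⧸ c ^ t) ⟶ M, ω (Submodule.Quotient.mk 1 : R ⧸ c ^ t) = w :=
  ⟨ModuleCat.ofHom (Submodule.liftQ (c ^ t) (LinearMap.toSpanSingleton R M w) (fun a ha => by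
    exact hw a ha)), by
    change (LinearMap.toSpanSingleton R M w) 1 = w
    simp⟩

lemma tors_of_hom {M : ModuleCat.{0} R} (t : ℕ) (ω : ModuleCat.of R (R ⧸ c ^ t) ⟶ M) (a : R)
    (ha : a ∈ c ^ t) : a • (ω (Submodule.Quotient.mk 1 : R ⧸ c ^ t)) = 0 := by
  rw [← map_smul ω.hom]
  have : a • (Submodule.Quotient.mk 1 : R ⧸ c ^ t) = 0 := by
    rw [← Submodule.Quotient.mk_smul, Submodule.Quotient.mk_eq_zero]
    simpa using ha
  erw [this, map_zero]

lemma hom_ext_one {M : ModuleCat.{0} R} (t : ℕ) (ω ω' : ModuleCat.of R (R ⧸ c ^ t) ⟶ M)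
    (h : ω (Submodule.Quotient.mk 1 : R ⧸ c ^ t) = ω' (Submodule.Quotient.mk 1 : R ⧸ c ^ t)) :
    ω = ω' := by
  ext : 1
  apply Submodule.linearMap_qext
  ext
  exact h

lemma ZZ_zero (hT : T.ShortExact) [Injective T.X₂] :
    ZZ c 0 T.X₁ ↔ ∀ w : T.X₃, Gam c w → ∃ x : T.X₂, Gam c x ∧ T.g x = w := by
  have := hT.mono_f
  have := hT.epi_g
  constructor
  · rintro H w ⟨t, hw⟩
    obtain ⟨ω, rfl⟩ := exists_of_tors c t w hw
    let γ := Projective.factorThru (pi0 c t ≫ ω) T.g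
    have hγ : γ ≫ T.g = pi0 c t ≫ ω := Projective.factorThru_comp _ _
    let η := hT.exact.liftFromProjective ((Pr c t).complex.d 1 0 ≫ γ) (by simp [hγ, reassoc_of% (d_pi0 c t)])
    have hη : η ≫ T.f = (Pr c t).complex.d 1 0 ≫ γ := hT.exact.liftFromProjective_comp _ _
    obtain ⟨s, hs, h, hh⟩ := H t η (by
      rw [← cancel_mono T.f]; simp [hη])
    obtain ⟨x, hx⟩ := pi0_fac c s ((ph c hs).f 0 ≫ γ - h ≫ T.f) (by
      simp only [Preadditive.comp_sub, ← HomologicalComplex.Hom.comm_assoc]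
      rw [← Category.assoc _ h, hh, Category.assoc, hη]; simp)
    have h1 : x ≫ T.g = qq c hs ≫ ω := by
      rw [← cancel_epi (pi0 c s), ← Category.assoc, hx]
      simp only [Preadditive.sub_comp, Category.assoc, hγ, T.zero, comp_zero, sub_zero]
      rw [← Category.assoc, ph_comm, Category.assoc]
    refine ⟨x (Submodule.Quotient.mk 1 : R ⧸ c ^ s), ⟨s, tors_of_hom c s x⟩, ?_⟩
    have h2 := congrArg (fun f => f.hom (Submodule.Quotient.mk 1 : R ⧸ c ^ s)) h1
    exact h2
  · intro H t η hη
    let γ : (Pr c t).complex.X 0 ⟶ T.X₂ := ((Pr c t).exact_succ 0).descToInjective (η ≫ T.f) (by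
      simp [reassoc_of% hη])
    have hγ : (Pr c t).complex.d 1 0 ≫ γ = η ≫ T.f :=
      ((Pr c t).exact_succ 0).comp_descToInjective _ _
    obtain ⟨ω, hω⟩ := pi0_fac c t (γ ≫ T.g) (by simp [reassoc_of% hγ])
    obtain ⟨x, ⟨s0, hs0⟩, hx⟩ := H (ω (Submodule.Quotient.mk 1 : R ⧸ c ^ t)) ⟨t, tors_of_hom c t ω⟩
    let s := max s0 t
    have hs : t ≤ s := le_max_right _ _
    obtain ⟨x', hx'⟩ := exists_of_tors c s x
      (fun a ha => hs0 a (Ideal.pow_le_pow_right (le_max_left _ _) ha))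
    have h1 : x' ≫ T.g = qq c hs ≫ ω := by
      apply hom_ext_one
      change T.g (x' _) = ω (qq c hs _)
      rw [hx', hx]
      rfl
    let κ := hT.exact.liftFromProjective
      ((ph c hs).f 0 ≫ γ - pi0 c s ≫ x') (by
        simp only [Preadditive.sub_comp, Category.assoc, h1, ← hω, reassoc_of% (ph_comm c hs),
          sub_self])
    have hκ : κ ≫ T.f = (ph c hs).f 0 ≫ γ - pi0 c s ≫ x' :=
      hT.exact.liftFromProjective_comp _ _
    refine ⟨s, hs, κ, ?_⟩
    rw [← cancel_mono T.f]
    simp [hκ, ← hγ, reassoc_of% (d_pi0 c s)]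

/-- the syzygies of an injective resolution -/
noncomputable def Mj (R : Type) [CommRing R] : ℕ → ModuleCat.{0} R
  | 0 => ModuleCat.of R R
  | (n+1) => cokernel (Injective.ι (Mj R n))

noncomputable def Tj (R : Type) [CommRing R] (n : ℕ) : ShortComplex (ModuleCat.{0} R) :=
  ShortComplex.mk (Injective.ι (Mj R n)) (cokernel.π (Injective.ι (Mj R n))) (by simp)

lemma Tj_exact (R : Type) [CommRing R] (n : ℕ) : (Tj R n).ShortExact where
  exact := ShortComplex.exact_cokernel _
  mono_f := by dsimp [Tj]; infer_instance
  epi_g := by dsimp [Tj]; infer_instance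

lemma ZZ_Mj (n k : ℕ) : ZZ c (n+k) (Mj R 0) ↔ ZZ c n (Mj R k) := by
  induction k generalizing n with
  | zero => rfl
  | succ k ih =>
    rw [show n + (k+1) = (n+1) + k by ring, ih]
    have : Injective (Tj R k).X₂ := by dsimp [Tj]; infer_instance
    exact ZZ_succ c (Tj R k) (Tj_exact R k) n

theorem exists_res (R : Type) [CommRing R] :
    ∃ (I : ℕ → ModuleCat.{0} R) (d : ∀ j, I j →ₗ[R] I (j+1)) (ε : R →ₗ[R] I 0),
      (∀ j, Module.Injective R (I j)) ∧ Function.Injective ε ∧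
      (∀ x, d 0 x = 0 ↔ ∃ r, ε r = x) ∧ (∀ j x, d (j+1) x = 0 ↔ ∃ y, d j y = x) ∧
      ∀ (c : Ideal R) (n : ℕ), Subsingleton ((localCohomology c (n+1)).obj (ModuleCat.of R R)) ↔
        ∀ u : I (n+1), d (n+1) u = 0 → Gam c u → ∃ v : I n, Gam c v ∧ d n v = u := by
  let I : ℕ → ModuleCat.{0} R := fun j => (Tj R j).X₂
  let F : ∀ j, Mj R j →ₗ[R] I j := fun j => (Tj R j).f.hom
  let G : ∀ j, I j →ₗ[R] Mj R (j+1) := fun j => (Tj R j).g.hom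
  have inj : ∀ n, Function.Injective (F n) := fun n =>
    (ModuleCat.mono_iff_injective _).1 (Tj_exact R n).mono_f
  have sur : ∀ n, Function.Surjective (G n) := fun n =>
    (ModuleCat.epi_iff_surjective _).1 (Tj_exact R n).epi_g
  have ex : ∀ n (x : I n), G n x = 0 ↔ ∃ y, F n y = x := fun n x =>
    ⟨fun h => (ShortComplex.moduleCat_exact_iff _).1 (Tj_exact R n).exact x h, by
      rintro ⟨y, rfl⟩
      have := LinearMap.congr_fun (congrArg ModuleCat.Hom.hom (Tj R n).zero) y
      exact this⟩
  let d : ∀ j, I j →ₗ[R] I (j+1) := fun j => F (j+1) ∘ₗ G j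
  have hd : ∀ j x, d j x = 0 ↔ ∃ y, F j y = x := fun j x => by
    rw [← ex]
    constructor
    · intro h; exact inj (j+1) (by rw [map_zero]; exact h)
    · intro h
      change F (j+1) (G j x) = 0
      rw [h, map_zero]
  refine ⟨I, d, F 0, fun j => ?_, inj 0, hd 0, fun j x => ?_,
    fun c n => ?_⟩
  · have : Injective (Tj R j).X₂ := by dsimp [Tj]; infer_instance
    exact Module.injective_module_of_injective_object _ _
  · rw [hd]
    constructor
    · rintro ⟨y, rfl⟩
      obtain ⟨z, rfl⟩ := sur j y
      exact ⟨z, rfl⟩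
    · rintro ⟨z, rfl⟩
      exact ⟨G j z, rfl⟩
  · have : Injective (Tj R n).X₂ := by dsimp [Tj]; infer_instance
    have h0 := ZZ_Mj c 0 n
    rw [zero_add] at h0
    rw [lc_ZZ]
    refine (h0.trans (ZZ_zero c (Tj R n) (Tj_exact R n))).trans ?_
    change (∀ w : Mj R (n+1), Gam c w → ∃ x : I n, Gam c x ∧ G n x = w) ↔ _
    constructor
    · rintro H u hu ⟨t, ht⟩
      obtain ⟨w, rfl⟩ := (hd (n+1) u).1 hu
      obtain ⟨x, hx, rfl⟩ := H w ⟨t, fun a ha => inj (n+1) (by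
        rw [map_zero, map_smul]; exact ht a ha)⟩
      exact ⟨x, hx, rfl⟩
    · rintro H w ⟨t, ht⟩
      obtain ⟨v, hv, hv2⟩ := H (F (n+1) w) ((hd (n+1) _).2 ⟨w, rfl⟩) ⟨t, fun a ha => by
        rw [← map_smul, ht a ha, map_zero]⟩
      exact ⟨v, hv, inj (n+1) hv2⟩
end LC
end

section
namespace LC

section
variable {R : Type} [CommRing R]

lemma inj_ext {M N Q : Type} [AddCommGroup M] [Module R M] [AddCommGroup N] [Module R N]
    [AddCommGroup Q] [Module R Q] (hQ : Module.Injective R Q) (g : M →ₗ[R] N) (f : M →ₗ[R] Q)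
    (h : LinearMap.ker g ≤ LinearMap.ker f) : ∃ k : N →ₗ[R] Q, ∀ x, k (g x) = f x := by
  obtain ⟨k, hk⟩ := hQ.out ((LinearMap.ker g).liftQ g le_rfl)
    (by rw [← LinearMap.ker_eq_bot]; exact Submodule.ker_liftQ_eq_bot _ _ _ le_rfl)
    ((LinearMap.ker g).liftQ f h)
  exact ⟨k, fun x => by simpa using hk (Submodule.Quotient.mk x)⟩

variable {M : Type} [AddCommGroup M] [Module R M]

lemma Gam.zero (c : Ideal R) : Gam c (0 : M) := ⟨0, fun a _ => smul_zero a⟩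

lemma Gam.add {c : Ideal R} {x y : M} (hx : Gam c x) (hy : Gam c y) : Gam c (x + y) := by
  obtain ⟨s, hs⟩ := hx
  obtain ⟨t, ht⟩ := hy
  refine ⟨max s t, fun a ha => ?_⟩
  rw [smul_add, hs a (Ideal.pow_le_pow_right (le_max_left _ _) ha),
    ht a (Ideal.pow_le_pow_right (le_max_right _ _) ha), add_zero]

lemma Gam.map {c : Ideal R} {x : M} {N : Type} [AddCommGroup N] [Module R N] (f : M →ₗ[R] N)
    (hx : Gam c x) : Gam c (f x) := by
  obtain ⟨s, hs⟩ := hx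
  exact ⟨s, fun a ha => by rw [← map_smul, hs a ha, map_zero]⟩

lemma Gam.smul {c : Ideal R} {x : M} (r : R) (hx : Gam c x) : Gam c (r • x) :=
  hx.map (LinearMap.lsmul R M r)

lemma Gam.sub {c : Ideal R} {x y : M} (hx : Gam c x) (hy : Gam c y) : Gam c (x - y) := by
  rw [sub_eq_add_neg, ← neg_one_smul R y]
  exact hx.add (hy.smul _)

lemma Gam.rad [IsNoetherianRing R] {a b : Ideal R} (h : a ≤ b.radical) {x : M} (hx : Gam b x) :
    Gam a x := by
  obtain ⟨t, ht⟩ := hx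
  obtain ⟨k, hk⟩ := Ideal.exists_radical_pow_le_of_fg b (IsNoetherian.noetherian _)
  refine ⟨k * t, fun r hr => ht r ?_⟩
  have h1 : a ^ k ≤ b := (Ideal.pow_right_mono h k).trans hk
  rw [pow_mul] at hr
  exact Ideal.pow_right_mono h1 t hr

lemma Gam.mono {a b : Ideal R} (h : a ≤ b) {x : M} (hx : Gam b x) : Gam a x := by
  obtain ⟨t, ht⟩ := hx
  exact ⟨t, fun r hr => ht r (Ideal.pow_right_mono h t hr)⟩

lemma Gam.sup {a b : Ideal R} {x : M} (ha : Gam a x) (hb : Gam b x) : Gam (a ⊔ b) x := by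
  obtain ⟨s, hs⟩ := ha
  obtain ⟨t, ht⟩ := hb
  refine ⟨s + t, fun r hr => ?_⟩
  have := Ideal.sup_pow_add_le_pow_sup_pow hr
  obtain ⟨p, hp, q, hq, rfl⟩ := Submodule.mem_sup.1 this
  rw [add_smul, hs p hp, ht q hq, add_zero]

lemma Gam_span (y : R) (x : M) : Gam (Ideal.span {y}) x ↔ ∃ t : ℕ, y ^ t • x = 0 := by
  constructor
  · rintro ⟨t, ht⟩
    exact ⟨t, ht _ (Ideal.pow_mem_pow (Ideal.mem_span_singleton_self y) t)⟩
  · rintro ⟨t, ht⟩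
    refine ⟨t, fun a ha => ?_⟩
    rw [Ideal.span_singleton_pow, Ideal.mem_span_singleton'] at ha
    obtain ⟨b, rfl⟩ := ha
    rw [mul_smul, ht, smul_zero]

lemma Gam_bot (x : M) : Gam (⊥ : Ideal R) x := ⟨1, fun a ha => by
  rw [pow_one] at ha; rw [(Submodule.mem_bot R).1 ha, zero_smul]⟩

/-- divisibility -/
lemma gam_div [IsNoetherianRing R] [IsDomain R] (hM : Module.Injective R M) (c : Ideal R) {y : R}
    (hy : y ≠ 0) {u : M} (hu : Gam c u) : ∃ v : M, Gam c v ∧ y • v = u := by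
  obtain ⟨t, ht⟩ := hu
  obtain ⟨k, hk⟩ := Ideal.exists_pow_inf_eq_pow_smul c (Ideal.span {y} : Submodule R R)
  let l := k + t
  have key : ∀ r, y * r ∈ c ^ l → r ∈ c ^ t := by
    intro r hr
    have h1 : y * r ∈ c ^ l • (⊤ : Submodule R R) ⊓ (Ideal.span {y} : Submodule R R) :=
      ⟨by simpa using hr, Ideal.mul_mem_right _ _ (Ideal.mem_span_singleton_self y)⟩
    rw [hk l (by omega)] at h1
    have h2 : y * r ∈ c ^ (l - k) • (Ideal.span {y} : Submodule R R) :=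
      Submodule.smul_mono le_rfl inf_le_right h1
    rw [smul_eq_mul, mul_comm, Ideal.mem_span_singleton_mul] at h2
    obtain ⟨z, hz, hzr⟩ := h2
    rw [← mul_left_cancel₀ hy hzr]
    simpa [l] using hz
  obtain ⟨h, hh⟩ := inj_ext hM ((c ^ l).mkQ ∘ₗ LinearMap.lsmul R R y) (LinearMap.toSpanSingleton R M u)
    (by
      intro r hr
      simp only [LinearMap.mem_ker, LinearMap.comp_apply, Submodule.mkQ_apply, LinearMap.lsmul_apply,
        Submodule.Quotient.mk_eq_zero, smul_eq_mul] at hr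
      simpa using ht r (key r hr))
  refine ⟨h (Submodule.Quotient.mk 1), ⟨l, fun a ha => ?_⟩, ?_⟩
  · rw [← map_smul, ← Submodule.Quotient.mk_smul, smul_eq_mul, mul_one,
      (Submodule.Quotient.mk_eq_zero _).2 ha, map_zero]
  · have := hh 1
    simp only [LinearMap.comp_apply, Submodule.mkQ_apply, LinearMap.lsmul_apply,
      LinearMap.toSpanSingleton_apply, one_smul] at this
    rw [← map_smul, ← Submodule.Quotient.mk_smul, this]

lemma gam_inf [IsNoetherianRing R] (hM : Module.Injective R M) (a b : Ideal R)
    {u : M} (hu : Gam (a ⊓ b) u) : ∃ v w : M, Gam a v ∧ Gam b w ∧ u = v + w := by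
  obtain ⟨t, ht⟩ := hu
  obtain ⟨k, hk⟩ := Ideal.exists_pow_inf_eq_pow_smul a (b ^ t : Submodule R R)
  let l := k + t
  have key : ∀ r, r ∈ a ^ l → r ∈ b ^ t → r ∈ (a ⊓ b) ^ t := by
    intro r hr hr2
    have h1 : r ∈ a ^ l • (⊤ : Submodule R R) ⊓ (b ^ t : Submodule R R) :=
      ⟨by simpa using hr, hr2⟩
    rw [hk l (by omega)] at h1
    have h2 : r ∈ a ^ (l - k) • (b ^ t : Submodule R R) :=
      Submodule.smul_mono le_rfl inf_le_right h1
    rw [smul_eq_mul, show l - k = t by omega, ← mul_pow] at h2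
    exact Ideal.pow_right_mono Ideal.mul_le_inf t h2
  obtain ⟨h, hh⟩ := inj_ext hM ((a ^ l).mkQ.prod (b ^ t).mkQ) (LinearMap.toSpanSingleton R M u)
    (by
      intro r hr
      have hr' := Prod.ext_iff.1 (show (((a ^ l).mkQ r, (b ^ t).mkQ r) : _ × _) = 0 from hr)
      simpa using ht r (key r ((Submodule.Quotient.mk_eq_zero _).1 hr'.1)
        ((Submodule.Quotient.mk_eq_zero _).1 hr'.2)))
  refine ⟨h (Submodule.Quotient.mk 1, 0), h (0, Submodule.Quotient.mk 1), ⟨l, fun a ha => ?_⟩,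
    ⟨t, fun a ha => ?_⟩, ?_⟩
  · rw [← map_smul, Prod.smul_mk, ← Submodule.Quotient.mk_smul, smul_eq_mul, mul_one,
      (Submodule.Quotient.mk_eq_zero _).2 ha, smul_zero, Prod.mk_zero_zero, map_zero]
  · rw [← map_smul, Prod.smul_mk, ← Submodule.Quotient.mk_smul, smul_eq_mul, mul_one,
      (Submodule.Quotient.mk_eq_zero _).2 ha, smul_zero, Prod.mk_zero_zero, map_zero]
  · have := hh 1
    rw [LinearMap.toSpanSingleton_apply, one_smul] at this
    rw [← map_add, ← this, Prod.mk_add_mk, add_zero, zero_add]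
    rfl
end
end LC
end

section
namespace LC

def GamS {R : Type} [CommRing R] (c : Ideal R) (M : Type) [AddCommGroup M] [Module R M] :
    Submodule R M where
  carrier := {x | Gam c x}
  add_mem' := Gam.add
  zero_mem' := Gam.zero c
  smul_mem' r _ h := h.smul r

lemma mem_GamS {R : Type} [CommRing R] {c : Ideal R} {M : Type} [AddCommGroup M] [Module R M]
    {x : M} : x ∈ GamS c M ↔ Gam c x := Iff.rfl

structure Res (R : Type) [CommRing R] where
  I : ℕ → ModuleCat.{0} R
  d : ∀ j, I j →ₗ[R] I (j+1)
  ε : R →ₗ[R] I 0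
  inj : ∀ j, Module.Injective R (I j)
  εinj : Function.Injective ε
  ex0 : ∀ x, d 0 x = 0 ↔ ∃ r, ε r = x
  ex : ∀ j x, d (j+1) x = 0 ↔ ∃ y, d j y = x

namespace Res

section
variable {R : Type} [CommRing R] (ρ : Res R)

def Bd (c : Ideal R) : (j : ℕ) → Submodule R (ρ.I j)
  | 0 => ⊥
  | j+1 => (GamS c (ρ.I j)).map (ρ.d j)

def Zc (c : Ideal R) (j : ℕ) : Submodule R (ρ.I j) :=
  GamS c (ρ.I j) ⊓ LinearMap.ker (ρ.d j)

def Van (c : Ideal R) (j : ℕ) : Prop := ρ.Zc c j ≤ ρ.Bd c j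

lemma dd (j : ℕ) (x : ρ.I j) : ρ.d (j+1) (ρ.d j x) = 0 := (ρ.ex j _).2 ⟨x, rfl⟩

lemma mem_Bd {c : Ideal R} {j : ℕ} {x : ρ.I (j+1)} :
    x ∈ ρ.Bd c (j+1) ↔ ∃ v, Gam c v ∧ ρ.d j v = x := Iff.rfl

lemma mem_Zc {c : Ideal R} {j : ℕ} {x : ρ.I j} : x ∈ ρ.Zc c j ↔ Gam c x ∧ ρ.d j x = 0 := Iff.rfl

lemma Bd_le (c : Ideal R) (j : ℕ) : ρ.Bd c j ≤ ρ.Zc c j := by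
  cases j with
  | zero => exact bot_le
  | succ j =>
    rintro _ ⟨v, hv, rfl⟩
    exact ⟨Gam.map (ρ.d j) hv, ρ.dd j v⟩

lemma Van_congr [IsNoetherianRing R] {a b : Ideal R} (h : a.radical = b.radical) {j : ℕ}
    (H : ρ.Van a j) : ρ.Van b j := by
  intro u hu
  have h1 : ∀ {k} {x : ρ.I k}, Gam b x → Gam a x := fun hx =>
    Gam.rad (h ▸ Ideal.le_radical) hx
  have h2 : ∀ {k} {x : ρ.I k}, Gam a x → Gam b x := fun hx =>
    Gam.rad (h ▸ Ideal.le_radical) hx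
  have := H (x := u) ⟨h1 hu.1, hu.2⟩
  cases j with
  | zero => exact this
  | succ j =>
    obtain ⟨v, hv, rfl⟩ := this
    exact ⟨v, h2 hv, rfl⟩

variable [IsNoetherianRing R] [IsDomain R]

lemma Bd_div (c : Ideal R) (j : ℕ) {x : R} (hx : x ≠ 0) {b : ρ.I j} (hb : b ∈ ρ.Bd c j) :
    ∃ b' ∈ ρ.Bd c j, x • b' = b := by
  cases j with
  | zero => exact ⟨0, zero_mem _, by rw [smul_zero]; exact ((Submodule.mem_bot R).1 hb).symm⟩
  | succ j =>
    obtain ⟨v, hv, rfl⟩ := hb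
    obtain ⟨w, hw, rfl⟩ := gam_div (ρ.inj j) c hx hv
    exact ⟨ρ.d j w, ⟨w, hw, rfl⟩, (map_smul _ _ _).symm⟩

lemma star {c : Ideal R} {j : ℕ} {x : R} (hx : x ≠ 0) {v : ρ.I j} (hv : Gam c v) (M : ℕ)
    (h : x ^ M • v ∈ ρ.Bd c j) : ρ.d j v ∈ ρ.Bd (Ideal.span {x} ⊔ c) (j+1) := by
  obtain ⟨b, hb, hb2⟩ := ρ.Bd_div c j (pow_ne_zero M hx) h
  have hb3 := ρ.Bd_le c j hb
  refine ⟨v - b, Gam.sup ((Gam_span _ _).2 ⟨M, ?_⟩) (hv.sub hb3.1), ?_⟩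
  · rw [smul_sub, hb2, sub_self]
  · rw [map_sub, hb3.2, sub_zero]

lemma ystep {c : Ideal R} {N : ℕ} (H : ∀ i ≥ N, ρ.Van c i) (y : R) :
    ∀ i ≥ N + 1, ρ.Van (Ideal.span {y} ⊔ c) i := by
  intro i hi
  by_cases hy : y = 0
  · have : Ideal.span {y} ⊔ c = c := by simp [hy]
    rw [this]; exact H i (by omega)
  obtain ⟨i, rfl⟩ : ∃ k, i = k + 1 := ⟨i - 1, by omega⟩
  rintro u ⟨hu, hu2⟩
  obtain ⟨v, hv, rfl⟩ := H (i+1) (by omega) ⟨Gam.mono le_sup_right hu, hu2⟩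
  obtain ⟨t, ht⟩ := (Gam_span _ _).1 (Gam.mono le_sup_left hu)
  refine ρ.star hy hv t (H i (by omega) ⟨hv.smul _, ?_⟩)
  rw [SetLike.mem_coe, LinearMap.mem_ker, map_smul, ht]

lemma van_bot : ∀ i ≥ 1, ρ.Van (⊥ : Ideal R) i := by
  intro i hi
  obtain ⟨i, rfl⟩ : ∃ k, i = k + 1 := ⟨i - 1, by omega⟩
  rintro u ⟨hu, hu2⟩
  obtain ⟨v, rfl⟩ := (ρ.ex i u).1 hu2
  exact ⟨v, Gam_bot v, rfl⟩

lemma ystep_list {c : Ideal R} {N : ℕ} (H : ∀ i ≥ N, ρ.Van c i) (l : List R) :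
    ∀ i ≥ N + l.length, ρ.Van (Ideal.ofList l ⊔ c) i := by
  induction l with
  | nil => simpa using H
  | cons y l ih =>
    rw [Ideal.ofList_cons, sup_assoc]
    exact ρ.ystep ih y

lemma van_list (l : List R) : ∀ i ≥ 1 + l.length, ρ.Van (Ideal.ofList l) i := by
  simpa using ρ.ystep_list ρ.van_bot l

/-- The symbols `1/x^N` -/
structure Sym (l : List R) (s : ℕ → ρ.I l.length) : Prop where
  mem : ∀ N, s N ∈ ρ.Zc (Ideal.ofList l) l.length
  kill : ∀ N, ∀ x ∈ l, x ^ N • s N ∈ ρ.Bd (Ideal.ofList l) l.length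
  tr : ∀ N, l.prod • s (N+1) - s N ∈ ρ.Bd (Ideal.ofList l) l.length
  sur : ∀ ω ∈ ρ.Zc (Ideal.ofList l) l.length, ∃ (N : ℕ) (r : R), ω - r • s N ∈ ρ.Bd (Ideal.ofList l) l.length
  zer : ∀ (N : ℕ) (r : R), r • s N ∈ ρ.Bd (Ideal.ofList l) l.length →
    ∃ k, l.prod ^ k * r ∈ Ideal.ofList (l.map (· ^ (N + k)))

lemma Sym.tr' {ρ : Res R} {l : List R} {s : ℕ → ρ.I l.length} (hs : ρ.Sym l s) (N k : ℕ) :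
    l.prod ^ k • s (N + k) - s N ∈ ρ.Bd (Ideal.ofList l) l.length := by
  induction k with
  | zero => simp
  | succ k ih =>
    have h1 := (ρ.Bd (Ideal.ofList l) l.length).smul_mem (l.prod ^ k) (hs.tr (N+k))
    have := add_mem h1 ih
    convert this using 1
    rw [smul_sub, ← mul_smul, ← pow_succ]
    abel_nf

lemma exists_sym (l : List R) (hl : ∀ x ∈ l, x ≠ 0) : ∃ s, ρ.Sym l s := by
  induction l with
  | nil =>
    refine ⟨fun _ => ρ.ε 1, fun N => ⟨?_, ?_⟩, by simp, by simp, ?_, ?_⟩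
    · rw [Ideal.ofList_nil]; exact Gam_bot _
    · exact (ρ.ex0 _).2 ⟨1, rfl⟩
    · rintro ω ⟨-, h⟩
      obtain ⟨r, rfl⟩ := (ρ.ex0 _).1 h
      exact ⟨0, r, by rw [← map_smul, smul_eq_mul, mul_one, sub_self]; exact zero_mem _⟩
    · intro N r h
      have h2 : r • ρ.ε 1 = 0 := h
      rw [← map_smul, smul_eq_mul, mul_one] at h2
      have := ρ.εinj (h2.trans (map_zero _).symm)
      exact ⟨0, by simp [this]⟩
  | cons x l ih =>
    obtain ⟨s, hs⟩ := ih (fun y hy => hl y (List.mem_cons_of_mem _ hy))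
    have hx : x ≠ 0 := hl x List.mem_cons_self
    choose v hv hv2 using fun N => gam_div (ρ.inj l.length) (Ideal.ofList l)
      (pow_ne_zero N hx) (hs.mem N).1
    have hsur : ∀ ω ∈ ρ.Zc (Ideal.ofList l) l.length, ∀ N, ∃ K ≥ N, ∃ r : R, ω - r • s K ∈ ρ.Bd (Ideal.ofList l) l.length := by
      intro ω hω N
      obtain ⟨K, r, h⟩ := hs.sur ω hω
      refine ⟨K + N, by omega, r * l.prod ^ N, ?_⟩
      have := (ρ.Bd (Ideal.ofList l) l.length).smul_mem r (hs.tr' K N)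
      convert sub_mem h this using 1
      rw [smul_sub, ← mul_smul]
      abel
    refine ⟨fun N => ρ.d l.length (v N), ?_⟩
    have e : Ideal.ofList (x :: l) = Ideal.span {x} ⊔ Ideal.ofList l := Ideal.ofList_cons _ _
    have e2 : (x :: l).length = l.length + 1 := rfl
    constructor
    · intro N
      rw [e]
      refine ⟨Gam.sup ((Gam_span _ _).2 ⟨N, ?_⟩) ((hv N).map _), ρ.dd _ _⟩
      rw [← map_smul, hv2]; exact (hs.mem N).2
    · intro N y hy
      rw [e]
      rcases List.mem_cons.1 hy with rfl | hy
      · rw [← map_smul, hv2, (hs.mem N).2]; exact zero_mem _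
      · rw [← map_smul]
        refine ρ.star hx ((hv N).smul _) N ?_
        rw [smul_comm, hv2]
        exact hs.kill N y hy
    · intro N
      rw [e, ← map_smul, ← map_sub]
      refine ρ.star hx (((hv _).smul _).sub (hv _)) N ?_
      rw [smul_sub, hv2, List.prod_cons, ← mul_smul,
        show x ^ N * (x * l.prod) = l.prod * x ^ (N+1) by ring, mul_smul, hv2]
      exact hs.tr N
    · rw [e]
      rintro ω ⟨hω, hω2⟩
      obtain ⟨w, hw, rfl⟩ := ρ.van_list l (l.length + 1) (by omega) ⟨Gam.mono le_sup_right hω, hω2⟩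
      obtain ⟨M, hM⟩ := (Gam_span _ _).1 (Gam.mono le_sup_left hω)
      obtain ⟨K, hK, r, h⟩ := hsur (x ^ M • w)
        ⟨hw.smul _, by rw [SetLike.mem_coe, LinearMap.mem_ker, map_smul, hM]⟩ M
      refine ⟨K, x ^ (K - M) * r, ?_⟩
      rw [← map_smul, ← map_sub]
      refine ρ.star hx (hw.sub ((hv K).smul _)) K ?_
      rw [smul_sub, smul_comm, hv2]
      convert (ρ.Bd (Ideal.ofList l) l.length).smul_mem (x ^ (K - M)) h using 1
      rw [smul_sub, ← mul_smul, ← mul_smul, ← pow_add, Nat.sub_add_cancel hK]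
    · rw [e]
      intro N r h
      rw [← map_smul] at h
      obtain ⟨τ, hτ, h⟩ := h
      obtain ⟨M, hM⟩ := (Gam_span _ _).1 (Gam.mono le_sup_left hτ)
      obtain ⟨K, hK, t, h2⟩ := hsur (r • v N - τ)
        ⟨((hv N).smul _).sub (Gam.mono le_sup_right hτ), by
          rw [SetLike.mem_coe, LinearMap.mem_ker, map_sub, h, sub_self]⟩ (M + N)
      have h3 := (ρ.Bd (Ideal.ofList l) l.length).smul_mem (x ^ K) h2
      have h4 := (ρ.Bd (Ideal.ofList l) l.length).smul_mem (x ^ (K - N) * r) (hs.tr' N (K - N))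
      rw [show N + (K - N) = K by omega] at h4
      have hM' : x ^ K • τ = 0 := by
        rw [show K = (K - M) + M by omega, pow_add, mul_smul, hM, smul_zero]
      have hv' : x ^ K • v N = x ^ (K - N) • s N := by
        rw [← hv2, ← mul_smul, ← pow_add]; congr 2; omega
      have h5 : ((x * l.prod) ^ (K - N) * r - x ^ K * t) • s K ∈ ρ.Bd (Ideal.ofList l) l.length := by
        convert add_mem h3 h4 using 1
        rw [smul_sub, smul_sub, smul_sub, hM', smul_comm (x ^ K) r, hv', sub_smul, mul_pow]
        simp only [← mul_smul]
        rw [show r * x ^ (K - N) = x ^ (K - N) * r by ring,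
          show x ^ (K - N) * l.prod ^ (K - N) * r = x ^ (K - N) * r * l.prod ^ (K - N) by ring]
        abel
      obtain ⟨k, hk⟩ := hs.zer K _ h5
      refine ⟨(K - N) + k, ?_⟩
      rw [show N + (K - N + k) = K + k by omega, List.map_cons, Ideal.ofList_cons, List.prod_cons]
      have h6 : (x * l.prod) ^ (K - N + k) * r =
        x ^ (K + k) * (l.prod ^ k * t) +
          x ^ k * (l.prod ^ k * ((x * l.prod) ^ (K - N) * r - x ^ K * t)) := by
        rw [pow_add, mul_pow _ _ k]; ring
      rw [h6]
      exact add_mem (Ideal.mem_sup_left (Ideal.mul_mem_right _ _ (Ideal.mem_span_singleton_self _)))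
        (Ideal.mem_sup_right (Ideal.mul_mem_left _ _ hk))

/-- nonvanishing criterion -/
lemma not_van {l : List R} (hl : ∀ x ∈ l, x ≠ 0) (H : ρ.Van (Ideal.ofList l) l.length) (N : ℕ) :
    ∃ k, l.prod ^ k ∈ Ideal.ofList (l.map (· ^ (N + k))) := by
  obtain ⟨s, hs⟩ := ρ.exists_sym l hl
  simpa using hs.zer N 1 (by rw [one_smul]; exact H (hs.mem N))

/-- Mayer–Vietoris step -/
lemma mv {a b m : Ideal R} (n : ℕ) (hm : m ≤ (a ⊔ b).radical) (ha : a ≤ m.radical) (hb : b ≤ m.radical)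
    (H : ρ.Van (a ⊓ b) (n+1))
    (h1 : ∀ u ∈ ρ.Zc m (n+2), u ∈ ρ.Bd a (n+2)) (h2 : ∀ u ∈ ρ.Zc m (n+2), u ∈ ρ.Bd b (n+2)) :
    ρ.Van m (n+2) := by
  intro u hu
  obtain ⟨v, hv, hvu⟩ := h1 u hu
  obtain ⟨w, hw, hwu⟩ := h2 u hu
  obtain ⟨t, ht, htv⟩ := H (x := v - w) ⟨(Gam.mono inf_le_left hv).sub (Gam.mono inf_le_right hw), by
    rw [SetLike.mem_coe, LinearMap.mem_ker, map_sub, hvu, hwu, sub_self]⟩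
  obtain ⟨ta, tb, hta, htb, rfl⟩ := gam_inf (ρ.inj n) a b ht
  refine ⟨v - ρ.d n ta, Gam.rad hm (Gam.sup (hv.sub (hta.map _)) ?_), ?_⟩
  · have : v - ρ.d n ta = w + ρ.d n tb := by
      rw [map_add] at htv
      rw [sub_eq_iff_eq_add, add_assoc, add_comm (ρ.d n tb), htv]; abel
    rw [this]
    exact hw.add (htb.map _)
  · rw [map_sub, ρ.dd, sub_zero, hvu]

/-- Hartshorne–Lichtenbaum from the elementary statement `E` -/
lemma hlvt {l : List R} (hl : ∀ x ∈ l, x ≠ 0) {x y : R} (hx : x ≠ 0) (hy : y ≠ 0) {m p : Ideal R}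
    (hm : Ideal.span {x} ⊔ Ideal.ofList l ≤ m)
    (hp : p ≤ (Ideal.span {y * x} ⊔ Ideal.ofList l).radical)
    (E : ∀ k r, ∃ i N t, y ^ N * (x * t - l.prod ^ i * r) ∈ Ideal.ofList (l.map (· ^ (k + i)))) :
    ∀ u ∈ ρ.Zc m (l.length + 1), u ∈ ρ.Bd p (l.length + 1) := by
  obtain ⟨s, hs⟩ := ρ.exists_sym l hl
  have E1 : ∀ ω ∈ ρ.Zc (Ideal.ofList l) l.length, ∃ η ∈ ρ.Zc (Ideal.ofList l) l.length, ∃ N, y ^ N • (x • η - ω) ∈ ρ.Bd (Ideal.ofList l) l.length := by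
    intro ω hω
    obtain ⟨k, r, h⟩ := hs.sur ω hω
    obtain ⟨i, N, t, ht⟩ := E k r
    refine ⟨t • s (k+i), (ρ.Zc (Ideal.ofList l) l.length).smul_mem _ (hs.mem _), N, ?_⟩
    have h1 : ∀ a ∈ Ideal.ofList (l.map (· ^ (k + i))), a • s (k+i) ∈ ρ.Bd (Ideal.ofList l) l.length := by
      intro a ha
      refine Submodule.span_induction ?_ ?_ ?_ ?_ ha
      · intro a ha
        obtain ⟨b, hb, rfl⟩ := List.mem_map.1 ha
        exact hs.kill _ b hb
      · rw [zero_smul]; exact zero_mem _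
      · intro a b _ _ ha hb; rw [add_smul]; exact add_mem ha hb
      · intro a b _ hb; rw [smul_eq_mul, mul_smul]; exact Submodule.smul_mem _ _ hb
    have h2 := h1 _ ht
    have h3 := (ρ.Bd (Ideal.ofList l) l.length).smul_mem (y ^ N) h
    have h4 := (ρ.Bd (Ideal.ofList l) l.length).smul_mem (y ^ N * r) (hs.tr' k i)
    convert sub_mem (add_mem h2 h4) h3 using 1
    simp only [mul_smul, smul_sub, sub_smul]
    rw [smul_comm (l.prod ^ i) r]
    abel
  have E2 : ∀ j, ∀ ω ∈ ρ.Zc (Ideal.ofList l) l.length, ∃ η ∈ ρ.Zc (Ideal.ofList l) l.length, ∃ N, y ^ N • (x ^ j • η - ω) ∈ ρ.Bd (Ideal.ofList l) l.length := by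
    intro j
    induction j with
    | zero => intro ω hω; exact ⟨ω, hω, 0, by simp⟩
    | succ j ih =>
      intro ω hω
      obtain ⟨η, hη, N, h⟩ := E1 ω hω
      obtain ⟨η', hη', N', h'⟩ := ih η hη
      refine ⟨η', hη', N + N', ?_⟩
      have h3 := (ρ.Bd (Ideal.ofList l) l.length).smul_mem (y ^ N') h
      have h4 := (ρ.Bd (Ideal.ofList l) l.length).smul_mem (y ^ N * x) h'
      convert add_mem h3 h4 using 1
      simp only [smul_sub, ← mul_smul]
      rw [show y ^ (N + N') * x ^ (j+1) = y ^ N * x * (y ^ N' * x ^ j) by ring,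
        show y ^ N * x * y ^ N' = y ^ N' * (y ^ N * x) by ring,
        show y ^ (N + N') = y ^ N' * y ^ N by ring]
      simp only [mul_smul]
      abel
  rintro u ⟨hu, hu2⟩
  obtain ⟨v, hv, rfl⟩ := ρ.van_list l (l.length + 1) (by omega) ⟨Gam.mono (le_sup_right.trans hm) hu, hu2⟩
  obtain ⟨j, hj⟩ := (Gam_span _ _).1 (Gam.mono (le_sup_left.trans hm) hu)
  obtain ⟨η, hη, N, h⟩ := E2 j (x ^ j • v) ⟨hv.smul _, by rw [SetLike.mem_coe, LinearMap.mem_ker, map_smul, hj]⟩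
  have h5 : ρ.d l.length (v - η) ∈ ρ.Bd (Ideal.span {y * x} ⊔ Ideal.ofList l) (l.length + 1) := by
    refine ρ.star (mul_ne_zero hy hx) (hv.sub hη.1) (N + j) ?_
    have := (ρ.Bd (Ideal.ofList l) l.length).smul_mem (-(y ^ j * x ^ N)) h
    convert this using 1
    simp only [smul_sub, ← mul_smul, mul_pow]
    rw [show -(y ^ j * x ^ N) * (y ^ N * x ^ j) = - (y ^ (N+j) * x ^ (N+j)) by ring,
      neg_smul, neg_smul]
    abel
  rw [map_sub, hη.2, sub_zero] at h5
  obtain ⟨w, hw, h6⟩ := h5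
  exact ⟨w, Gam.rad hp hw, h6⟩

end
end Res
end LC
end

section
namespace LC

lemma subring_zorn {C : Type} [CommRing C] (D0 U : Subring C) (W : Set C) (e : C)
    (hU : D0 ≤ U) (hW : ∀ x ∈ D0, x ∈ W → ∃ y ∈ D0, x = e * y) :
    ∃ D : Subring C, (D0 ≤ D ∧ D ≤ U ∧ ∀ x ∈ D, x ∈ W → ∃ y ∈ D, x = e * y) ∧
      ∀ D' : Subring C, D ≤ D' → D' ≤ U → (∀ x ∈ D', x ∈ W → ∃ y ∈ D', x = e * y) → D' ≤ D := by
  obtain ⟨D, h1, h2⟩ := zorn_le_nonempty₀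
    {D : Subring C | D ≤ U ∧ ∀ x ∈ D, x ∈ W → ∃ y ∈ D, x = e * y} (by
      intro c hc hcc D hD
      have hne : c.Nonempty := ⟨D, hD⟩
      have hdir := hcc.directedOn
      refine ⟨sSup c, ⟨sSup_le fun E hE => (hc hE).1, ?_⟩, fun E hE => le_sSup hE⟩
      intro x hx hxW
      obtain ⟨E, hE, hxE⟩ := (Subring.mem_sSup_of_directedOn hne hdir).1 hx
      obtain ⟨y, hy, h⟩ := (hc hE).2 x hxE hxW
      exact ⟨y, (Subring.mem_sSup_of_directedOn hne hdir).2 ⟨E, hE, hy⟩, h⟩) D0 ⟨hU, hW⟩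
  exact ⟨D, ⟨h1, h2.1.1, h2.1.2⟩, fun D' h3 h4 h5 => h2.2 ⟨h4, h5⟩ h3⟩

lemma eval₂_mem_subring {C : Type} [CommRing C] (D U : Subring C) (h : D ≤ U) (τ : C) (hτ : τ ∈ U)
    (f : Polynomial D) : f.eval₂ D.subtype τ ∈ U := by
  rw [Polynomial.eval₂_eq_sum_range]
  exact sum_mem fun i _ => mul_mem (h (f.coeff i).2) (pow_mem hτ _)

theorem lift_charp (p : ℕ) [hp : Fact p.Prime] {k C B : Type} [Field k] [CharP k p]
    [CommRing C] [CharP C p] [CommRing B] [Nontrivial B] (π : C →+* B)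
    (hπ : Function.Surjective π)
    (hN : ∀ x y, π x = 0 → π y = 0 → x * y = 0) (φ : k →+* B) :
    ∃ ψ : k →+* C, π.comp ψ = φ := by
  haveI : ExpChar C p := ExpChar.prime hp.out
  have h2 : 2 ≤ p := hp.out.two_le
  have hφ : Function.Injective φ := φ.injective
  have wd : ∀ x y, π x = π y → x ^ p = y ^ p := by
    intro x y h
    have h1 : π (x - y) = 0 := by rw [map_sub, h, sub_self]
    have h3 := hN _ _ h1 h1
    have h4 : (x - y) ^ p = 0 := by
      rw [show p = 2 + (p - 2) by omega, pow_add, pow_two, h3, zero_mul]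
    rw [sub_pow_expChar] at h4
    exact sub_eq_zero.1 h4
  choose c hc using hπ
  let F : k →+* C :=
    { toFun := fun a => c (φ a) ^ p
      map_one' := by
        rw [wd _ 1 (by rw [hc, map_one, map_one]), one_pow]
      map_mul' := fun a b => by
        rw [← mul_pow]; exact wd _ _ (by simp [hc])
      map_zero' := by
        rw [wd _ 0 (by rw [hc, map_zero, map_zero]), zero_pow (by omega)]
      map_add' := fun a b => by
        rw [← add_pow_expChar]; exact wd _ _ (by simp [hc]) }
  have hF : ∀ x a, π x = φ a → x ^ p = F a := fun x a h => wd _ _ (by rw [h, hc])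
  have hF' : ∀ a, π (F a) = φ (a ^ p) := fun a => by
    change π (c (φ a) ^ p) = _
    rw [map_pow, hc, map_pow]
  haveI : Nontrivial C := π.domain_nontrivial
  have hFi : Function.Injective F := F.injective
  obtain ⟨D, ⟨hD0, hDU, hDW⟩, hmax⟩ := subring_zorn F.range (φ.range.comap π) {x | π x = 0} 0
    (by rintro _ ⟨a, rfl⟩; exact ⟨a ^ p, (hF' a).symm⟩)
    (by
      rintro _ ⟨a, rfl⟩ (h : π (F a) = 0)
      rw [hF'] at h
      have := hφ (h.trans (map_zero φ).symm)
      have : a = 0 := (pow_eq_zero_iff (by omega)).1 this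
      exact ⟨0, zero_mem _, by rw [this, map_zero, zero_mul]⟩)
  have hDi : ∀ x ∈ D, π x = 0 → x = 0 := fun x hx h => by
    obtain ⟨y, -, h⟩ := hDW x hx h; rw [h, zero_mul]
  have hDF : ∀ a, F a ∈ D := fun a => hD0 ⟨a, rfl⟩
  have hfield : IsField D := by
    refine ⟨⟨0, 1, zero_ne_one⟩, mul_comm, ?_⟩
    rintro ⟨x, hx⟩ hx0
    obtain ⟨a, ha⟩ := hDU hx
    refine ⟨⟨x ^ (p-1) * F a⁻¹, mul_mem (pow_mem hx _) (hDF _)⟩, Subtype.ext ?_⟩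
    have ha0 : a ≠ 0 := by
      rintro rfl
      rw [map_zero] at ha
      exact hx0 (Subtype.ext (hDi x hx ha.symm))
    change x * (x ^ (p-1) * F a⁻¹) = 1
    rw [← mul_assoc, ← pow_succ', Nat.sub_add_cancel (by omega), hF x a ha.symm, ← map_mul,
      mul_inv_cancel₀ ha0, map_one]
  have hsurj : ∀ t : k, ∃ x ∈ D, π x = φ t := by
    intro t
    by_contra! hcon
    letI := hfield.toField
    let τ := c (φ t)
    have hτ : π τ = φ t := hc _
    let s : D := ⟨F t, hDF t⟩
    have hirr : Irreducible (Polynomial.X ^ p - Polynomial.C s : Polynomial D) := by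
      apply X_pow_sub_C_irreducible_of_prime hp.out
      rintro ⟨b, hb⟩ h
      obtain ⟨b', hb'⟩ := hDU hb
      have h' : b ^ p = F t := congrArg Subtype.val h
      rw [hF b b' hb'.symm] at h'
      exact hcon b hb (by rw [← hb', hFi h'])
    have hev : (Polynomial.X ^ p - Polynomial.C s : Polynomial D).eval₂ D.subtype τ = 0 := by
      rw [Polynomial.eval₂_sub, Polynomial.eval₂_X_pow, Polynomial.eval₂_C, hF τ t hτ]
      exact sub_self _
    have := hmax (Polynomial.eval₂RingHom D.subtype τ).range
      (fun x hx => ⟨Polynomial.C ⟨x, hx⟩, by simp⟩)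
      (by
        rintro _ ⟨f, rfl⟩
        exact eval₂_mem_subring D _ hDU τ ⟨t, hτ.symm⟩ f)
      (by
        rintro _ ⟨f, rfl⟩ (hf : π (Polynomial.eval₂ D.subtype τ f) = 0)
        refine ⟨0, zero_mem _, ?_⟩
        rw [zero_mul]
        change Polynomial.eval₂ D.subtype τ f = 0
        by_cases hdvd : (Polynomial.X ^ p - Polynomial.C s : Polynomial D) ∣ f
        · obtain ⟨q, rfl⟩ := hdvd
          rw [Polynomial.eval₂_mul, hev, zero_mul]
        · exfalso
          obtain ⟨u, v, huv⟩ := (hirr.coprime_iff_not_dvd).2 hdvd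
          have h1 := congrArg (fun g => π (Polynomial.eval₂ D.subtype τ g)) huv
          simp only [Polynomial.eval₂_add, Polynomial.eval₂_mul, hev, map_add, map_mul, hf,
            mul_zero, map_zero, Polynomial.eval₂_one, map_one, add_zero] at h1
          exact zero_ne_one h1)
    exact hcon τ (this ⟨Polynomial.X, by simp⟩) hτ
  choose g hgD hg using hsurj
  have huniq : ∀ x ∈ D, ∀ y ∈ D, π x = π y → x = y := fun x hx y hy h =>
    sub_eq_zero.1 (hDi _ (sub_mem hx hy) (by rw [map_sub, h, sub_self]))
  refine ⟨{ toFun := g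
            map_one' := huniq _ (hgD _) _ (one_mem _) (by simp [hg])
            map_zero' := huniq _ (hgD _) _ (zero_mem _) (by simp [hg])
            map_mul' := fun a b => huniq _ (hgD _) _ (mul_mem (hgD _) (hgD _)) (by simp [hg])
            map_add' := fun a b => huniq _ (hgD _) _ (add_mem (hgD _) (hgD _)) (by simp [hg]) }, ?_⟩
  ext a
  exact hg a
end LC
end

section
namespace LC

theorem lift_limit {A R : Type} [CommRing A] [CommRing R] (m : Ideal R) [IsAdicComplete m R]
    (φ : A →+* R ⧸ m)
    (hl : ∀ (j : ℕ) (f : A →+* R ⧸ m ^ (j+1)),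
      (∀ a, Ideal.Quotient.factor (Ideal.pow_le_self (Nat.succ_ne_zero j)) (f a) = φ a) →
      ∃ g : A →+* R ⧸ m ^ (j+2), (Ideal.Quotient.factorPow m (Nat.le_succ (j+1))).comp g = f) :
    ∃ ψ : A →+* R, ∀ a, Ideal.Quotient.mk m (ψ a) = φ a := by
  choose L hL using hl
  let P : ∀ j : ℕ, (A →+* R ⧸ m ^ (j+1)) → Prop := fun j f =>
    ∀ a, Ideal.Quotient.factor (Ideal.pow_le_self (Nat.succ_ne_zero j)) (f a) = φ a
  let g0 : {f // P 0 f} := ⟨(Ideal.quotEquivOfEq (by simp : m = m ^ (0+1))).toRingHom.comp φ, by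
    intro a
    obtain ⟨r, hr⟩ := Ideal.Quotient.mk_surjective (φ a)
    rw [RingHom.comp_apply, ← hr]; rfl⟩
  have step : ∀ j (f : {f // P j f}), P (j+1) (L j f.1 f.2) := by
    intro j f a
    have h := RingHom.congr_fun (hL j f.1 f.2) a
    rw [← f.2 a, ← h]
    obtain ⟨r, hr⟩ := Ideal.Quotient.mk_surjective (L j f.1 f.2 a)
    rw [RingHom.comp_apply, ← hr]
    rfl
  let g : ∀ j, {f // P j f} := fun j =>
    Nat.rec g0 (fun j f => ⟨L j f.1 f.2, step j f⟩) j
  have hg : ∀ j, (Ideal.Quotient.factorPow m (Nat.le_succ (j+1))).comp (g (j+1)).1 = (g j).1 :=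
    fun j => hL j (g j).1 (g j).2
  have hfac : ∀ (a b c : ℕ) (h1 : b ≤ a) (h2 : c ≤ b) (x : R ⧸ m ^ a),
      Ideal.Quotient.factorPow m h2 (Ideal.Quotient.factorPow m h1 x) =
        Ideal.Quotient.factorPow m (h2.trans h1) x := by
    intro a b c h1 h2 x
    obtain ⟨r, rfl⟩ := Ideal.Quotient.mk_surjective x
    rfl
  have hg2 : ∀ i k a, Ideal.Quotient.factorPow m (by omega : i + 1 ≤ i + k + 1) ((g (i+k)).1 a) = (g i).1 a := by
    intro i k a
    induction k with
    | zero =>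
      obtain ⟨r, hr⟩ := Ideal.Quotient.mk_surjective ((g i).1 a)
      change Ideal.Quotient.factorPow m _ ((g i).1 a) = _
      rw [← hr]; rfl
    | succ k ih =>
      rw [← ih, ← hg (i+k), RingHom.comp_apply, hfac]
      rfl
  let f : ∀ n, A →+* R ⧸ m ^ n := fun n => (Ideal.Quotient.factorPow m (Nat.le_succ n)).comp (g n).1
  have hf : ∀ {i n : ℕ} (hle : i ≤ n), (Ideal.Quotient.factorPow m hle).comp (f n) = f i := by
    intro i n hle
    obtain ⟨k, rfl⟩ := Nat.exists_eq_add_of_le hle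
    ext a
    simp only [f, RingHom.comp_apply]
    rw [← hg2 i k a, hfac, hfac]
  refine ⟨IsAdicComplete.liftRingHom m f hf, fun a => ?_⟩
  have := IsAdicComplete.mk_liftRingHom m f hf 1 a
  have h2 := congrArg (Ideal.Quotient.factor (by simp : m ^ 1 ≤ m)) this
  rw [Ideal.Quotient.factor_mk] at h2
  have h3 := RingHom.congr_fun (hg 0) a
  rw [h2, ← (g 0).2 a, ← h3]
  rfl

/-- coefficient field, char p -/
theorem coeff_field_p (p : ℕ) [hp : Fact p.Prime] {R : Type} [CommRing R] [IsLocalRing R]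
    [IsAdicComplete (IsLocalRing.maximalIdeal R) R] (hpR : (p : R) = 0) :
    ∃ ψ : (R ⧸ IsLocalRing.maximalIdeal R) →+* R,
      ∀ a, Ideal.Quotient.mk (IsLocalRing.maximalIdeal R) (ψ a) = a := by
  have hch : ∀ (I : Ideal R), I ≠ ⊤ → CharP (R ⧸ I) p := by
    intro I hI
    haveI := Ideal.Quotient.nontrivial_iff.2 hI
    refine (CharP.charP_iff_prime_eq_zero hp.out).2 ?_
    rw [← map_natCast (Ideal.Quotient.mk I), hpR, map_zero]
  have hm := (IsLocalRing.maximalIdeal.isMaximal R).ne_top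
  have hm' : ∀ j, IsLocalRing.maximalIdeal R ^ (j+1) ≠ ⊤ := fun j h =>
    hm (top_le_iff.1 (h ▸ Ideal.pow_le_self (Nat.succ_ne_zero j)))
  letI := Ideal.Quotient.field (IsLocalRing.maximalIdeal R)
  haveI : CharP (R ⧸ IsLocalRing.maximalIdeal R) p := hch _ hm
  refine lift_limit _ (RingHom.id _) fun j f _ => ?_
  haveI := hch _ (hm' (j+1))
  haveI := Ideal.Quotient.nontrivial_iff.2 (hm' j)
  refine lift_charp p _ (Ideal.Quotient.factor_surjective _) ?_ f
  intro x y hx hy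
  obtain ⟨x, rfl⟩ := Ideal.Quotient.mk_surjective x
  obtain ⟨y, rfl⟩ := Ideal.Quotient.mk_surjective y
  have hx' : x ∈ IsLocalRing.maximalIdeal R ^ (j+1) := Ideal.Quotient.eq_zero_iff_mem.1 hx
  have hy' : y ∈ IsLocalRing.maximalIdeal R ^ (j+1) := Ideal.Quotient.eq_zero_iff_mem.1 hy
  rw [← map_mul]
  refine Ideal.Quotient.eq_zero_iff_mem.2 (Ideal.pow_le_pow_right (by omega : j+2 ≤ (j+1)+(j+1)) ?_)
  rw [pow_add]
  exact Ideal.mul_mem_mul hx' hy'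

/-- coefficient field, char 0 -/
theorem coeff_field_0 {R : Type} [CommRing R] [IsLocalRing R]
    [IsAdicComplete (IsLocalRing.maximalIdeal R) R]
    [hch : CharZero (R ⧸ IsLocalRing.maximalIdeal R)] :
    ∃ ψ : (R ⧸ IsLocalRing.maximalIdeal R) →+* R,
      ∀ a, Ideal.Quotient.mk (IsLocalRing.maximalIdeal R) (ψ a) = a := by
  letI := Ideal.Quotient.field (IsLocalRing.maximalIdeal R)
  have hu : ∀ n : ℕ, n ≠ 0 → IsUnit (n : R) := by
    intro n hn
    by_contra h
    have h1 : (n : R) ∈ IsLocalRing.maximalIdeal R := h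
    have h2 := Ideal.Quotient.eq_zero_iff_mem.2 h1
    rw [map_natCast] at h2
    exact hn (Nat.cast_eq_zero.1 h2)
  letI : Algebra ℚ R := by
    refine (RingHom.toAlgebra (IsLocalization.lift (M := nonZeroDivisors ℤ) (S := ℚ) (g := Int.castRingHom R) ?_))
    rintro ⟨z, hz⟩
    have hz0 : z ≠ 0 := nonZeroDivisors.ne_zero hz
    have := hu z.natAbs (by simpa using hz0)
    simp only [eq_intCast]
    rcases Int.natAbs_eq z with h | h
    · rw [h]; simpa using this
    · rw [h]; simpa using this
  obtain ⟨s, hs⟩ := exists_isTranscendenceBasis ℚ (R ⧸ IsLocalRing.maximalIdeal R)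
  haveI : Algebra.IsAlgebraic (IntermediateField.adjoin ℚ (Set.range ((↑) : s → (R ⧸ IsLocalRing.maximalIdeal R))))
    (R ⧸ IsLocalRing.maximalIdeal R) := hs.isAlgebraic_field
  haveI := Algebra.FormallySmooth.of_algebraicIndependent_of_isSeparable hs.1
  obtain ⟨g, hg⟩ := Algebra.FormallySmooth.exists_mkₐ_comp_eq_of_isAdicComplete
    (I := IsLocalRing.maximalIdeal R)
    (@AlgHom.mk ℚ (R ⧸ IsLocalRing.maximalIdeal R) (R ⧸ IsLocalRing.maximalIdeal R) _ _ _ DivisionRing.toRatAlgebra (Ideal.instAlgebraQuotient ℚ _)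
      (RingHom.id (R ⧸ IsLocalRing.maximalIdeal R)) (fun q => by
        exact RingHom.congr_fun (Subsingleton.elim (@algebraMap ℚ (R ⧸ IsLocalRing.maximalIdeal R) _ _ DivisionRing.toRatAlgebra)
          (@algebraMap ℚ (R ⧸ IsLocalRing.maximalIdeal R) _ _ (Ideal.instAlgebraQuotient ℚ _))) q))
  exact ⟨g.toRingHom, fun a => DFunLike.congr_fun hg a⟩
end LC
end

section
namespace LC
open Polynomial

lemma root_above {O : Type} [CommRing O] {κ : Type} [Field κ] (res : O →+* κ)
    (hroot : ∀ g : O[X], g.Monic → g.natDegree ≠ 0 → ∃ τ, g.IsRoot τ) (s : κ) :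
    ∀ (d : ℕ) (g : O[X]), g.Monic → g.natDegree = d → g.eval₂ res s = 0 →
      ∃ τ, g.IsRoot τ ∧ res τ = s := by
  have hnt : Nontrivial O := res.domain_nontrivial
  intro d
  induction d with
  | zero =>
    intro g hg hd h0
    rw [hg.natDegree_eq_zero.1 hd, eval₂_one] at h0
    exact absurd h0 one_ne_zero
  | succ d ih =>
    intro g hg hd h0
    obtain ⟨τ, hτ⟩ := hroot g hg (by omega)
    obtain ⟨q, hq⟩ := dvd_iff_isRoot.2 hτ
    have hqm : q.Monic := (monic_X_sub_C τ).of_mul_monic_left (hq ▸ hg)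
    by_cases h : res τ = s
    · exact ⟨τ, hτ, h⟩
    · have hqd : q.natDegree = d := by
        have := (monic_X_sub_C τ).natDegree_mul hqm
        rw [← hq, hd, natDegree_X_sub_C] at this
        omega
      rw [hq, eval₂_mul, eval₂_sub, eval₂_X, eval₂_C] at h0
      obtain ⟨σ, h1, h2⟩ := ih q hqm hqd
        ((mul_eq_zero.1 h0).resolve_left (sub_ne_zero.2 (Ne.symm h)))
      refine ⟨σ, ?_, h2⟩
      rw [hq, IsRoot, eval_mul, h1, mul_zero]

theorem cohen_sub {O : Type} [CommRing O] [IsLocalRing O] (p : ℕ) (hp : p.Prime)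
    {κ : Type} [Field κ] (res : O →+* κ) (hres : Function.Surjective res)
    (hu : ∀ x, res x ≠ 0 → IsUnit x) (hpm : res (p : O) = 0)
    (hroot : ∀ g : O[X], g.Monic → g.natDegree ≠ 0 → ∃ τ, g.IsRoot τ)
    {k : Type} [Field k] (j : k →+* κ) :
    ∃ D : Subring O, (∀ x ∈ D, ∃ t, j t = res x) ∧ (∀ t, ∃ x ∈ D, res x = j t) ∧
      ∀ x ∈ D, res x = 0 → ∃ y ∈ D, x = p * y := by
  obtain ⟨D, ⟨-, hDU, hDW⟩, hmax⟩ := subring_zorn (⊥ : Subring O) (j.range.comap res) {x | res x = 0}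
    (p : O) bot_le (by
      intro x hx (hxW : res x = 0)
      obtain ⟨z, rfl⟩ := Subring.mem_bot.1 hx
      by_cases hz : (p : ℤ) ∣ z
      · obtain ⟨w, rfl⟩ := hz
        exact ⟨w, Subring.mem_bot.2 ⟨w, rfl⟩, by push_cast; rfl⟩
      · exfalso
        have hc : IsCoprime (p : ℤ) z := ((Nat.prime_iff_prime_int.1 hp).coprime_iff_not_dvd).2 hz
        obtain ⟨a, b, hab⟩ := hc
        have := congrArg (fun z : ℤ => res (z : O)) hab
        simp [hxW] at this
        have h2 := hpm
        simp at h2 hxW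
        simp [h2, hxW] at this)
  refine ⟨D, hDU, ?_, hDW⟩
  have hinv : ∀ a ∈ D, res a ≠ 0 → ∃ b ∈ D, b * a = 1 := by
    intro a ha ha0
    obtain ⟨b, hb⟩ := (hu a ha0).exists_left_inv
    refine ⟨b, ?_, hb⟩
    have key := hmax
      { carrier := {x | ∃ n, a ^ n * x ∈ D}
        one_mem' := ⟨0, by simp [one_mem]⟩
        zero_mem' := ⟨0, by simp [zero_mem]⟩
        mul_mem' := by
          rintro x y ⟨n, hn⟩ ⟨m, hm⟩
          refine ⟨n + m, ?_⟩
          convert mul_mem hn hm using 1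
          ring
        add_mem' := by
          rintro x y ⟨n, hn⟩ ⟨m, hm⟩
          refine ⟨n + m, ?_⟩
          convert add_mem (mul_mem (pow_mem ha m) hn) (mul_mem (pow_mem ha n) hm) using 1
          ring
        neg_mem' := by
          rintro x ⟨n, hn⟩
          refine ⟨n, ?_⟩
          rw [mul_neg]; exact neg_mem hn }
      (fun x hx => ⟨0, by simpa using hx⟩)
      (by
        rintro x ⟨n, hn⟩
        obtain ⟨s, hs⟩ := hDU hn
        obtain ⟨t, ht⟩ := hDU ha
        refine ⟨s / t ^ n, ?_⟩
        rw [map_div₀, map_pow, hs, ht, map_mul, map_pow, mul_div_cancel_left₀ _ (pow_ne_zero _ ha0)])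
      (by
        rintro x ⟨n, hn⟩ (hx : res x = 0)
        obtain ⟨y, hy, hxy⟩ := hDW _ hn (by change res _ = 0; rw [map_mul, hx, mul_zero])
        have hba : b ^ n * a ^ n = 1 := by rw [← mul_pow, hb, one_pow]
        refine ⟨b ^ n * y, ⟨n, ?_⟩, ?_⟩
        · rw [← mul_assoc, mul_comm (a ^ n), hba, one_mul]; exact hy
        · calc x = b ^ n * a ^ n * x := by rw [hba, one_mul]
            _ = b ^ n * (p * y) := by rw [mul_assoc, hxy]
            _ = _ := by ring)
    refine key ⟨1, ?_⟩
    rw [pow_one, mul_comm, hb]; exact one_mem _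
  have adj : ∀ τ : O, ∀ t, res τ = j t → (∀ f : D[X], res (f.eval₂ D.subtype τ) = 0 →
      ∃ g : D[X], f.eval₂ D.subtype τ = p * g.eval₂ D.subtype τ) → τ ∈ D := by
    intro τ t ht hf
    have := hmax (Polynomial.eval₂RingHom D.subtype τ).range
      (fun x hx => ⟨Polynomial.C ⟨x, hx⟩, by simp⟩)
      (by
        rintro _ ⟨f, rfl⟩
        exact eval₂_mem_subring D _ hDU τ ⟨t, ht.symm⟩ f)
      (by
        rintro _ ⟨f, rfl⟩ (h : res (Polynomial.eval₂ D.subtype τ f) = 0)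
        obtain ⟨g, hg⟩ := hf f h
        exact ⟨_, ⟨g, rfl⟩, hg⟩)
    exact this ⟨Polynomial.X, by simp⟩
  have hpD : ((p : D) : O) = p := by simp
  -- polynomials with coefficients in the maximal ideal
  have hdiv : ∀ f : D[X], (∀ i, res (f.coeff i) = 0) → ∃ g : D[X], f = C (p : D) * g := by
    intro f hf
    rw [← dvd_def, C_dvd_iff_dvd_coeff]
    intro i
    obtain ⟨y, hy, h⟩ := hDW _ (f.coeff i).2 (hf i)
    exact ⟨⟨y, hy⟩, Subtype.ext (by rw [h]; simp)⟩
  let rD : D →+* κ := res.comp D.subtype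
  have hev : ∀ (f : D[X]) (τ : O), res (f.eval₂ D.subtype τ) = f.eval₂ rD (res τ) := fun f τ => by
    rw [hom_eval₂]
  -- residue field of D
  let K : Subfield κ := { rD.range with
    inv_mem' := by
      rintro _ ⟨a, rfl⟩
      by_cases h : rD a = 0
      · exact ⟨0, by rw [h]; simp⟩
      · obtain ⟨b, hb, hba⟩ := hinv a a.2 h
        refine ⟨⟨b, hb⟩, ?_⟩
        have := congrArg res hba
        rw [map_mul, map_one] at this
        exact eq_inv_of_mul_eq_one_left this }
  have hK : ∀ a, rD a ∈ K := fun a => ⟨a, rfl⟩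
  let rK : D →+* K := rD.codRestrict K hK
  have hrK : Function.Surjective rK := by
    rintro ⟨_, a, rfl⟩; exact ⟨a, rfl⟩
  have hmap : ∀ (f : D[X]) (s : κ), f.eval₂ rD s = (aeval s) (f.map rK) := fun f s => by
    rw [aeval_def, eval₂_map]; rfl
  have hz : ∀ f : D[X], f.map rK = 0 → ∀ i, res (f.coeff i) = 0 := by
    intro f hf i
    have h : rK (f.coeff i) = 0 := by rw [← coeff_map, hf, coeff_zero]
    exact congrArg Subtype.val h
  intro t
  by_cases halg : IsAlgebraic K (j t)
  · have hint : IsIntegral K (j t) := halg.isIntegral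
    obtain ⟨g, hg1, hg2, hg3⟩ := lifts_and_degree_eq_and_monic (f := rK) (p := minpoly K (j t))
      ((mem_lifts _).2 (map_surjective _ hrK _)) (minpoly.monic hint)
    obtain ⟨τ, hτ, hτt⟩ := root_above res hroot (j t) _ (g.map D.subtype) (hg3.map _) rfl
      (by rw [eval₂_map]; change g.eval₂ rD _ = 0; rw [hmap, hg1, minpoly.aeval])
    refine ⟨τ, adj τ t hτt ?_, hτt⟩
    intro f hf
    have hτ0 : g.eval₂ D.subtype τ = 0 := by
      rw [← eval_map]; exact hτ
    have hfr : f.eval₂ D.subtype τ = (f %ₘ g).eval₂ D.subtype τ := by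
      conv_lhs => rw [← modByMonic_add_div f g]
      rw [eval₂_add, eval₂_mul, hτ0, zero_mul, add_zero]
    have h0 : (f %ₘ g).map rK = 0 := by
      rw [hfr, hev, hτt, hmap] at hf
      by_contra hne
      have h1 := minpoly.degree_le_of_ne_zero K (j t) hne hf
      have h2 : ((f %ₘ g).map rK).degree < g.degree := lt_of_le_of_lt degree_map_le (degree_modByMonic_lt f hg3)
      rw [← hg2] at h1
      exact absurd h2 (not_lt.2 h1)
    obtain ⟨q, hq⟩ := hdiv _ (hz _ h0)
    refine ⟨q, ?_⟩
    rw [hfr, hq, eval₂_mul, eval₂_C]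
    simp
  · obtain ⟨τ, hτt⟩ := hres (j t)
    refine ⟨τ, adj τ t hτt ?_, hτt⟩
    intro f hf
    rw [hev, hτt, hmap] at hf
    have h0 : f.map rK = 0 := by
      by_contra hne
      exact halg ⟨_, hne, hf⟩
    obtain ⟨q, hq⟩ := hdiv _ (hz _ h0)
    refine ⟨q, ?_⟩
    rw [hq, eval₂_mul, eval₂_C]
    simp

theorem cohen_ring (p : ℕ) [hp : Fact p.Prime] (k : Type) [Field k] [CharP k p] :
    ∃ (A : Type) (_ : CommRing A) (φ : A →+* k), Function.Surjective φ ∧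
      (∀ a, φ a = 0 → ∃ b, a = p * b) ∧ ∀ a : A, (p : A) * a = 0 → a = 0 := by
  let B := WittVector p k
  have hloc : ∀ b : B, WittVector.constantCoeff b ≠ 0 → IsUnit b := fun b hb =>
    WittVector.isUnit_of_coeff_zero_ne_zero b hb
  haveI : IsLocalRing B := by
    refine IsLocalRing.of_isUnit_or_isUnit_one_sub_self fun b => ?_
    by_cases hb : WittVector.constantCoeff b = 0
    · right
      apply hloc
      rw [map_sub, hb, map_one, sub_zero]
      exact one_ne_zero
    · exact Or.inl (hloc b hb)
  let Ω := AlgebraicClosure (FractionRing B)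
  have hinj : Function.Injective (algebraMap B Ω) := by
    rw [IsScalarTower.algebraMap_eq B (FractionRing B) Ω]
    exact (algebraMap (FractionRing B) Ω).injective.comp (IsFractionRing.injective B _)
  obtain ⟨O, hO, hlo⟩ := IsLocalRing.exists_factor_valuationRing (algebraMap B Ω)
  let ι : B →+* O := (algebraMap B Ω).codRestrict O.toSubring hO
  haveI : IsLocalHom ι := hlo
  let res := IsLocalRing.residue O
  have hres : Function.Surjective res := IsLocalRing.residue_surjective
  have hu : ∀ x, res x ≠ 0 → IsUnit x := fun x hx => by
    by_contra h
    exact hx ((IsLocalRing.residue_eq_zero_iff x).2 h)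
  have hk : ∀ b : B, WittVector.constantCoeff b = 0 → res (ι b) = 0 := by
    intro b hb
    refine (IsLocalRing.residue_eq_zero_iff _).2 fun h => ?_
    have h1 : IsUnit b := (isUnit_map_iff ι b).1 h
    have h2 := h1.map (WittVector.constantCoeff (p := p) (R := k))
    rw [hb] at h2
    exact not_isUnit_zero h2
  have hpB : WittVector.constantCoeff (p : B) = 0 := by
    rw [map_natCast]; exact CharP.cast_eq_zero k p
  have hsur : Function.Surjective (WittVector.constantCoeff (p := p) (R := k)) := fun a =>
    ⟨WittVector.teichmuller p a, by simp⟩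
  let j : k →+* IsLocalRing.ResidueField O := RingHom.liftOfSurjective _ hsur ⟨res.comp ι, fun b hb => hk b hb⟩
  have hpm : res (p : O) = 0 := by
    have := hk _ hpB
    rwa [map_natCast] at this
  have hroot : ∀ g : Polynomial O, g.Monic → g.natDegree ≠ 0 → ∃ τ, g.IsRoot τ := by
    intro g hg hd
    have hmd : (g.map (algebraMap O Ω)).degree ≠ 0 := by
      rw [hg.degree_map, degree_eq_natDegree hg.ne_zero]
      exact_mod_cast hd
    obtain ⟨w, hw⟩ := IsAlgClosed.exists_root _ hmd
    have hwi : IsIntegral O w := ⟨g, hg, by rw [← eval_map]; exact hw⟩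
    obtain ⟨τ, rfl⟩ := IsIntegrallyClosed.isIntegral_iff.1 hwi
    refine ⟨τ, ?_⟩
    have h2 : algebraMap O Ω (g.eval τ) = 0 := by
      rw [← hw, eval_map, eval₂_at_apply]
    exact (IsFractionRing.injective O Ω) (by rw [h2, map_zero])
  obtain ⟨D, h1, h2, h3⟩ := cohen_sub p hp.out res hres hu hpm hroot j
  choose φ hφ using fun x : D => h1 x x.2
  have ji := j.injective
  refine ⟨D, inferInstance,
    { toFun := φ
      map_one' := ji (by rw [hφ]; simp)
      map_zero' := ji (by rw [hφ]; simp)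
      map_mul' := fun a b => ji (by simp [hφ])
      map_add' := fun a b => ji (by simp [hφ]) }, ?_, ?_, ?_⟩
  · intro t
    obtain ⟨x, hx, hxt⟩ := h2 t
    exact ⟨⟨x, hx⟩, ji (by rw [← hxt]; exact hφ _)⟩
  · intro a (ha : φ a = 0)
    obtain ⟨y, hy, h⟩ := h3 a a.2 (by rw [← hφ, ha, map_zero])
    exact ⟨⟨y, hy⟩, Subtype.ext (by rw [h]; simp)⟩
  · intro a ha
    have hpne : (p : O) ≠ 0 := by
      intro h
      have h4 : ι (p : B) = 0 := by rw [map_natCast, h]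
      have h5 : algebraMap B Ω (p : B) = 0 := congrArg Subtype.val h4
      exact WittVector.p_nonzero p k (hinj (by rw [h5, map_zero]))
    have h6 : (p : O) * (a : O) = 0 := by
      have := congrArg Subtype.val ha
      simpa using this
    exact Subtype.ext ((mul_eq_zero.1 h6).resolve_left hpne)

theorem lift_cohen (p : ℕ) [hp : Fact p.Prime] {A C B k : Type} [CommRing A] [CommRing C] [CommRing B]
    [Field k] [CharP k p] (φ : A →+* k) (hφ : Function.Surjective φ)
    (hker : ∀ a, φ a = 0 → ∃ b, a = p * b) (hpA : ∀ a : A, (p : A) * a = 0 → a = 0)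
    (π : C →+* B) (hπ : Function.Surjective π) (hN : ∀ x y, π x = 0 → π y = 0 → x * y = 0)
    (hpN : ∀ x, π x = 0 → (p : C) * x = 0) (f : A →+* B) :
    ∃ g : A →+* C, π.comp g = f := by
  let E : Subring (C × A) := RingHom.eqLocus (π.comp (RingHom.fst C A)) (f.comp (RingHom.snd C A))
  have hE : ∀ x : E, π x.1.1 = f x.1.2 := fun x => x.2
  let I : Ideal E := Ideal.span {(p : E)}
  let θ : E →+* k := φ.comp ((RingHom.snd C A).comp E.subtype)
  have hpk : (p : k) = 0 := CharP.cast_eq_zero k p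
  have hI : ∀ x ∈ I, θ x = 0 := by
    intro x hx
    obtain ⟨y, rfl⟩ := Ideal.mem_span_singleton.1 hx
    rw [map_mul, map_natCast, hpk, zero_mul]
  let θ' : E ⧸ I →+* k := Ideal.Quotient.lift I θ hI
  have hθ : Function.Surjective θ := by
    intro t
    obtain ⟨a, rfl⟩ := hφ t
    obtain ⟨c, hc⟩ := hπ (f a)
    exact ⟨⟨(c, a), hc⟩, rfl⟩
  have hθ' : Function.Surjective θ' := Ideal.Quotient.lift_surjective_of_surjective I hI hθ
  haveI : Nontrivial (E ⧸ I) := θ'.domain_nontrivial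
  haveI : CharP (E ⧸ I) p := by
    refine (CharP.charP_iff_prime_eq_zero hp.out).2 ?_
    rw [← map_natCast (Ideal.Quotient.mk I)]
    exact Ideal.Quotient.eq_zero_iff_mem.2 (Ideal.mem_span_singleton_self _)
  -- adjusting the second component
  have adj : ∀ (x : E) (a : A), φ x.1.2 = φ a → ∃ y : E, y.1.2 = a ∧ Ideal.Quotient.mk I y = Ideal.Quotient.mk I x := by
    intro x a h
    obtain ⟨b, hb⟩ := hker (a - x.1.2) (by rw [map_sub, h, sub_self])
    obtain ⟨c, hc⟩ := hπ (f b)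
    let z : E := ⟨(c, b), hc⟩
    refine ⟨x + p * z, ?_, ?_⟩
    · change x.1.2 + ((p : E) : C × A).2 * b = a
      have : ((p : E) : C × A).2 = (p : A) := by simp
      rw [this, ← hb]; ring
    · rw [map_add, map_mul, map_natCast, CharP.cast_eq_zero, zero_mul, add_zero]
  have uniq : ∀ x y : E, x.1.2 = y.1.2 → Ideal.Quotient.mk I x = Ideal.Quotient.mk I y → x = y := by
    intro x y h1 h2
    obtain ⟨z, hz⟩ := Ideal.mem_span_singleton.1 (Ideal.Quotient.eq.1 h2)
    have hzz : ((x - y : E) : C × A) = (p : C × A) * (z : C × A) := by rw [hz]; simp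
    have ha : (p : A) * z.1.2 = 0 := by
      have := congrArg Prod.snd hzz
      rw [show ((x - y : E) : C × A).2 = x.1.2 - y.1.2 from rfl, h1, sub_self] at this
      rw [this]; simp
    have hz2 := hpA _ ha
    have hc : (p : C) * z.1.1 = 0 := hpN _ (by rw [hE, hz2, map_zero])
    have h3 : x.1.1 = y.1.1 := by
      have := congrArg Prod.fst hzz
      rw [show ((x - y : E) : C × A).1 = x.1.1 - y.1.1 from rfl] at this
      refine sub_eq_zero.1 (this.trans ?_)
      rw [← hc]; simp
    exact Subtype.ext (Prod.ext h3 h1)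
  obtain ⟨s, hs⟩ := lift_charp p θ' hθ' (by
    intro x y hx hy
    obtain ⟨x, rfl⟩ := Ideal.Quotient.mk_surjective x
    obtain ⟨y, rfl⟩ := Ideal.Quotient.mk_surjective y
    obtain ⟨x', hx1, hx2⟩ := adj x 0 (by rw [map_zero]; exact hx)
    obtain ⟨y', hy1, hy2⟩ := adj y 0 (by rw [map_zero]; exact hy)
    rw [← hx2, ← hy2, ← map_mul]
    have : x' * y' = 0 := by
      refine Subtype.ext (Prod.ext ?_ ?_)
      · exact hN _ _ (by rw [hE, hx1, map_zero]) (by rw [hE, hy1, map_zero])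
      · change x'.1.2 * y'.1.2 = 0
        rw [hx1, zero_mul]
    rw [this, map_zero]) (RingHom.id k)
  have ex : ∀ a : A, ∃ y : E, y.1.2 = a ∧ Ideal.Quotient.mk I y = s (φ a) := by
    intro a
    obtain ⟨x, hx⟩ := Ideal.Quotient.mk_surjective (s (φ a))
    have h1 : φ x.1.2 = φ a := by
      have := RingHom.congr_fun hs (φ a)
      rw [RingHom.comp_apply, ← hx] at this
      exact this
    obtain ⟨y, h2, h3⟩ := adj x a h1
    exact ⟨y, h2, h3.trans hx⟩
  choose g hg1 hg2 using ex
  let G : A →+* E :=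
    { toFun := g
      map_one' := uniq _ _ (by rw [hg1]; rfl) (by rw [hg2, map_one, map_one, map_one])
      map_zero' := uniq _ _ (by rw [hg1]; rfl) (by rw [hg2, map_zero, map_zero, map_zero])
      map_mul' := fun a b => uniq _ _ (by
        rw [hg1]; change _ = (g a).1.2 * (g b).1.2; rw [hg1, hg1]) (by rw [map_mul, hg2, hg2, hg2, map_mul, map_mul])
      map_add' := fun a b => uniq _ _ (by
        rw [hg1]; change _ = (g a).1.2 + (g b).1.2; rw [hg1, hg1]) (by rw [map_add, hg2, hg2, hg2, map_add, map_add]) }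
  refine ⟨(RingHom.fst C A).comp (E.subtype.comp G), ?_⟩
  ext a
  exact (hE (g a)).trans (by rw [hg1])
end LC
end

section
namespace LC
open IsLocalRing

theorem coeff_ring (R : Type) [CommRing R] [IsLocalRing R] [IsDomain R]
    [IsAdicComplete (maximalIdeal R) R] (t : R) (ht : t ∈ maximalIdeal R) (ht0 : t ≠ 0) :
    ∃ (A : Type) (_ : CommRing A) (π : A) (ψ : A →+* R),
      (∀ r, ∃ a, r - ψ a ∈ maximalIdeal R) ∧ (∀ a, ψ a ∈ maximalIdeal R → ∃ b, a = π * b) ∧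
      (∀ a, π * a = 0 → a = 0) ∧ ψ π ∈ maximalIdeal R ∧ ψ π ≠ 0 := by
  letI := Ideal.Quotient.field (maximalIdeal R)
  have equal : ∀ s : (R ⧸ maximalIdeal R) →+* R,
      (∀ a, Ideal.Quotient.mk (maximalIdeal R) (s a) = a) →
    ∃ (A : Type) (_ : CommRing A) (π : A) (ψ : A →+* R),
      (∀ r, ∃ a, r - ψ a ∈ maximalIdeal R) ∧ (∀ a, ψ a ∈ maximalIdeal R → ∃ b, a = π * b) ∧
      (∀ a, π * a = 0 → a = 0) ∧ ψ π ∈ maximalIdeal R ∧ ψ π ≠ 0 := by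
    intro s hs
    refine ⟨Polynomial (R ⧸ maximalIdeal R), inferInstance, Polynomial.X,
      Polynomial.eval₂RingHom s t, ?_, ?_, ?_, by simpa using ht, by simpa using ht0⟩
    · intro r
      refine ⟨Polynomial.C (Ideal.Quotient.mk _ r), Ideal.Quotient.eq.1 ?_⟩
      simp [hs]
    · intro f hf
      refine Polynomial.X_dvd_iff.2 ?_
      have h1 := Ideal.Quotient.eq_zero_iff_mem.2 hf
      rw [Polynomial.coe_eval₂RingHom, Polynomial.hom_eval₂, Ideal.Quotient.eq_zero_iff_mem.2 ht,
        show (Ideal.Quotient.mk (maximalIdeal R)).comp s = RingHom.id _ from RingHom.ext hs] at h1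
      rw [Polynomial.coeff_zero_eq_eval_zero]
      exact h1
    · intro f hf
      exact (mul_eq_zero.1 hf).resolve_left Polynomial.X_ne_zero
  obtain ⟨p, hch⟩ := CharP.exists (R ⧸ maximalIdeal R)
  rcases CharP.char_is_prime_or_zero (R ⧸ maximalIdeal R) p with hp | hp
  · haveI : Fact p.Prime := ⟨hp⟩
    have hpm : (p : R) ∈ maximalIdeal R := Ideal.Quotient.eq_zero_iff_mem.1 (by
      rw [map_natCast]; exact CharP.cast_eq_zero _ p)
    by_cases hpR : (p : R) = 0
    · obtain ⟨s, hs⟩ := coeff_field_p p hpR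
      exact equal s hs
    · obtain ⟨A, _, φ, h1, h2, h3⟩ := cohen_ring p (R ⧸ maximalIdeal R)
      obtain ⟨ψ, hψ⟩ := lift_limit (maximalIdeal R) φ (by
        intro j f _
        refine lift_cohen p φ h1 h2 h3 _ (Ideal.Quotient.factor_surjective _) ?_ ?_ f
        · intro x y hx hy
          obtain ⟨x, rfl⟩ := Ideal.Quotient.mk_surjective x
          obtain ⟨y, rfl⟩ := Ideal.Quotient.mk_surjective y
          have hx' : x ∈ IsLocalRing.maximalIdeal R ^ (j+1) := Ideal.Quotient.eq_zero_iff_mem.1 hx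
          have hy' : y ∈ IsLocalRing.maximalIdeal R ^ (j+1) := Ideal.Quotient.eq_zero_iff_mem.1 hy
          rw [← map_mul]
          refine Ideal.Quotient.eq_zero_iff_mem.2 (Ideal.pow_le_pow_right (by omega : j+2 ≤ (j+1)+(j+1)) ?_)
          rw [pow_add]
          exact Ideal.mul_mem_mul hx' hy'
        · intro x hx
          obtain ⟨x, rfl⟩ := Ideal.Quotient.mk_surjective x
          have hx' : x ∈ IsLocalRing.maximalIdeal R ^ (j+1) := Ideal.Quotient.eq_zero_iff_mem.1 hx
          rw [← map_natCast (Ideal.Quotient.mk _), ← map_mul]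
          refine Ideal.Quotient.eq_zero_iff_mem.2 ?_
          rw [pow_succ']
          exact Ideal.mul_mem_mul hpm hx')
      refine ⟨A, inferInstance, p, ψ, ?_, ?_, h3, by simpa using hpm, by simpa using hpR⟩
      · intro r
        obtain ⟨a, ha⟩ := h1 (Ideal.Quotient.mk _ r)
        exact ⟨a, Ideal.Quotient.eq.1 (by rw [hψ, ha])⟩
      · intro a ha
        exact h2 a (by rw [← hψ]; exact Ideal.Quotient.eq_zero_iff_mem.2 ha)
  · subst hp
    haveI : CharZero (R ⧸ maximalIdeal R) := CharP.charP_to_charZero _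
    obtain ⟨s, hs⟩ := coeff_field_0 (R := R)
    exact equal s hs

theorem dvr_of_complete (V : Type) [CommRing V] (π : V) [hm : (Ideal.span {π}).IsMaximal]
    [hc : IsAdicComplete (Ideal.span {π}) V] (hπ : ∀ x, π * x = 0 → x = 0) :
    ∃ _ : IsDomain V, IsDiscreteValuationRing V ∧ Irreducible π := by
  haveI := isLocalRing_of_isAdicComplete_maximal (Ideal.span {π})
  have hmax : maximalIdeal V = Ideal.span {π} := (IsLocalRing.eq_maximalIdeal hm).symm
  have hpow : ∀ n x, π ^ n * x = 0 → x = 0 := by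
    intro n
    induction n with
    | zero => intro x hx; simpa using hx
    | succ n ih => intro x hx; exact ih _ (hπ _ (by rw [← hx]; ring))
  have hfac : ∀ x : V, x ≠ 0 → ∃ n u, IsUnit u ∧ x = π ^ n * u := by
    intro x hx
    have hex : ∃ n, ¬ π ^ n ∣ x := by
      by_contra! h
      refine hx (hc.haus' x fun n => ?_)
      rw [SModEq.zero, smul_eq_mul, Ideal.mul_top, Ideal.span_singleton_pow]
      exact Ideal.mem_span_singleton.2 (h n)
    classical
    obtain ⟨n, hn⟩ : ∃ n, Nat.find hex = n + 1 := Nat.exists_eq_succ_of_ne_zero (by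
      intro h0
      have := Nat.find_spec hex
      rw [h0, pow_zero] at this
      exact this (one_dvd x))
    obtain ⟨u, hu⟩ := not_not.1 (Nat.find_min hex (by omega : n < _))
    refine ⟨n, u, ?_, hu⟩
    by_contra hnu
    have h1 : u ∈ maximalIdeal V := hnu
    rw [hmax] at h1
    obtain ⟨w, hw⟩ := Ideal.mem_span_singleton.1 h1
    have := Nat.find_spec hex
    rw [hn] at this
    exact this ⟨w, by rw [hu, hw]; ring⟩
  have hdom : IsDomain V := by
    haveI : NoZeroDivisors V := ⟨by
      intro a b hab
      by_contra! h
      obtain ⟨n, u, hu, rfl⟩ := hfac a h.1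
      obtain ⟨m, w, hw, rfl⟩ := hfac b h.2
      have h1 : u * w = 0 := hpow (n+m) _ (by rw [← hab]; ring)
      have h2 := hu.mul hw
      rw [h1] at h2
      exact not_isUnit_zero h2⟩
    exact NoZeroDivisors.to_isDomain V
  have hπu : ¬ IsUnit π := fun h => hm.ne_top (Ideal.span_singleton_eq_top.2 h)
  have hπ0 : π ≠ 0 := by
    rintro rfl
    exact one_ne_zero (hπ 1 (zero_mul _))
  have hirr : Irreducible π := ((Ideal.span_singleton_prime hπ0).1 hm.isPrime).irreducible
  refine ⟨hdom, IsDiscreteValuationRing.ofHasUnitMulPowIrreducibleFactorization ⟨π, hirr, ?_⟩, hirr⟩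
  intro x hx
  obtain ⟨n, u, hu, rfl⟩ := hfac x hx
  exact ⟨n, hu.unit, rfl⟩

theorem coeff_dvr (R : Type) [CommRing R] [IsLocalRing R] [IsDomain R]
    [IsAdicComplete (maximalIdeal R) R] (t : R) (ht : t ∈ maximalIdeal R) (ht0 : t ≠ 0) :
    ∃ (V : Type) (_ : CommRing V) (_ : IsDomain V) (_ : IsDiscreteValuationRing V) (π : V) (ψ : V →+* R),
      IsAdicComplete (Ideal.span {π}) V ∧ Irreducible π ∧
      (∀ r, ∃ a, r - ψ a ∈ maximalIdeal R) ∧ ψ π ∈ maximalIdeal R ∧ ψ π ≠ 0 := by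
  obtain ⟨A, _, π, ψ, h1, h2, h3, h4, h5⟩ := coeff_ring R t ht ht0
  let I : Ideal A := Ideal.span {π}
  have hIm : I.IsMaximal := by
    letI := Ideal.Quotient.field (maximalIdeal R)
    let φ : A →+* R ⧸ maximalIdeal R := (Ideal.Quotient.mk _).comp ψ
    have hφ : Function.Surjective φ := by
      intro r
      obtain ⟨r, rfl⟩ := Ideal.Quotient.mk_surjective r
      obtain ⟨a, ha⟩ := h1 r
      exact ⟨a, (Ideal.Quotient.eq.2 ha).symm⟩
    have : I = RingHom.ker φ := by
      ext a
      rw [Ideal.mem_span_singleton, RingHom.mem_ker, RingHom.comp_apply, Ideal.Quotient.eq_zero_iff_mem]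
      constructor
      · rintro ⟨b, rfl⟩; rw [map_mul]; exact Ideal.mul_mem_right _ _ h4
      · intro h; exact h2 a h
    rw [this]
    exact RingHom.ker_isMaximal_of_surjective φ hφ
  have hfg : I.FG := ⟨{π}, by simp [I]⟩
  let V := AdicCompletion I A
  let ϖ : V := algebraMap A V π
  have hmap : I.map (algebraMap A V) = Ideal.span {ϖ} := by
    rw [Ideal.map_span, Set.image_singleton]
  haveI hc : IsAdicComplete (Ideal.span {ϖ}) V := by
    rw [← hmap]; exact AdicCompletion.isAdicComplete_self _ hfg
  haveI hm : (Ideal.span {ϖ}).IsMaximal := by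
    rw [← hmap]; exact AdicCompletion.isMaximal_map_of_le _ I le_rfl hfg
  have hcmp : ∀ x : V, ∃ s : ℕ → A, (∀ n, AdicCompletion.evalₐ I n x = Ideal.Quotient.mk _ (s n)) ∧
      ∀ m n, m ≤ n → Ideal.Quotient.mk (I ^ m) (s n) = Ideal.Quotient.mk (I ^ m) (s m) := by
    intro x
    induction x using AdicCompletion.induction_on with
    | _ x => exact ⟨x.1, fun n => AdicCompletion.evalₐ_mk I n x, fun m n h => AdicCompletion.Ideal.mk_eq_mk I h x⟩
  have hpi : ∀ x, ϖ * x = 0 → x = 0 := by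
    intro x hx
    refine AdicCompletion.ext_evalₐ fun n => ?_
    obtain ⟨s, hs1, hs2⟩ := hcmp x
    have hy := (hs1 (n+1)).symm
    set y := s (n+1)
    have e1 : AdicCompletion.evalₐ I (n+1) (ϖ * x) = 0 := by rw [hx, map_zero]
    rw [map_mul, ← hy, AlgHom.commutes] at e1
    have e2 : π * y ∈ I ^ (n+1) := Ideal.Quotient.eq_zero_iff_mem.1 (by rw [map_mul]; exact e1)
    rw [Ideal.span_singleton_pow] at e2
    obtain ⟨z, hz⟩ := Ideal.mem_span_singleton.1 e2
    have e3 : y = π ^ n * z := sub_eq_zero.1 (h3 _ (by rw [mul_sub, hz]; ring))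
    have e4 : AdicCompletion.evalₐ I n x = Ideal.Quotient.mk _ y := by
      rw [hs1, ← hs2 n (n+1) (Nat.le_succ n)]
    rw [e4, map_zero, Ideal.Quotient.eq_zero_iff_mem, Ideal.span_singleton_pow]
    exact Ideal.mem_span_singleton.2 ⟨z, e3⟩
  obtain ⟨hd, hdvr, hirr⟩ := dvr_of_complete V ϖ hpi
  have hle : ∀ n, I ^ n ≤ (maximalIdeal R ^ n).comap ψ := by
    intro n
    rw [← Ideal.map_le_iff_le_comap, Ideal.map_pow]
    refine Ideal.pow_right_mono ?_ n
    rw [Ideal.map_span, Set.image_singleton, Ideal.span_singleton_le_iff_mem]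
    exact h4
  let f : ∀ n, V →+* R ⧸ maximalIdeal R ^ n := fun n =>
    (Ideal.quotientMap _ ψ (hle n)).comp (AdicCompletion.evalₐ I n).toRingHom
  have hf : ∀ {m n : ℕ} (hle : m ≤ n), (Ideal.Quotient.factorPow (maximalIdeal R) hle).comp (f n) = f m := by
    intro m n h
    ext x
    obtain ⟨s, hs1, hs2⟩ := hcmp x
    have e1 : ∀ n, f n x = Ideal.Quotient.mk _ (ψ (s n)) := fun n => by
      have := hs1 n
      change Ideal.quotientMap _ ψ (hle n) (AdicCompletion.evalₐ I n x) = _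
      rw [this, Ideal.quotientMap_mk]
    rw [RingHom.comp_apply, e1, e1]
    refine Ideal.Quotient.eq.2 ?_
    rw [← map_sub]
    exact hle m (Ideal.Quotient.eq.1 (hs2 m n h))
  let F := IsAdicComplete.liftRingHom (maximalIdeal R) f hf
  have hF : ∀ a : A, F (algebraMap A V a) = ψ a := by
    intro a
    refine sub_eq_zero.1 (IsHausdorff.haus' (I := maximalIdeal R) (M := R) _ fun n => ?_)
    rw [SModEq.zero, smul_eq_mul, Ideal.mul_top]
    apply Ideal.Quotient.eq.1
    rw [IsAdicComplete.mk_liftRingHom]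
    simp only [f, RingHom.comp_apply]
    erw [AlgHom.commutes]
    rfl
  refine ⟨V, inferInstance, hd, hdvr, ϖ, F, hc, hirr, ?_, by rw [hF]; exact h4, by rw [hF]; exact h5⟩
  intro r
  obtain ⟨a, ha⟩ := h1 r
  exact ⟨algebraMap A V a, by rw [hF]; exact ha⟩
end LC
end

section
namespace LC
open IsLocalRing

lemma nak {A N : Type} [CommRing A] (I : Ideal A) [hc : IsAdicComplete I A] [AddCommGroup N] [Module A N]
    [IsHausdorff I N] {r : ℕ} (G : Fin r → N)
    (h : ∀ y, ∃ v : Fin r → A, y - ∑ i, v i • G i ∈ (I • ⊤ : Submodule A N)) : Module.Finite A N := by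
  have hmem : ∀ (J : Ideal A) (v : Fin r → A), v ∈ (J • ⊤ : Submodule A (Fin r → A)) ↔ ∀ i, v i ∈ J := by
    intro J v
    constructor
    · intro hv i
      refine Submodule.smul_induction_on hv ?_ ?_
      · intro a ha b _
        exact J.mul_mem_right _ ha
      · intro a b ha hb
        exact J.add_mem ha hb
    · intro hv
      rw [pi_eq_sum_univ' v]
      exact sum_mem fun i _ => Submodule.smul_mem_smul (hv i) trivial
  haveI : IsPrecomplete I (Fin r → A) := ⟨by
    intro f hf
    have : ∀ i, ∃ L : A, ∀ n, f n i ≡ L [SMOD (I ^ n • ⊤ : Submodule A A)] := by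
      intro i
      refine hc.prec' (fun n => f n i) fun {m n} hmn => ?_
      have := hf hmn
      rw [SModEq.sub_mem, hmem] at this
      rw [SModEq.sub_mem, smul_eq_mul, Ideal.mul_top]
      exact this i
    choose L hL using this
    refine ⟨L, fun n => ?_⟩
    rw [SModEq.sub_mem, hmem]
    intro i
    have := hL i n
    rw [SModEq.sub_mem, smul_eq_mul, Ideal.mul_top] at this
    exact this⟩
  let f : (Fin r → A) →ₗ[A] N := Fintype.linearCombination A G
  have hs : Function.Surjective f := by
    refine surjective_of_mkQ_comp_surjective (I := I) ?_
    intro y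
    obtain ⟨y, rfl⟩ := Submodule.mkQ_surjective _ y
    obtain ⟨v, hv⟩ := h y
    refine ⟨v, ?_⟩
    rw [LinearMap.comp_apply]
    symm
    exact (Submodule.Quotient.eq _).2 (by simpa [f, Fintype.linearCombination_apply] using hv)
  exact Module.Finite.of_surjective f hs

theorem complete_lift {A R : Type} [CommRing A] [CommRing R] (I : Ideal A) (m : Ideal R) [IsAdicComplete m R]
    (ψ : A →+* R) (h4 : I ≤ m.comap ψ) :
    ∃ F : AdicCompletion I A →+* R, ∀ a, F (algebraMap A _ a) = ψ a := by
  have hcmp : ∀ x : AdicCompletion I A, ∃ s : ℕ → A, (∀ n, AdicCompletion.evalₐ I n x = Ideal.Quotient.mk _ (s n)) ∧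
      ∀ m n, m ≤ n → Ideal.Quotient.mk (I ^ m) (s n) = Ideal.Quotient.mk (I ^ m) (s m) := by
    intro x
    induction x using AdicCompletion.induction_on with
    | _ x => exact ⟨x.1, fun n => AdicCompletion.evalₐ_mk I n x, fun m n h => AdicCompletion.Ideal.mk_eq_mk I h x⟩
  have hle : ∀ n, I ^ n ≤ (m ^ n).comap ψ := by
    intro n
    rw [← Ideal.map_le_iff_le_comap, Ideal.map_pow]
    exact Ideal.pow_right_mono (Ideal.map_le_iff_le_comap.2 h4) n
  let f : ∀ n, AdicCompletion I A →+* R ⧸ m ^ n := fun n =>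
    (Ideal.quotientMap _ ψ (hle n)).comp (AdicCompletion.evalₐ I n).toRingHom
  have hf : ∀ {i n : ℕ} (hle : i ≤ n), (Ideal.Quotient.factorPow m hle).comp (f n) = f i := by
    intro i n h
    ext x
    obtain ⟨s, hs1, hs2⟩ := hcmp x
    have e1 : ∀ n, f n x = Ideal.Quotient.mk _ (ψ (s n)) := fun n => by
      have := hs1 n
      change Ideal.quotientMap _ ψ (hle n) (AdicCompletion.evalₐ I n x) = _
      rw [this, Ideal.quotientMap_mk]
    rw [RingHom.comp_apply, e1, e1]
    refine Ideal.Quotient.eq.2 ?_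
    rw [← map_sub]
    exact hle i (Ideal.Quotient.eq.1 (hs2 i n h))
  refine ⟨IsAdicComplete.liftRingHom m f hf, fun a => ?_⟩
  refine sub_eq_zero.1 (IsHausdorff.haus' (I := m) (M := R) _ fun n => ?_)
  rw [SModEq.zero, smul_eq_mul, Ideal.mul_top]
  apply Ideal.Quotient.eq.1
  rw [IsAdicComplete.mk_liftRingHom]
  simp only [f, RingHom.comp_apply]
  erw [AlgHom.commutes]
  rfl

lemma haus_of {A R N : Type} [CommRing A] [CommRing R] [Algebra A R] [AddCommGroup N] [Module A N]
    [Module R N] [IsScalarTower A R N] (I : Ideal A) (m : Ideal R) (hI : ∀ a ∈ I, algebraMap A R a ∈ m)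
    [hm : IsHausdorff m N] : IsHausdorff I N := by
  refine ⟨fun x hx => hm.haus' x fun n => ?_⟩
  have := hx n
  rw [SModEq.zero] at this ⊢
  have hp : ∀ a ∈ I ^ n, algebraMap A R a ∈ m ^ n := by
    have h1 : I ≤ m.comap (algebraMap A R) := hI
    have : I ^ n ≤ (m ^ n).comap (algebraMap A R) := by
      rw [← Ideal.map_le_iff_le_comap, Ideal.map_pow]
      exact Ideal.pow_right_mono (Ideal.map_le_iff_le_comap.2 h1) n
    exact this
  refine Submodule.smul_induction_on this ?_ ?_
  · intro a ha y _
    rw [← algebraMap_smul R a y]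
    exact Submodule.smul_mem_smul (hp a ha) trivial
  · intro a b ha hb
    exact add_mem ha hb

theorem norm_exists (R : Type) [CommRing R] [IsNoetherianRing R] [IsLocalRing R]
    [IsAdicComplete (maximalIdeal R) R] {V : Type} [CommRing V] (π : V) [IsAdicComplete (Ideal.span {π}) V]
    (ψ : V →+* R) (hsur : ∀ r, ∃ a, r - ψ a ∈ maximalIdeal R) (hπ : ψ π ∈ maximalIdeal R)
    {σ : Type} [Finite σ] (x : σ → R) (hx : ∀ i, x i ∈ maximalIdeal R)
    (e : ℕ) (he : maximalIdeal R ^ e ≤ Ideal.span (Set.range x) ⊔ Ideal.span {ψ π}) :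
    ∃ F : MvPowerSeries σ V →+* R, (∀ v, F (MvPowerSeries.C v) = ψ v) ∧
      (∀ i, F (MvPowerSeries.X i) = x i) ∧ F.Finite := by
  obtain ⟨F0, hF0⟩ := complete_lift (MvPolynomial.idealOfVars σ V) (maximalIdeal R)
    (MvPolynomial.eval₂Hom ψ x) (by
      rw [MvPolynomial.idealOfVars, Ideal.span_le]
      rintro _ ⟨i, rfl⟩
      simpa using hx i)
  let F : MvPowerSeries σ V →+* R := F0.comp (MvPowerSeries.toAdicCompletionAlgEquiv σ V).toRingEquiv.toRingHom
  have hF : ∀ q : MvPolynomial σ V, F (q : MvPowerSeries σ V) = MvPolynomial.eval₂Hom ψ x q := by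
    intro q
    rw [← hF0]
    change F0 (MvPowerSeries.toAdicCompletion σ V q) = _
    rw [MvPowerSeries.toAdicCompletion_coe]
    rfl
  have hC : ∀ v, F (MvPowerSeries.C v) = ψ v := fun v => by
    rw [← MvPolynomial.coe_C, hF]; simp
  have hX : ∀ i, F (MvPowerSeries.X i) = x i := fun i => by
    rw [← MvPolynomial.coe_X, hF]; simp
  refine ⟨F, hC, hX, ?_⟩
  letI algV : Algebra V R := ψ.toAlgebra
  have hsm : ∀ (v : V) (r : R), v • r = ψ v * r := fun v r => rfl
  -- approximation modulo powers
  have app : ∀ e : ℕ, ∃ (s : ℕ) (G : Fin s → R), ∀ r, ∃ v : Fin s → V,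
      r - ∑ i, v i • G i ∈ maximalIdeal R ^ e := by
    intro e
    induction e with
    | zero => exact ⟨0, fun _ => 0, fun r => ⟨fun _ => 0, by simp⟩⟩
    | succ e ih =>
      obtain ⟨s, G, hG⟩ := ih
      obtain ⟨t, H, hH⟩ := Submodule.fg_iff_exists_fin_generating_family.1
        ((isNoetherianRing_iff_ideal_fg R).1 inferInstance (maximalIdeal R ^ e))
      refine ⟨s + t, Fin.append G H, fun r => ?_⟩
      obtain ⟨v, hv⟩ := hG r
      rw [← hH, Submodule.mem_span_range_iff_exists_fun] at hv
      obtain ⟨c, hc⟩ := hv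
      choose a ha using fun j => hsur (c j)
      refine ⟨Fin.append v a, ?_⟩
      rw [Fin.sum_univ_add]
      simp only [Fin.append_left, Fin.append_right]
      rw [← sub_sub, ← hc, ← Finset.sum_sub_distrib]
      refine sum_mem fun j _ => ?_
      rw [hsm, smul_eq_mul, ← sub_mul, pow_succ']
      exact Ideal.mul_mem_mul (ha j) (by rw [← hH]; exact Submodule.subset_span ⟨j, rfl⟩)
  let J : Ideal R := Ideal.span (Set.range x)
  have hfin1 : Module.Finite V (R ⧸ J) := by
    obtain ⟨s, G, hG⟩ := app e
    haveI : IsHausdorff (Ideal.span {π}) (R ⧸ J) := by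
      refine haus_of (R := R) (Ideal.span {π}) (maximalIdeal R) ?_
      intro a ha
      obtain ⟨b, rfl⟩ := Ideal.mem_span_singleton.1 ha
      rw [map_mul]
      exact Ideal.mul_mem_right _ _ hπ
    refine nak (Ideal.span {π}) (fun i => Ideal.Quotient.mk J (G i)) fun y => ?_
    obtain ⟨y, rfl⟩ := Ideal.Quotient.mk_surjective y
    obtain ⟨v, hv⟩ := hG y
    refine ⟨v, ?_⟩
    have e1 : Ideal.Quotient.mk J y - ∑ i, v i • Ideal.Quotient.mk J (G i) =
        Ideal.Quotient.mk J (y - ∑ i, v i • G i) := by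
      rw [map_sub, map_sum]; rfl
    rw [e1]
    obtain ⟨a, ha, b, hb, hab⟩ := Submodule.mem_sup.1 (he hv)
    obtain ⟨c, rfl⟩ := Ideal.mem_span_singleton.1 hb
    rw [← hab, map_add, Ideal.Quotient.eq_zero_iff_mem.2 ha, zero_add]
    exact Submodule.smul_mem_smul (Ideal.mem_span_singleton_self π) (n := Ideal.Quotient.mk J c) trivial
  letI algS : Algebra (MvPowerSeries σ V) R := F.toAlgebra
  change Module.Finite (MvPowerSeries σ V) R
  obtain ⟨s, G, hG⟩ := Module.Finite.exists_fin (R := V) (M := R ⧸ J)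
  choose g hg using fun i => Ideal.Quotient.mk_surjective (G i)
  haveI : IsHausdorff (Ideal.span (Set.range MvPowerSeries.X) : Ideal (MvPowerSeries σ V)) R := by
    refine haus_of (R := R) _ (maximalIdeal R) ?_
    change _ ≤ (maximalIdeal R).comap F
    rw [Ideal.span_le]
    rintro _ ⟨i, rfl⟩
    change F _ ∈ maximalIdeal R
    rw [hX]; exact hx i
  refine nak (Ideal.span (Set.range MvPowerSeries.X)) g fun y => ?_
  have hy : Ideal.Quotient.mk J y ∈ Submodule.span V (Set.range G) := by rw [hG]; trivial
  obtain ⟨v, hv⟩ := (Submodule.mem_span_range_iff_exists_fun V).1 hy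
  refine ⟨fun i => MvPowerSeries.C (v i), ?_⟩
  have e2 : y - ∑ i, (MvPowerSeries.C (v i) : MvPowerSeries σ V) • g i ∈ J := by
    apply Ideal.Quotient.eq.1
    rw [← hv, map_sum]
    refine Finset.sum_congr rfl fun i _ => ?_
    rw [← hg i]
    change _ = Ideal.Quotient.mk J (F _ * g i)
    rw [hC]; rfl
  refine Submodule.span_induction (p := fun z _ => z ∈ (Ideal.span (Set.range MvPowerSeries.X) • ⊤ : Submodule (MvPowerSeries σ V) R)) ?_ ?_ ?_ ?_ e2
  · rintro _ ⟨i, rfl⟩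
    have := Submodule.smul_mem_smul (Ideal.subset_span ⟨i, rfl⟩ : (MvPowerSeries.X i : MvPowerSeries σ V) ∈ Ideal.span (Set.range MvPowerSeries.X)) (n := (1 : R)) (N := ⊤) trivial
    have e3 : (MvPowerSeries.X i : MvPowerSeries σ V) • (1 : R) = x i := by
      change F _ * 1 = _
      rw [hX, mul_one]
    rwa [e3] at this
  · exact zero_mem _
  · intro a b _ _ ha hb; exact add_mem ha hb
  · intro c z _ hz
    refine Submodule.smul_induction_on hz ?_ ?_
    · intro a ha b _
      rw [smul_eq_mul, mul_smul_comm]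
      exact Submodule.smul_mem_smul ha trivial
    · intro a b ha hb
      rw [smul_add]; exact add_mem ha hb
end LC
end

section
namespace LC
open MvPowerSeries

section
variable {V : Type} [CommRing V] {σ : Type} [Fintype σ] [DecidableEq σ]

lemma crit (c : V) (k : ℕ) (τ : Finset σ) : ∀ (s : MvPowerSeries σ V)
    (_ : ∀ α : σ →₀ ℕ, (∀ i ∈ τ, α i < k) → c ∣ coeff α s),
    s ∈ Ideal.span ((fun i => (X i : MvPowerSeries σ V) ^ k) '' τ) ⊔ Ideal.span {C c} := by
  induction τ using Finset.induction_on with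
  | empty =>
    intro s h
    have : ∃ t : MvPowerSeries σ V, ∀ α, coeff α s = c * coeff α t := by
      choose t ht using fun α => h α (by simp)
      exact ⟨t, ht⟩
    obtain ⟨t, ht⟩ := this
    refine Ideal.mem_sup_right (Ideal.mem_span_singleton.2 ⟨t, ?_⟩)
    ext α
    rw [coeff_C_mul, ht]
  | insert i τ hi ih =>
    intro s h
    let s1 : MvPowerSeries σ V := fun α => if α i < k then coeff α s else 0
    have h1 : s1 ∈ _ := ih s1 (by
      intro α hα
      change c ∣ if α i < k then coeff α s else 0
      split_ifs with h2
      · refine h α fun j hj => ?_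
        rcases Finset.mem_insert.1 hj with rfl | hj
        · exact h2
        · exact hα j hj
      · exact dvd_zero _)
    have h2 : X i ^ k ∣ s - s1 := by
      rw [X_pow_dvd_iff]
      intro α hα
      rw [map_sub]
      change _ - (if α i < k then coeff α s else 0) = 0
      rw [if_pos hα, sub_self]
    obtain ⟨q, hq⟩ := h2
    rw [← sub_add_cancel s s1, hq]
    have hle : Ideal.span ((fun i => (X i : MvPowerSeries σ V) ^ k) '' τ) ⊔ Ideal.span {C c} ≤
        Ideal.span ((fun i => (X i : MvPowerSeries σ V) ^ k) '' (insert i τ : Finset σ)) ⊔ Ideal.span {C c} :=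
      sup_le_sup_right (Ideal.span_mono (Set.image_mono (by
        intro j hj; exact Finset.mem_coe.2 (Finset.mem_insert_of_mem hj)))) _
    refine add_mem (Ideal.mem_sup_left (Ideal.mul_mem_right _ _ (Ideal.subset_span ⟨i, by simp, rfl⟩)))
      (hle h1)

lemma crit_conv (c : V) (k : ℕ) (τ : Finset σ) (s : MvPowerSeries σ V)
    (hs : s ∈ Ideal.span ((fun i => (X i : MvPowerSeries σ V) ^ k) '' τ) ⊔ Ideal.span {C c})
    (α : σ →₀ ℕ) (hα : ∀ i ∈ τ, α i < k) : c ∣ coeff α s := by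
  obtain ⟨a, ha, b, hb, rfl⟩ := Submodule.mem_sup.1 hs
  obtain ⟨b, rfl⟩ := Ideal.mem_span_singleton.1 hb
  rw [map_add, coeff_C_mul]
  have h0 : coeff α a = 0 := by
    refine Submodule.span_induction (p := fun a _ => ∀ b, coeff α (b * a) = 0) ?_ ?_ ?_ ?_ ha 1 |> fun h => by simpa using h
    · rintro _ ⟨i, hi, rfl⟩ b
      exact X_pow_dvd_iff.1 (Dvd.intro_left b rfl) α (hα i hi)
    · intro b; simp
    · intro x y _ _ hx hy b
      rw [mul_add, map_add, hx, hy, add_zero]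
    · intro c x _ hx b
      rw [smul_eq_mul, ← mul_assoc]; exact hx _
  rw [h0, zero_add]
  exact dvd_mul_right _ _

/-- parameters of the power series ring -/
noncomputable def uu (π : V) : Option σ → MvPowerSeries σ V
  | none => C π
  | some i => X i

lemma uu_pow_mem (π : V) (i0 : Option σ) (k : ℕ) (s : MvPowerSeries σ V)
    (h : ∀ α : σ →₀ ℕ, (∀ i, some i ≠ i0 → α i < k) → (if i0 = none then 0 else π ^ k) ∣ coeff α s) :
    s ∈ Ideal.span ((fun i => uu π i ^ k) '' {i | i ≠ i0}) := by
  have h1 := crit (if i0 = none then 0 else π ^ k) k (Finset.univ.filter fun i => some i ≠ i0) s (by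
    intro α hα
    exact h α fun i hi => hα i (by simpa using hi))
  revert h1
  refine fun h1 => (show _ ≤ Ideal.span ((fun i => uu π i ^ k) '' {i | i ≠ i0}) from sup_le ?_ ?_) h1
  · rw [Ideal.span_le]
    rintro _ ⟨i, hi, rfl⟩
    exact Ideal.subset_span ⟨some i, by simpa using hi, rfl⟩
  · rw [Ideal.span_singleton_le_iff_mem]
    split_ifs with h2
    · simp
    · rw [map_pow]
      exact Ideal.subset_span ⟨none, fun h => h2 h.symm, rfl⟩

lemma uu_all (π : V) (k : ℕ) (s : MvPowerSeries σ V) :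
    s ∈ Ideal.span (Set.range fun i => uu π i ^ k) ↔
      ∀ α : σ →₀ ℕ, (∀ i, α i < k) → π ^ k ∣ coeff α s := by
  have : Ideal.span (Set.range fun i : Option σ => uu π i ^ k) =
      Ideal.span ((fun i => (X i : MvPowerSeries σ V) ^ k) '' (Finset.univ : Finset σ)) ⊔ Ideal.span {C (π ^ k)} := by
    apply le_antisymm
    · rw [Ideal.span_le]
      rintro _ ⟨i, rfl⟩
      cases i with
      | none => exact Ideal.mem_sup_right (by simp [uu, Ideal.mem_span_singleton_self])
      | some i => exact Ideal.mem_sup_left (Ideal.subset_span ⟨i, by simp, rfl⟩)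
    · refine sup_le ?_ ?_
      · rw [Ideal.span_le]
        rintro _ ⟨i, -, rfl⟩
        exact Ideal.subset_span ⟨some i, rfl⟩
      · rw [Ideal.span_singleton_le_iff_mem, map_pow]
        exact Ideal.subset_span ⟨none, rfl⟩
  rw [this]
  constructor
  · intro h α hα
    exact crit_conv _ k _ s h α fun i _ => hα i
  · intro h
    exact crit _ k _ s fun α hα => h α fun i => hα i (by simp)

lemma uu_cancel [IsDomain V] {π : V} (hπ : π ≠ 0) (N l : ℕ) (g : MvPowerSeries σ V)
    (h : (∏ i, uu π i) ^ l * g ∈ Ideal.span (Set.range fun i : Option σ => uu π i ^ (N + l))) :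
    g ∈ Ideal.span (Set.range fun i : Option σ => uu π i ^ N) := by
  rw [uu_all] at h ⊢
  intro α hα
  have h1 := h (α + Finsupp.equivFunOnFinite.symm fun _ => l) (fun i => by simpa using hα i)
  have e1 : (∏ i : Option σ, uu π i) ^ l =
      C (π ^ l) * monomial (Finsupp.equivFunOnFinite.symm fun _ : σ => l) (1 : V) := by
    rw [Fintype.prod_option, mul_pow]
    congr 1
    · simp [uu]
    · rw [← Finset.prod_pow]
      have : ∀ τ : Finset σ, ∏ i ∈ τ, (uu π (some i) : MvPowerSeries σ V) ^ l =
          monomial (∑ i ∈ τ, Finsupp.single i l) (1 : V) := by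
        intro τ
        induction τ using Finset.induction_on with
        | empty => simp
        | insert i τ hi ih =>
          rw [Finset.prod_insert hi, Finset.sum_insert hi, ih]
          simp only [uu, X_pow_eq, monomial_mul_monomial, one_mul]
      rw [this]
      congr 2
      ext i
      simp [Finsupp.finset_sum_apply, Finsupp.single_apply]
  rw [e1, mul_assoc, coeff_C_mul, add_comm α, coeff_add_monomial_mul, one_mul, add_comm N l, pow_add] at h1
  exact (mul_dvd_mul_iff_left (pow_ne_zero _ hπ)).1 h1

lemma uu_haus {π : V} [hc : IsAdicComplete (Ideal.span {π}) V] (g : MvPowerSeries σ V)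
    (h : ∀ N, g ∈ Ideal.span (Set.range fun i : Option σ => uu π i ^ N)) : g = 0 := by
  ext α
  rw [map_zero]
  refine hc.haus' _ fun n => ?_
  rw [SModEq.zero, smul_eq_mul, Ideal.mul_top, Ideal.span_singleton_pow]
  have := (uu_all π (n + (∑ i, α i) + 1) g).1 (h _) α (fun i => by
    have : α i ≤ ∑ i, α i := Finset.single_le_sum (f := fun i => α i) (fun _ _ => Nat.zero_le _) (Finset.mem_univ i)
    omega)
  exact Ideal.mem_span_singleton.2 ((pow_dvd_pow _ (by omega)).trans this)

lemma uu_max [IsDomain V] [IsDiscreteValuationRing V] {π : V} (hπ : Irreducible π) :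
    IsLocalRing.maximalIdeal (MvPowerSeries σ V) = Ideal.span (Set.range (uu (σ := σ) π)) := by
  apply le_antisymm
  · intro s hs
    have h1 : ¬ IsUnit (constantCoeff s) := fun h => hs (isUnit_iff_constantCoeff.2 h)
    have h2 : constantCoeff s ∈ IsLocalRing.maximalIdeal V := h1
    rw [hπ.maximalIdeal_eq, Ideal.mem_span_singleton] at h2
    have := (uu_all (σ := σ) π 1 s).2 (by
      intro α hα
      have : α = 0 := by ext i; simpa using hα i
      rw [this, pow_one]; simpa using h2)
    simpa using this
  · rw [Ideal.span_le]
    rintro _ ⟨i, rfl⟩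
    intro h
    have := h.map (constantCoeff (σ := σ) (R := V))
    cases i with
    | none => exact hπ.not_isUnit (by simpa [uu] using this)
    | some i => simp [uu] at this
end
end LC
end

section
namespace LC
open MvPowerSeries

lemma dim_le_of_integral {A B : Type} [CommRing A] [CommRing B] (f : A →+* B) (hf : f.IsIntegral) :
    ringKrullDim B ≤ ringKrullDim A := by
  let _ : Algebra A B := f.toAlgebra
  have : Algebra.IsIntegral A B := ⟨hf⟩
  refine Order.krullDim_le_of_strictMono (PrimeSpectrum.comap f) ?_
  intro p q hpq
  have h : p.asIdeal < q.asIdeal := hpq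
  exact Ideal.IsIntegral.comap_lt_comap (R := A) h

lemma norm_inj {V : Type} [CommRing V] [IsDomain V] [IsDiscreteValuationRing V] {σ : Type} [Fintype σ]
    {π : V} (hπ : Irreducible π) {R : Type} [CommRing R] [IsDomain R]
    (F : MvPowerSeries σ V →+* R) (hF : F.Finite)
    (hdim : ringKrullDim R = ((Fintype.card σ + 1 : ℕ) : WithBot ℕ∞)) : Function.Injective F := by
  classical
  rw [injective_iff_map_eq_zero]
  intro s hs
  by_contra hs0
  have h1 : ringKrullDim (MvPowerSeries σ V) ≤ ((Fintype.card σ + 1 : ℕ) : WithBot ℕ∞) := by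
    refine (ringKrullDim_le_spanFinrank_maximalIdeal _).trans ?_
    rw [uu_max hπ]
    have h2 := Submodule.spanFinrank_span_le_ncard_of_finite (R := MvPowerSeries σ V)
      (Set.finite_range (uu (σ := σ) π))
    have h3 : (Set.range (uu (σ := σ) π)).ncard ≤ Fintype.card σ + 1 := by
      rw [← Set.image_univ]
      refine (Set.ncard_image_le Set.finite_univ).trans ?_
      rw [Set.ncard_univ, Nat.card_eq_fintype_card, Fintype.card_option]
    exact_mod_cast h2.trans h3
  have h2 := ringKrullDim_quotient_succ_le_of_nonZeroDivisor (mem_nonZeroDivisors_of_ne_zero hs0)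
  have h3 : ringKrullDim R ≤ ringKrullDim (MvPowerSeries σ V ⧸ Ideal.span {s}) := by
    let G : MvPowerSeries σ V ⧸ Ideal.span {s} →+* R := Ideal.Quotient.lift _ F (by
      intro a ha
      obtain ⟨b, rfl⟩ := Ideal.mem_span_singleton.1 ha
      rw [map_mul, hs, zero_mul])
    refine dim_le_of_integral G ?_
    have h4 : F.IsIntegral := hF.to_isIntegral
    have h5 : F = G.comp (Ideal.Quotient.mk _) := by ext; rfl
    rw [h5] at h4
    exact RingHom.IsIntegral.tower_top _ _ h4
  have h6 : ringKrullDim R + 1 ≤ ((Fintype.card σ + 1 : ℕ) : WithBot ℕ∞) :=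
    (add_le_add_left h3 1).trans (h2.trans h1)
  rw [hdim] at h6
  have : Fintype.card σ + 1 + 1 ≤ Fintype.card σ + 1 := by exact_mod_cast h6
  omega

end LC
end

section
namespace LC

section
variable {R : Type} [CommRing R]

/-- saturation of an ideal -/
def satI (y : R) (J : Ideal R) : Ideal R where
  carrier := {r | ∃ N, y ^ N * r ∈ J}
  zero_mem' := ⟨0, by simp⟩
  add_mem' := by
    rintro a b ⟨N, hN⟩ ⟨M, hM⟩
    refine ⟨N + M, ?_⟩
    have : y ^ (N + M) * (a + b) = y ^ M * (y ^ N * a) + y ^ N * (y ^ M * b) := by ring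
    rw [this]
    exact add_mem (J.mul_mem_left _ hN) (J.mul_mem_left _ hM)
  smul_mem' := by
    rintro c a ⟨N, hN⟩
    refine ⟨N, ?_⟩
    rw [smul_eq_mul, mul_left_comm]
    exact J.mul_mem_left _ hN

variable {ι : Type} [Fintype ι] [DecidableEq ι]

/-- powers of all but one of the parameters -/
def JJ (x : ι → R) (i0 : ι) (m : ℕ) : Ideal R := Ideal.span ((fun i => x i ^ m) '' {i | i ≠ i0})

/-- numerators of the classes to be killed -/
def KK (x : ι → R) (i0 : ι) (y : R) (m : ℕ) : Ideal R := satI y (JJ x i0 m) ⊔ Ideal.span {x i0 ^ m}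

/-- monomials -/
def DD (x : ι → R) (β : ι → ℕ) : R := ∏ i, x i ^ β i

lemma DD_add (x : ι → R) (β γ : ι → ℕ) : DD x (β + γ) = DD x β * DD x γ := by
  simp [DD, pow_add, Finset.prod_mul_distrib]

lemma DD_dvd (x : ι → R) (β : ι → ℕ) (i : ι) : x i ^ β i ∣ DD x β :=
  Finset.dvd_prod_of_mem (fun i => x i ^ β i) (Finset.mem_univ i)

lemma JJ_mul {x : ι → R} {i0 : ι} {k m : ℕ} {c r : R} (hc : ∀ i, i ≠ i0 → x i ^ m ∣ x i ^ k * c)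
    (hr : r ∈ JJ x i0 k) : r * c ∈ JJ x i0 m := by
  refine Submodule.span_induction (p := fun a _ => a * c ∈ JJ x i0 m) ?_ ?_ ?_ ?_ hr
  · rintro _ ⟨i, hi, rfl⟩
    obtain ⟨d, hd⟩ := hc i hi
    simp only
    rw [hd]
    exact Ideal.mul_mem_right _ _ (Ideal.subset_span ⟨i, hi, rfl⟩)
  · simp
  · intro a b _ _ ha hb
    rw [add_mul]; exact add_mem ha hb
  · intro d a _ ha
    rw [smul_eq_mul, mul_assoc]; exact Ideal.mul_mem_left _ _ ha

lemma KK_bump {x : ι → R} {i0 : ι} {y r : R} {m : ℕ} (k : ℕ) (hr : r ∈ KK x i0 y m) :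
    r * DD x (fun _ => k) ∈ KK x i0 y (m + k) := by
  obtain ⟨a, ⟨N, ha⟩, b, hb, rfl⟩ := Submodule.mem_sup.1 hr
  obtain ⟨b, rfl⟩ := Ideal.mem_span_singleton.1 hb
  rw [add_mul]
  refine add_mem (Ideal.mem_sup_left ⟨N, ?_⟩) (Ideal.mem_sup_right ?_)
  · rw [← mul_assoc]
    refine JJ_mul (fun i _ => ?_) ha
    rw [pow_add]
    exact mul_dvd_mul_left _ (DD_dvd x (fun _ => k) i)
  · rw [Ideal.mem_span_singleton, pow_add]
    obtain ⟨c, hc⟩ := DD_dvd x (fun _ => k) i0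
    rw [hc]
    exact ⟨b * c, by ring⟩

variable [IsDomain R]

/-- the fraction `r / x ^ β` -/
noncomputable def fr (x : ι → R) (r : R) (β : ι → ℕ) : FractionRing R :=
  algebraMap R _ r / algebraMap R _ (DD x β)

lemma fr_den {x : ι → R} (hx : ∀ i, x i ≠ 0) (β : ι → ℕ) : algebraMap R (FractionRing R) (DD x β) ≠ 0 := by
  rw [Ne, IsFractionRing.to_map_eq_zero_iff]
  exact Finset.prod_ne_zero_iff.2 fun i _ => pow_ne_zero _ (hx i)

lemma fr_eq {x : ι → R} (hx : ∀ i, x i ≠ 0) (r s : R) (β γ : ι → ℕ) :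
    fr x r β = fr x s γ ↔ r * DD x γ = s * DD x β := by
  rw [fr, fr, div_eq_div_iff (fr_den hx β) (fr_den hx γ), ← map_mul, ← map_mul]
  exact (IsFractionRing.injective R (FractionRing R)).eq_iff

lemma fr_add (x : ι → R) (r s : R) (β : ι → ℕ) : fr x (r + s) β = fr x r β + fr x s β := by
  rw [fr, map_add, add_div]; rfl

lemma fr_smul (x : ι → R) (r s : R) (β : ι → ℕ) : fr x (r * s) β = r • fr x s β := by
  rw [fr, map_mul, mul_div_assoc, Algebra.smul_def]; rfl

lemma fr_bump {x : ι → R} (hx : ∀ i, x i ≠ 0) (r : R) (β γ : ι → ℕ) :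
    fr x (r * DD x γ) (β + γ) = fr x r β := by
  rw [fr_eq hx, DD_add]; ring

/-- the module of classes to be killed -/
noncomputable def AA (x : ι → R) (hx : ∀ i, x i ≠ 0) (i0 : ι) (y : R) : Submodule R (FractionRing R) where
  carrier := {t | ∃ m, ∃ r ∈ KK x i0 y m, t = fr x r fun _ => m}
  zero_mem' := ⟨0, 0, zero_mem _, by simp [fr]⟩
  add_mem' := by
    rintro _ _ ⟨m, r, hr, rfl⟩ ⟨m', r', hr', rfl⟩
    refine ⟨m + m', r * DD x (fun _ => m') + r' * DD x (fun _ => m), add_mem (KK_bump m' hr) ?_, ?_⟩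
    · rw [add_comm m m']
      exact KK_bump m hr'
    · rw [fr_add]
      congr 1
      · exact (fr_bump hx r (fun _ => m) (fun _ => m')).symm
      · rw [← fr_bump hx r' (fun _ => m') (fun _ => m)]
        congr 1
        funext i; exact add_comm _ _
  smul_mem' := by
    rintro c _ ⟨m, r, hr, rfl⟩
    exact ⟨m, c * r, Ideal.mul_mem_left _ _ hr, (fr_smul x c r _).symm⟩

lemma fr_top {x : ι → R} (hx : ∀ i, x i ≠ 0) (r : R) (β : ι → ℕ) (m : ℕ) (hm : ∀ i, β i ≤ m) :
    fr x r β = fr x (r * DD x (fun i => m - β i)) (fun _ => m) := by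
  rw [← fr_bump hx r β (fun i => m - β i)]
  congr 1
  funext i
  exact Nat.add_sub_cancel' (hm i)

lemma exists_bd (β : ι → ℕ) : ∃ m, ∀ i, β i ≤ m :=
  ⟨∑ i, β i, fun i => Finset.single_le_sum (f := fun i => β i) (fun _ _ => Nat.zero_le _) (Finset.mem_univ i)⟩

lemma AA_of_zero {x : ι → R} (hx : ∀ i, x i ≠ 0) (i0 : ι) (y : R) (r : R) (β : ι → ℕ) (i : ι)
    (hi : β i = 0) : fr x r β ∈ AA x hx i0 y := by
  obtain ⟨m, hm⟩ := exists_bd β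
  refine ⟨m, _, ?_, fr_top hx r β m hm⟩
  have h := DD_dvd x (fun i => m - β i) i
  simp only [hi, Nat.sub_zero] at h
  obtain ⟨c, hc⟩ := h
  rw [hc]
  by_cases h : i = i0
  · subst h
    exact Ideal.mem_sup_right (Ideal.mem_span_singleton.2 ⟨r * c, by ring⟩)
  · refine Ideal.mem_sup_left ⟨0, ?_⟩
    have : y ^ 0 * (r * (x i ^ m * c)) = x i ^ m * (r * c) := by ring
    rw [this]
    exact Ideal.mul_mem_right _ _ (Ideal.subset_span ⟨i, h, rfl⟩)

lemma AA_of_pow {x : ι → R} (hx : ∀ i, x i ≠ 0) (i0 : ι) (y : R) (w : R) (β : ι → ℕ) (k M : ℕ)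
    (hβ : ∀ i, i ≠ i0 → β i ≤ k) (hw : y ^ M * w ∈ JJ x i0 k) : fr x w β ∈ AA x hx i0 y := by
  obtain ⟨m, hm⟩ := exists_bd β
  refine ⟨m, _, Ideal.mem_sup_left ⟨M, ?_⟩, fr_top hx w β m hm⟩
  rw [← mul_assoc]
  refine JJ_mul (fun i hi => ?_) hw
  obtain ⟨c, hc⟩ := DD_dvd x (fun i => m - β i) i
  rw [hc, ← mul_assoc, ← pow_add]
  refine Dvd.dvd.mul_right (pow_dvd_pow _ ?_) _
  have := hm i
  have := hβ i hi
  omega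

lemma E_of {x : ι → R} (hx : ∀ i, x i ≠ 0) (i0 : ι) (y : R)
    (H : ∀ r β, fr x r β ∈ AA x hx i0 y) (hy : y ∈ (Ideal.span (Set.range x)).radical)
    (k : ℕ) (r : R) : ∃ m N t, y ^ N * (x i0 * t - (∏ i ∈ Finset.univ.erase i0, x i) ^ m * r) ∈
      JJ x i0 (k + m) := by
  have hi : i0 = i0 := rfl
  let β : ι → ℕ := fun i => if i = i0 then 1 else k
  obtain ⟨m0, r', hr', he⟩ := H r β
  have h1 := KK_bump (k + 1) hr'
  have he' : fr x r β = fr x (r' * DD x fun _ => k + 1) (fun _ => m0 + (k + 1)) := by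
    rw [he]; exact (fr_bump hx r' (fun _ => m0) (fun _ => k + 1)).symm
  have hβ : ∀ i, β i ≤ m0 + (k + 1) := by
    intro i; simp only [β]; split_ifs <;> omega
  rw [fr_top hx r β (m0 + (k + 1)) hβ, fr_eq hx] at he'
  have h2 := mul_right_cancel₀ (Finset.prod_ne_zero_iff.2 fun i _ => pow_ne_zero _ (hx i)) he'
  rw [← h2] at h1
  have h3 : DD x (fun i => m0 + (k + 1) - β i) = x i0 ^ (m0 + k) * (∏ i ∈ Finset.univ.erase i0, x i) ^ (m0 + 1) := by
    rw [DD, ← Finset.mul_prod_erase _ _ (Finset.mem_univ i0), ← Finset.prod_pow]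
    congr 1
    · congr 1; simp [β]
    · refine Finset.prod_congr rfl fun i hi => ?_
      have : i ≠ i0 := (Finset.mem_erase.1 hi).1
      congr 1
      simp only [β, if_neg this]; omega
  rw [h3] at h1
  obtain ⟨a, ⟨N, ha⟩, b, hb, hab⟩ := Submodule.mem_sup.1 h1
  obtain ⟨b, rfl⟩ := Ideal.mem_span_singleton.1 hb
  have h4 : ∃ e, y ^ e ∈ JJ x i0 (k + (m0 + 1)) ⊔ Ideal.span {x i0 ^ (m0 + k)} := by
    change y ∈ (JJ x i0 (k + (m0 + 1)) ⊔ Ideal.span {x i0 ^ (m0 + k)}).radical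
    have : (Ideal.span (Set.range x)).radical ≤ (JJ x i0 (k + (m0 + 1)) ⊔ Ideal.span {x i0 ^ (m0 + k)}).radical := by
      rw [Ideal.radical_le_radical_iff, Ideal.span_le]
      rintro _ ⟨i, rfl⟩
      by_cases h : i = i0
      · subst h
        exact ⟨m0 + k, Ideal.mem_sup_right (Ideal.mem_span_singleton_self _)⟩
      · exact ⟨k + (m0 + 1), Ideal.mem_sup_left (Ideal.subset_span ⟨i, h, rfl⟩)⟩
    exact this hy
  obtain ⟨e, h4⟩ := h4
  obtain ⟨c, hc, d, hd, hcd⟩ := Submodule.mem_sup.1 h4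
  obtain ⟨d, rfl⟩ := Ideal.mem_span_singleton.1 hd
  refine ⟨m0 + 1, e + N, b, ?_⟩
  set X := ∏ i ∈ Finset.univ.erase i0, x i
  have e1 : y ^ (e + N) * (x i0 * b - X ^ (m0 + 1) * r) =
      c * (y ^ N * (x i0 * b - X ^ (m0 + 1) * r)) - d * (y ^ N * a) := by
    have ha' : a = r * (x i0 ^ (m0 + k) * X ^ (m0 + 1)) - x i0 ^ (m0 + (k + 1)) * b := by rw [← hab]; ring
    rw [ha', pow_add, ← hcd]; ring
  rw [e1]
  refine sub_mem (Ideal.mul_mem_right _ _ hc) (Ideal.mul_mem_left _ _ ?_)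
  have : k + (m0 + 1) = m0 + (k + 1) := by ring
  rw [this]; exact ha

end
end LC
end

section
namespace LC

section
variable (V : Type) [CommRing V] [IsDomain V]

/-- the injective hull of the residue field of a discrete valuation ring -/
abbrev QV : Type := FractionRing V ⧸ LinearMap.range (Algebra.linearMap V (FractionRing V))

lemma QV_inj [IsPrincipalIdealRing V] : Module.Injective V (QV V) := by
  apply Module.Baer.injective
  intro I g
  obtain ⟨b, rfl⟩ := IsPrincipalIdealRing.principal I
  have hb : b ∈ Submodule.span V {b} := Submodule.mem_span_singleton_self b
  by_cases h0 : b = 0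
  · refine ⟨0, fun x hx => ?_⟩
    have : x = 0 := by
      obtain ⟨c, rfl⟩ := Submodule.mem_span_singleton.1 hx
      rw [h0, smul_zero]
    subst this
    rw [LinearMap.zero_apply]
    exact (map_zero g).symm
  · obtain ⟨q, hq⟩ := Submodule.Quotient.mk_surjective _ (g ⟨b, hb⟩)
    refine ⟨LinearMap.toSpanSingleton V _ (Submodule.Quotient.mk (q / algebraMap V _ b)), fun x hx => ?_⟩
    obtain ⟨c, rfl⟩ := Submodule.mem_span_singleton.1 hx
    have h1 : (⟨c • b, hx⟩ : Submodule.span V {b}) = c • ⟨b, hb⟩ := rfl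
    rw [h1, map_smul g, ← hq, LinearMap.toSpanSingleton_apply, smul_eq_mul, mul_smul,
      ← Submodule.Quotient.mk_smul _ b]
    congr 2
    rw [Algebra.smul_def]
    have : algebraMap V (FractionRing V) b ≠ 0 := by
      rwa [Ne, IsFractionRing.to_map_eq_zero_iff]
    field_simp

variable {V}

/-- the class of `v / π ^ a` -/
noncomputable def qv (π v : V) (a : ℕ) : QV V :=
  Submodule.Quotient.mk (algebraMap V (FractionRing V) v / algebraMap V _ π ^ a)

lemma qv_eq_zero {π : V} (hπ : π ≠ 0) (v : V) (a : ℕ) : qv π v a = 0 ↔ π ^ a ∣ v := by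
  have h0 : algebraMap V (FractionRing V) π ^ a ≠ 0 := by
    apply pow_ne_zero
    rwa [Ne, IsFractionRing.to_map_eq_zero_iff]
  rw [qv, Submodule.Quotient.mk_eq_zero]
  constructor
  · rintro ⟨w, hw⟩
    refine ⟨w, IsFractionRing.injective V (FractionRing V) ?_⟩
    rw [Algebra.linearMap_apply, eq_div_iff h0] at hw
    rw [map_mul, map_pow, ← hw, mul_comm]
  · rintro ⟨w, rfl⟩
    refine ⟨w, ?_⟩
    rw [Algebra.linearMap_apply, eq_div_iff h0, map_mul, map_pow, mul_comm]

lemma qv_add (π v w : V) (a : ℕ) : qv π (v + w) a = qv π v a + qv π w a := by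
  rw [qv, map_add, add_div, Submodule.Quotient.mk_add]; rfl

lemma qv_smul (π c v : V) (a : ℕ) : qv π (c * v) a = c • qv π v a := by
  rw [qv, map_mul, mul_div_assoc, qv, ← Submodule.Quotient.mk_smul, Algebra.smul_def]

lemma qv_sub (π v w : V) (a : ℕ) : qv π (v - w) a = qv π v a - qv π w a := by
  rw [eq_sub_iff_add_eq, ← qv_add, sub_add_cancel]

lemma qv_succ {π : V} (hπ : π ≠ 0) (v : V) (a : ℕ) : π • qv π v (a + 1) = qv π v a := by
  have h0 : algebraMap V (FractionRing V) π ≠ 0 := by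
    rwa [Ne, IsFractionRing.to_map_eq_zero_iff]
  rw [qv, qv, ← Submodule.Quotient.mk_smul, Algebra.smul_def]
  congr 1
  field_simp
  ring

lemma qv_surj {π : V} (hπ : π ≠ 0) (e : QV V) (a : ℕ) (h : π ^ a • e = 0) : ∃ v, e = qv π v a := by
  have h0 : algebraMap V (FractionRing V) π ^ a ≠ 0 := by
    apply pow_ne_zero
    rwa [Ne, IsFractionRing.to_map_eq_zero_iff]
  obtain ⟨q, rfl⟩ := Submodule.Quotient.mk_surjective _ e
  rw [← Submodule.Quotient.mk_smul, Submodule.Quotient.mk_eq_zero] at h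
  obtain ⟨v, hv⟩ := h
  refine ⟨v, ?_⟩
  rw [qv]
  congr 1
  rw [eq_div_iff h0, mul_comm, ← map_pow, ← Algebra.smul_def, ← hv]; rfl

lemma qv_uniq {π : V} (hπ : π ≠ 0) [hc : IsAdicComplete (Ideal.span {π}) V] {v w : V}
    (h : ∀ a, qv π v a = qv π w a) : v = w := by
  rw [← sub_eq_zero]
  refine hc.haus' _ fun n => ?_
  rw [SModEq.zero, smul_eq_mul, Ideal.mul_top, Ideal.span_singleton_pow, Ideal.mem_span_singleton,
    ← qv_eq_zero hπ, qv_sub, h, sub_self]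

lemma qv_tate {π : V} (hπ : π ≠ 0) [hc : IsAdicComplete (Ideal.span {π}) V] (e : ℕ → QV V)
    (h0 : e 0 = 0) (h : ∀ a, π • e (a + 1) = e a) : ∃ v, ∀ a, e a = qv π v a := by
  have h1 : ∀ a, π ^ a • e a = 0 := by
    intro a
    induction a with
    | zero => simpa using h0
    | succ a ih => rw [pow_succ, mul_smul, h, ih]
  choose v hv using fun a => qv_surj hπ (e a) a (h1 a)
  have h2 : ∀ a b, a ≤ b → e a = qv π (v b) a := by
    intro a b hab
    induction b, hab using Nat.le_induction with
    | base => exact hv a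
    | succ b hab ih =>
      have h3 : ∀ d, π ^ d • qv π (v (b + 1)) (b + 1) = π ^ d • e (b + 1) := by intro d; rw [hv (b+1)]
      have h4 : ∀ d w c, π ^ d • qv π w (c + d) = qv π w c := by
        intro d
        induction d with
        | zero => intro w c; simp
        | succ d ih => intro w c; rw [pow_succ, mul_smul, ← add_assoc, qv_succ hπ, ih]
      have h5 : ∀ d c, π ^ d • e (c + d) = e c := by
        intro d
        induction d with
        | zero => intro c; simp
        | succ d ih => intro c; rw [pow_succ, mul_smul, ← add_assoc, h, ih]
      obtain ⟨d, hd⟩ : ∃ d, b + 1 = a + d := ⟨b + 1 - a, by omega⟩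
      have := h3 d
      rw [hd, h4, h5] at this
      rw [hd]
      exact this.symm
  obtain ⟨L, hL⟩ := hc.prec' v (by
    intro m n hmn
    rw [SModEq.sub_mem, smul_eq_mul, Ideal.mul_top, Ideal.span_singleton_pow, Ideal.mem_span_singleton,
      ← qv_eq_zero hπ, qv_sub, ← h2 m m le_rfl, ← h2 m n hmn, sub_self])
  refine ⟨L, fun a => ?_⟩
  have := hL a
  rw [SModEq.sub_mem, smul_eq_mul, Ideal.mul_top, Ideal.span_singleton_pow, Ideal.mem_span_singleton,
      ← qv_eq_zero hπ, qv_sub, sub_eq_zero] at this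
  rw [hv a, this]

lemma QV_sep [IsPrincipalIdealRing V] {π : V} (hπ : π ≠ 0) (hm : ∀ v, ¬ IsUnit v → π ∣ v) (hu : ¬ IsUnit π)
    {L : Type} [AddCommGroup L] [Module V L]
    (A : Submodule V L) (t : L) (ht : t ∉ A) : ∃ φ : L →ₗ[V] QV V, (∀ a ∈ A, φ a = 0) ∧ φ t ≠ 0 := by
  let q : V →ₗ[V] QV V := LinearMap.toSpanSingleton V _ (qv π 1 1)
  obtain ⟨k, hk⟩ := inj_ext (QV_inj V) (LinearMap.toSpanSingleton V (L ⧸ A) (A.mkQ t)) q (by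
    intro v hv
    rw [LinearMap.mem_ker, LinearMap.toSpanSingleton_apply, ← map_smul, Submodule.mkQ_apply,
      Submodule.Quotient.mk_eq_zero] at hv
    rw [LinearMap.mem_ker, LinearMap.toSpanSingleton_apply, ← qv_smul, qv_eq_zero hπ, mul_one, pow_one]
    apply hm
    intro hv'
    obtain ⟨u, rfl⟩ := hv'
    apply ht
    have := A.smul_mem (↑u⁻¹ : V) hv
    rwa [← mul_smul, Units.inv_mul, one_smul] at this)
  refine ⟨k ∘ₗ A.mkQ, fun a ha => ?_, ?_⟩
  · rw [LinearMap.comp_apply, Submodule.mkQ_apply, (Submodule.Quotient.mk_eq_zero A).2 ha, map_zero]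
  · have := hk 1
    rw [LinearMap.toSpanSingleton_apply, one_smul, LinearMap.toSpanSingleton_apply, one_smul] at this
    rw [LinearMap.comp_apply, this, Ne, qv_eq_zero hπ, pow_one]
    exact fun h => hu (isUnit_of_dvd_one h)

end
end LC
end

section
namespace LC
open MvPowerSeries

section
variable {V : Type} [CommRing V] [IsDomain V] {σ : Type} [Fintype σ] [DecidableEq σ]
  {R : Type} [CommRing R] [IsDomain R] [Algebra V R]

/-- exponent vectors -/
def bt (a : ℕ) (α : σ →₀ ℕ) : Option σ → ℕ
  | none => a
  | some i => α i + 1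

lemma fr_vsmul (x : Option σ → R) (v : V) (r : R) (β : Option σ → ℕ) :
    fr x (algebraMap V R v * r) β = v • fr x r β := by
  rw [fr_smul, algebraMap_smul]

lemma exists_f {π : V} (hπ : π ≠ 0) [IsAdicComplete (Ideal.span {π}) V]
    (F : MvPowerSeries σ V →+* R) (hFC : ∀ v, F (C v) = algebraMap V R v)
    {x : Option σ → R} (hxF : ∀ i, x i = F (uu π i)) (hx : ∀ i, x i ≠ 0)
    (φ : FractionRing R →ₗ[V] QV V) (hφ : ∀ r β i, β i = 0 → φ (fr x r β) = 0) :
    ∃ f : R → MvPowerSeries σ V, (∀ r s, f (r + s) = f r + f s) ∧ (∀ s r, f (F s * r) = s * f r) ∧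
      ∀ r α a, φ (fr x r (bt a α)) = qv π (coeff α (f r)) a := by
  have hxn : x none = algebraMap V R π := by rw [hxF, ← hFC]; rfl
  have hxs : ∀ i, x (some i) = F (X i) := fun i => hxF _
  have key : ∀ r (α : σ →₀ ℕ), ∃ v, ∀ a, φ (fr x r (bt a α)) = qv π v a := by
    intro r α
    refine qv_tate hπ (fun a => φ (fr x r (bt a α))) (hφ _ _ none rfl) fun a => ?_
    rw [← map_smul, ← fr_vsmul, ← hxn]
    congr 1
    rw [fr_eq hx, DD, DD, Fintype.prod_option, Fintype.prod_option]
    simp only [bt]; ring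
  have key2 : ∃ f : R → MvPowerSeries σ V, ∀ r α a, φ (fr x r (bt a α)) = qv π (coeff α (f r)) a := by
    choose v hv using key
    exact ⟨v, hv⟩
  obtain ⟨f, hf⟩ := key2
  have hadd : ∀ r s, f (r + s) = f r + f s := by
    intro r s; ext α
    refine qv_uniq hπ fun a => ?_
    rw [map_add, qv_add, ← hf, ← hf, ← hf, fr_add, map_add]
  have hC : ∀ v r, f (F (C v) * r) = C v * f r := by
    intro v r; ext α
    refine qv_uniq hπ fun a => ?_
    rw [coeff_C_mul, qv_smul, ← hf, ← hf, hFC, fr_vsmul, map_smul]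
  have hX : ∀ i r, f (F (X i) * r) = X i * f r := by
    intro i r; ext α
    refine qv_uniq hπ fun a => ?_
    rw [← hf, ← hxs]
    by_cases h : α i = 0
    · have h1 : coeff α (X i * f r) = 0 := by
        have := X_pow_dvd_iff.1 (show (X i : MvPowerSeries σ V) ^ 1 ∣ X i * f r by rw [pow_one]; exact dvd_mul_right _ _) α
          (by omega)
        exact this
      rw [h1, (qv_eq_zero hπ _ _).2 (dvd_zero _)]
      let β : Option σ → ℕ := Function.update (bt a α) (some i) 0
      have h2 : fr x (x (some i) * r) (bt a α) = fr x r β := by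
        rw [fr_eq hx, DD, DD, ← Finset.mul_prod_erase _ _ (Finset.mem_univ (some i)),
          ← Finset.mul_prod_erase _ (fun j => x j ^ bt a α j) (Finset.mem_univ (some i))]
        have h3 : ∏ j ∈ Finset.univ.erase (some i), x j ^ β j = ∏ j ∈ Finset.univ.erase (some i), x j ^ bt a α j := by
          refine Finset.prod_congr rfl fun j hj => ?_
          simp only [β, Function.update_of_ne (Finset.ne_of_mem_erase hj)]
        rw [h3]
        simp only [β, Function.update_self, bt, h]
        ring
      rw [h2]
      exact hφ _ _ (some i) (by simp [β])
    · obtain ⟨γ, rfl⟩ : ∃ γ, α = Finsupp.single i 1 + γ :=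
        ⟨α - Finsupp.single i 1, by
          rw [add_tsub_cancel_of_le]
          exact Finsupp.single_le_iff.2 (by omega)⟩
      rw [X, coeff_add_monomial_mul, one_mul, ← hf]
      congr 1
      have h4 : bt a (Finsupp.single i 1 + γ) = bt a γ + Pi.single (some i) 1 := by
        funext j
        cases j with
        | none => simp [bt]
        | some j =>
          by_cases hj : j = i
          · subst hj; simp [bt]; ring
          · simp [bt, Pi.single_apply, hj, Finsupp.single_apply, Ne.symm hj]
      rw [h4, ← fr_bump hx r (bt a γ) (Pi.single (some i) 1)]
      congr 1
      rw [DD, Finset.prod_eq_single (some i)]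
      · simp [mul_comm]
      · intro j _ hj; simp [hj]
      · simp
  have hzero : f 0 = 0 := by
    have := hadd 0 0
    simpa using this
  have hpoly : ∀ (p : MvPolynomial σ V) r, f (F (p : MvPowerSeries σ V) * r) = p * f r := by
    intro p
    induction p using MvPolynomial.induction_on with
    | C v => intro r; simpa using hC v r
    | add p q hp hq => intro r; simp only [MvPolynomial.coe_add, map_add, add_mul, hadd, hp, hq]
    | mul_X p i hp =>
      intro r
      rw [MvPolynomial.coe_mul, MvPolynomial.coe_X, map_mul, mul_assoc, hp, hX, mul_assoc]
  have hsub : ∀ r s, f (r - s) = f r - f s := by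
    intro r s
    rw [eq_sub_iff_add_eq, ← hadd, sub_add_cancel]
  refine ⟨f, hadd, ?_, hf⟩
  intro s r
  ext α
  obtain ⟨k, hk⟩ : ∃ k, ∀ i, α i < k := by
    obtain ⟨m, hm⟩ := exists_bd (fun i => α i)
    exact ⟨m + 1, fun i => Nat.lt_succ_of_le (hm i)⟩
  let n : σ →₀ ℕ := Finsupp.equivFunOnFinite.symm fun _ => k - 1
  let p := trunc' V n s
  have hXk : ∀ i t r, f (F (X i ^ t) * r) = X i ^ t * f r := by
    intro i t r
    have := hpoly (MvPolynomial.X i ^ t) r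
    simpa using this
  have hmem : s - (p : MvPowerSeries σ V) ∈ Ideal.span ((fun i => (X i : MvPowerSeries σ V) ^ k) '' (Finset.univ : Finset σ)) := by
    have := crit (0 : V) k Finset.univ (s - (p : MvPowerSeries σ V)) (by
      intro γ hγ
      rw [map_sub, MvPolynomial.coeff_coe, coeff_trunc', if_pos, sub_self]
      intro i
      have := hγ i (Finset.mem_univ i)
      simp only [n, Finsupp.equivFunOnFinite_symm_apply_apply]
      omega)
    simpa using this
  have hz : coeff α (f (F (s - (p : MvPowerSeries σ V)) * r)) = coeff α ((s - (p : MvPowerSeries σ V)) * f r) := by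
    have : ∀ t ∈ Ideal.span ((fun i => (X i : MvPowerSeries σ V) ^ k) '' (Finset.univ : Finset σ)),
        ∀ r, coeff α (f (F t * r)) = 0 ∧ coeff α (t * f r) = 0 := by
      intro t ht
      refine Submodule.span_induction (p := fun t _ => ∀ (c : MvPowerSeries σ V) r,
        coeff α (f (F (c * t) * r)) = 0 ∧ coeff α ((c * t) * f r) = 0) ?_ ?_ ?_ ?_ ht 1 |> fun h => by simpa using h
      · rintro _ ⟨i, -, rfl⟩ c r
        constructor
        · rw [mul_comm c, map_mul, mul_assoc, hXk]
          exact X_pow_dvd_iff.1 (dvd_mul_right _ _) α (hk i)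
        · rw [mul_comm c, mul_assoc]
          exact X_pow_dvd_iff.1 (dvd_mul_right _ _) α (hk i)
      · intro c r; simp [hzero]
      · intro u v _ _ hu hv c r
        simp only [mul_add, add_mul, map_add, hadd, (hu c r).1, (hv c r).1, (hu c r).2, (hv c r).2, add_zero, and_self]
      · intro d u _ hu c r
        rw [smul_eq_mul, ← mul_assoc]
        exact hu _ r
    rw [(this _ hmem r).1, (this _ hmem r).2]
  rw [map_sub, sub_mul, sub_mul, hsub, hpoly, map_sub, map_sub] at hz
  exact sub_left_injective hz

end
end LC
end

section
namespace LC
open MvPowerSeries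

section
variable {V : Type} [CommRing V] [IsDomain V] [IsDiscreteValuationRing V]
  {σ : Type} [Fintype σ] [DecidableEq σ] {R : Type} [CommRing R] [IsDomain R]

lemma JJ_rad {ι : Type} (x : ι → R) (i0 : ι) (k : ℕ) :
    (Ideal.span (x '' {i | i ≠ i0})).radical ≤ (JJ x i0 k).radical := by
  rw [Ideal.radical_le_radical_iff, Ideal.span_le]
  rintro _ ⟨i, hi, rfl⟩
  exact ⟨k, Ideal.subset_span ⟨i, hi, rfl⟩⟩

lemma pi_mem_smul {S : Type} [CommRing S] {τ : Type} [Fintype τ] [DecidableEq τ] (I : Ideal S) (v : τ → S)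
    (h : ∀ i, v i ∈ I) : v ∈ I • (⊤ : Submodule S (τ → S)) := by
  rw [pi_eq_sum_univ v]
  exact sum_mem fun i _ => Submodule.smul_mem_smul (h i) trivial

lemma core {π : V} (hπ : Irreducible π) [IsAdicComplete (Ideal.span {π}) V]
    (F : MvPowerSeries σ V →+* R) (hfin : F.Finite)
    {x : Option σ → R} (hxF : ∀ i, x i = F (uu π i)) (hx : ∀ i, x i ≠ 0)
    (i0 : Option σ) (p : Ideal R) [p.IsPrime] (hxp : ∀ i, i ≠ i0 → x i ∈ p)
    (y z : R) (hz : z ∉ p) (hyz : y * z ∈ (Ideal.span (x '' {i | i ≠ i0})).radical) (r : R)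
    (β : Option σ → ℕ) : fr x r β ∈ AA x hx i0 y := by
  classical
  letI : Algebra V R := (F.comp C).toAlgebra
  letI : Algebra (MvPowerSeries σ V) R := F.toAlgebra
  haveI : Module.Finite (MvPowerSeries σ V) R := hfin
  by_contra hcon
  obtain ⟨φ, hφ0, hφ1⟩ := QV_sep hπ.ne_zero (fun v hv => by
      have : v ∈ IsLocalRing.maximalIdeal V := hv
      rwa [hπ.maximalIdeal_eq, Ideal.mem_span_singleton] at this) hπ.not_isUnit
    ((AA x hx i0 y).restrictScalars V) (fr x r β) hcon
  obtain ⟨f, fadd, flin, fch⟩ := exists_f hπ.ne_zero F (fun v => rfl) hxF hx φ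
    (fun r β i hi => hφ0 _ (AA_of_zero hx i0 y r β i hi))
  -- `f` is not zero
  obtain ⟨r1, hr1⟩ : ∃ r1, f r1 ≠ 0 := by
    obtain ⟨m, hm⟩ := exists_bd β
    refine ⟨r * DD x (fun i => m + 1 - β i), fun h => hφ1 ?_⟩
    · rw [fr_top hx r β (m + 1) (fun i => (hm i).trans (Nat.le_succ m))]
      have : (fun _ : Option σ => m + 1) = bt (m + 1) (Finsupp.equivFunOnFinite.symm fun _ => m) := by
        funext i; cases i <;> simp [bt]
      rw [this, fch, h, map_zero, (qv_eq_zero hπ.ne_zero _ _).2 (dvd_zero _)]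
  let fl : R →ₗ[MvPowerSeries σ V] MvPowerSeries σ V :=
    { toFun := f
      map_add' := fadd
      map_smul' := fun s r => by
        rw [Algebra.smul_def]; exact flin s r }
  let P : Ideal (MvPowerSeries σ V) := Ideal.span (uu π '' {i | i ≠ i0})
  have hk : ∀ k, ∃ M, ∀ r, f (z ^ M * r) ∈ P ^ k := by
    intro k
    obtain ⟨M, hM⟩ := JJ_rad x i0 k hyz
    refine ⟨M, fun r => ?_⟩
    have h1 : f (z ^ M * r) ∈ Ideal.span ((fun i => uu π i ^ k) '' {i | i ≠ i0}) := by
      apply uu_pow_mem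
      intro α hα
      have h2 : ∀ a, (i0 ≠ none → a ≤ k) → φ (fr x (z ^ M * r) (bt a α)) = 0 := by
        intro a ha
        refine hφ0 _ (AA_of_pow hx i0 y _ _ k M ?_ ?_)
        · intro i hi
          cases i with
          | none => exact ha (Ne.symm hi)
          | some i => exact hα i hi
        · rw [← mul_assoc, ← mul_pow]
          exact Ideal.mul_mem_right _ _ hM
      split_ifs with h3
      · rw [zero_dvd_iff]
        refine qv_uniq hπ.ne_zero (π := π) fun a => ?_
        rw [← fch, h2 a (fun h => absurd h3 h), (qv_eq_zero hπ.ne_zero _ _).2 (dvd_zero _)]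
      · rw [← qv_eq_zero hπ.ne_zero, ← fch]
        exact h2 k fun _ => le_rfl
    refine (fun h5 :  Ideal.span ((fun i => (uu π i : MvPowerSeries σ V) ^ k) '' {i | i ≠ i0}) ≤ P ^ k => h5 h1) ?_
    rw [Ideal.span_le]
    rintro _ ⟨i, hi, rfl⟩
    have h6 : (uu π i : MvPowerSeries σ V) ∈ P := Ideal.subset_span ⟨i, hi, rfl⟩
    exact Ideal.pow_mem_pow h6 k
  obtain ⟨G, hG⟩ := (Module.Finite.fg_top : (⊤ : Submodule (MvPowerSeries σ V) R).FG)
  let j : R →ₗ[MvPowerSeries σ V] (G → MvPowerSeries σ V) :=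
    LinearMap.pi fun g => fl ∘ₗ LinearMap.mulRight (MvPowerSeries σ V) (g : R)
  have hj : ∀ r g, j r g = f (r * g) := fun r g => rfl
  have jinj : Function.Injective j := by
    rw [injective_iff_map_eq_zero]
    intro r hr
    by_contra hr0
    have h1 : ∀ r' : R, f (r * r') = 0 := by
      intro r'
      have : r' ∈ (⊤ : Submodule (MvPowerSeries σ V) R) := trivial
      rw [← hG] at this
      refine Submodule.span_induction (p := fun r' _ => f (r * r') = 0) ?_ ?_ ?_ ?_ this
      · intro g hg
        rw [← hj r ⟨g, hg⟩, hr]; rfl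
      · rw [mul_zero]; exact map_zero fl
      · intro a b _ _ ha hb
        rw [mul_add, fadd, ha, hb, add_zero]
      · intro s a _ ha
        rw [Algebra.smul_def, mul_left_comm]
        exact (flin s _).trans (by rw [ha, mul_zero])
    have h2 : (Ideal.span {r}).comap (algebraMap (MvPowerSeries σ V) R) ≠ ⊥ :=
      Ideal.comap_ne_bot_of_integral_mem hr0 (Ideal.mem_span_singleton_self r) (Algebra.IsIntegral.isIntegral r)
    obtain ⟨s, hs, hs0⟩ := Submodule.exists_mem_ne_zero_of_ne_bot h2
    obtain ⟨r', hr'⟩ := Ideal.mem_span_singleton.1 hs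
    have h3 : s * f r1 = 0 := by
      rw [← flin]
      change f (algebraMap _ _ s * r1) = 0
      rw [hr', mul_assoc]; exact h1 _
    rcases mul_eq_zero.1 h3 with h | h
    · exact hs0 h
    · exact hr1 h
  obtain ⟨k, hAR⟩ := Ideal.exists_pow_inf_eq_pow_smul P (LinearMap.range j)
  have hAR' := hAR (k + 1) (Nat.le_succ k)
  obtain ⟨M, hM⟩ := hk (k + 1)
  have h1 : j (z ^ M) ∈ P ^ (k + 1) • (⊤ : Submodule (MvPowerSeries σ V) (G → MvPowerSeries σ V)) ⊓ LinearMap.range j :=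
    ⟨pi_mem_smul _ _ fun g => hM g, ⟨_, rfl⟩⟩
  rw [hAR', Nat.add_sub_cancel_left, pow_one] at h1
  have h2 : j (z ^ M) ∈ P • LinearMap.range j := Submodule.smul_mono le_rfl inf_le_right h1
  rw [LinearMap.range_eq_map, ← Submodule.map_smul''] at h2
  obtain ⟨w, hw, hwz⟩ := h2
  rw [jinj hwz] at hw
  have h3 : P • (⊤ : Submodule (MvPowerSeries σ V) R) ≤ p.restrictScalars _ := by
    rw [Submodule.smul_le]
    intro s hs r _
    have hPp : P ≤ p.comap F := by
      rw [Ideal.span_le]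
      rintro _ ⟨i, hi, rfl⟩
      change F (uu π i) ∈ p
      rw [← hxF]; exact hxp i hi
    rw [Algebra.smul_def]
    exact p.mul_mem_right _ (hPp hs)
  have h4 : z ^ M ∈ p := h3 hw
  exact hz (Ideal.IsPrime.mem_of_pow_mem inferInstance _ h4)

end
end LC
end

section
namespace LC
open MvPowerSeries

lemma exists_g (A B : Type) [CommRing A] [IsDomain A] [CommRing B] [IsDomain B] [Algebra A B]
    [Module.Finite A B] (hinj : Function.Injective (algebraMap A B)) : ∃ g : B →ₗ[A] A, g 1 ≠ 0 := by
  classical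
  haveI : FaithfulSMul A B := (faithfulSMul_iff_algebraMap_injective A B).2 hinj
  haveI : FaithfulSMul A (FractionRing B) := (faithfulSMul_iff_algebraMap_injective A _).2 (by
    rw [IsScalarTower.algebraMap_eq A B (FractionRing B)]
    exact (IsFractionRing.injective B (FractionRing B)).comp hinj)
  letI : Algebra (FractionRing A) (FractionRing B) := FractionRing.liftAlgebra A (FractionRing B)
  haveI : IsScalarTower A (FractionRing A) (FractionRing B) := FractionRing.isScalarTower_liftAlgebra A (FractionRing B)
  obtain ⟨lam, hlam⟩ := LinearMap.exists_leftInverse_of_injective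
    (Algebra.linearMap (FractionRing A) (FractionRing B))
    (LinearMap.ker_eq_bot.2 (algebraMap (FractionRing A) (FractionRing B)).injective)
  have hl1 : lam 1 = 1 := by
    have := LinearMap.congr_fun hlam 1
    simpa using this
  let mu : B →ₗ[A] FractionRing A := (lam.restrictScalars A) ∘ₗ (Algebra.linearMap B (FractionRing B)).restrictScalars A
  have hmu : mu 1 = 1 := by
    change lam (algebraMap B (FractionRing B) 1) = 1
    rw [map_one, hl1]
  obtain ⟨G, hG⟩ := (Module.Finite.fg_top : (⊤ : Submodule A B).FG)
  obtain ⟨b, hb⟩ := IsLocalization.exist_integer_multiples (nonZeroDivisors A) G mu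
  have key : ∀ r, ∃ a, algebraMap A (FractionRing A) a = (b : A) • mu r := by
    intro r
    have : r ∈ (⊤ : Submodule A B) := trivial
    rw [← hG] at this
    refine Submodule.span_induction (p := fun r _ => ∃ a, algebraMap A (FractionRing A) a = (b : A) • mu r) ?_ ?_ ?_ ?_ this
    · intro g hg; exact hb g hg
    · exact ⟨0, by simp⟩
    · rintro u v _ _ ⟨a, ha⟩ ⟨a', ha'⟩
      exact ⟨a + a', by rw [map_add, map_add, smul_add, ha, ha']⟩
    · rintro c u _ ⟨a, ha⟩
      exact ⟨c * a, by rw [map_mul, ha, map_smul, smul_comm, Algebra.smul_def c]⟩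
  have hAi := IsFractionRing.injective A (FractionRing A)
  choose g hg using key
  refine ⟨{ toFun := g, map_add' := ?_, map_smul' := ?_ }, ?_⟩
  · intro u v
    apply hAi
    rw [map_add, hg, hg, hg, map_add, smul_add]
  · intro c u
    apply hAi
    rw [RingHom.id_apply, smul_eq_mul, map_mul, hg, hg, map_smul, smul_comm, Algebra.smul_def c]
  · intro h
    have h1 : g 1 = 0 := h
    have h2 := hg 1
    rw [h1, map_zero, hmu, Algebra.smul_def, mul_one] at h2
    exact nonZeroDivisors.coe_ne_zero b (hAi (h2.symm.trans (map_zero _).symm))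

section
variable {V : Type} [CommRing V] [IsDomain V] [IsDiscreteValuationRing V]
  {σ : Type} [Fintype σ] [DecidableEq σ] {R : Type} [CommRing R] [IsDomain R]

lemma ofList_map {ι : Type} [DecidableEq ι] (s : Finset ι) (x : ι → R) :
    Ideal.ofList (s.toList.map x) = Ideal.span (x '' s) := by
  rw [Ideal.ofList]
  congr 1
  ext r
  simp

lemma nonvan [IsNoetherianRing R] (ρ : Res R) {π : V} (hπ : Irreducible π) [IsAdicComplete (Ideal.span {π}) V]
    (F : MvPowerSeries σ V →+* R) (hfin : F.Finite) (hinj : Function.Injective F)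
    {x : Option σ → R} (hxF : ∀ i, x i = F (uu π i)) (hx : ∀ i, x i ≠ 0) :
    ¬ ρ.Van (Ideal.span (Set.range x)) (Fintype.card σ + 1) := by
  classical
  intro H
  letI : Algebra (MvPowerSeries σ V) R := F.toAlgebra
  haveI : Module.Finite (MvPowerSeries σ V) R := hfin
  haveI : IsDomain (MvPowerSeries σ V) := NoZeroDivisors.to_isDomain _
  obtain ⟨g, hg⟩ := exists_g (MvPowerSeries σ V) R hinj
  let l : List R := (Finset.univ : Finset (Option σ)).toList.map x
  have hll : l.length = Fintype.card σ + 1 := by simp [l]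
  have hlI : Ideal.ofList l = Ideal.span (Set.range x) := by
    rw [ofList_map]; simp
  apply hg
  apply uu_haus (π := π)
  intro N
  obtain ⟨k, hk⟩ := ρ.not_van (l := l) (by simp [l, hx]) (by rw [hlI, hll]; exact H) N
  apply uu_cancel hπ.ne_zero N k
  have h1 : l.prod = F (∏ i, uu π i) := by
    simp only [l]
    rw [Finset.prod_map_toList, map_prod]
    exact Finset.prod_congr rfl fun i _ => hxF i
  have h2 : l.map (· ^ (N + k)) = (Finset.univ : Finset (Option σ)).toList.map (fun i => x i ^ (N + k)) := by
    simp only [l, List.map_map]; rfl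
  rw [h2, ofList_map, h1, Finset.coe_univ, Set.image_univ] at hk
  have h3 : ∀ w ∈ Ideal.span (Set.range fun i => x i ^ (N + k)),
      g w ∈ Ideal.span (Set.range fun i => (uu π i : MvPowerSeries σ V) ^ (N + k)) := by
    intro w hw
    refine Submodule.span_induction (p := fun w _ => ∀ c, g (c * w) ∈ Ideal.span (Set.range fun i => (uu π i : MvPowerSeries σ V) ^ (N + k))) ?_ ?_ ?_ ?_ hw 1 |> fun h => by simpa using h
    · rintro _ ⟨i, rfl⟩ c
      have : c * x i ^ (N + k) = (uu π i ^ (N + k) : MvPowerSeries σ V) • c := by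
        rw [Algebra.smul_def, hxF, mul_comm, ← map_pow]; rfl
      simp only
      rw [this, map_smul, smul_eq_mul]
      exact Ideal.mul_mem_right _ _ (Ideal.subset_span ⟨i, rfl⟩)
    · intro c; simp
    · intro u v _ _ hu hv c
      rw [mul_add, map_add]; exact add_mem (hu c) (hv c)
    · intro d u _ hu c
      rw [smul_eq_mul, ← mul_assoc]; exact hu _
  have h4 := h3 _ hk
  have h5 : F (∏ i, uu π i) ^ k = ((∏ i, uu π i) ^ k : MvPowerSeries σ V) • (1 : R) := by
    rw [Algebra.smul_def, mul_one, ← map_pow]; rfl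
  rw [h5, map_smul, smul_eq_mul] at h4
  exact h4

lemma hl_final [IsNoetherianRing R] (ρ : Res R) {π : V} (hπ : Irreducible π) [IsAdicComplete (Ideal.span {π}) V]
    (F : MvPowerSeries σ V →+* R) (hfin : F.Finite)
    {x : Option σ → R} (hxF : ∀ i, x i = F (uu π i)) (hx : ∀ i, x i ≠ 0)
    (i0 : Option σ) (p : Ideal R) [p.IsPrime] (hxp : ∀ i, i ≠ i0 → x i ∈ p)
    (y z : R) (hz : z ∉ p) (hyz : y * z ∈ (Ideal.span (x '' {i | i ≠ i0})).radical)
    (hy0 : y ≠ 0) (hy : y ∈ (Ideal.span (Set.range x)).radical)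
    (hp : p ≤ (Ideal.span {y * x i0} ⊔ Ideal.span (x '' {i | i ≠ i0})).radical)
    {m : Ideal R} (hm : ∀ i, x i ∈ m) :
    ∀ u ∈ ρ.Zc m (Fintype.card σ + 1), u ∈ ρ.Bd p (Fintype.card σ + 1) := by
  classical
  have hA := core hπ F hfin hxF hx i0 p hxp y z hz hyz
  let l : List R := ((Finset.univ : Finset (Option σ)).erase i0).toList.map x
  have hll : l.length = Fintype.card σ := by simp [l]
  have hs : ((Finset.univ.erase i0 : Finset (Option σ)) : Set (Option σ)) = {i | i ≠ i0} := by
    ext i; simp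
  have hlI : Ideal.ofList l = Ideal.span (x '' {i | i ≠ i0}) := by
    rw [ofList_map, hs]
  have := ρ.hlvt (l := l) (by simp [l, hx]) (hx i0) hy0 (m := m) (p := p) (by
    rw [hlI]
    refine sup_le ((Ideal.span_singleton_le_iff_mem _).2 (hm i0)) (Ideal.span_le.2 ?_)
    rintro _ ⟨i, -, rfl⟩
    exact hm i) (by rw [hlI]; exact hp) (by
      intro k r
      obtain ⟨m, N, t, h⟩ := E_of hx i0 y hA hy k r
      refine ⟨m, N, t, ?_⟩
      have h1 : l.prod = ∏ i ∈ Finset.univ.erase i0, x i := by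
        simp only [l]; rw [Finset.prod_map_toList]
      have h2 : l.map (· ^ (k + m)) = ((Finset.univ : Finset (Option σ)).erase i0).toList.map (fun i => x i ^ (k + m)) := by
        simp only [l, List.map_map]; rfl
      rw [h1, h2, ofList_map, hs]
      exact h)
  rw [hll] at this
  exact this

end
end LC
end

section
namespace LC
open IsLocalRing

lemma avoid {R : Type} [CommRing R] (I : Ideal R) {S : Set (Ideal R)} (hS : S.Finite)
    (hp : ∀ q ∈ S, q.IsPrime) (hI : ∀ q ∈ S, ¬ I ≤ q) : ∃ x ∈ I, ∀ q ∈ S, x ∉ q := by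
  by_contra! h
  have h1 : (I : Set R) ⊆ ⋃ i ∈ (hS.toFinset : Set (Ideal R)), (i : Set R) := by
    intro x hx
    obtain ⟨q, hq, hxq⟩ := h x hx
    simp only [Set.mem_iUnion]
    exact ⟨q, by simpa using hq, hxq⟩
  obtain ⟨q, hq, hIq⟩ := (Ideal.subset_union_prime (s := hS.toFinset) (f := fun q => q) ⊥ ⊥
    (fun q hq _ _ => hp q (by simpa using hq))).1 h1
  exact hI q (by simpa using hq) hIq

lemma eq_max {R : Type} [CommRing R] [IsNoetherianRing R] [IsLocalRing R] {J Q Q' : Ideal R}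
    [Q.IsPrime] [Q'.IsPrime] (hJ : J ≤ Q) (hQ : Q < Q') {x : R} (hxm : x ∈ maximalIdeal R)
    (hx : maximalIdeal R ≤ (J ⊔ Ideal.span {x}).radical) : Q' = maximalIdeal R := by
  by_contra hne
  have hlt : Q' < maximalIdeal R := lt_of_le_of_ne (le_maximalIdeal (Ideal.IsPrime.ne_top ‹_›)) hne
  have := Ideal.mem_minimalPrimes_span_of_mem_minimalPrimes_span_insert (q := Q')
    (p := maximalIdeal R) hlt x (Q : Set R) ?_ (Q : Set R) hQ.le ?_
  · rw [Ideal.span_eq] at this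
    exact absurd (this.2 ⟨‹Q.IsPrime›, le_rfl⟩ hQ.le) (not_le_of_gt hQ)
  · rw [Ideal.span_insert, Ideal.span_eq]
    refine ⟨⟨inferInstance, sup_le ?_ (hQ.le.trans hlt.le)⟩, ?_⟩
    · rwa [Ideal.span_singleton_le_iff_mem]
    · rintro q ⟨hq, hle⟩ _
      refine hx.trans (hq.radical_le_iff.2 (sup_le ?_ (le_sup_left.trans hle)))
      exact hJ.trans (le_sup_right.trans hle)
  · exact fun y hy => Ideal.le_radical (Ideal.subset_span (Set.mem_insert_of_mem _ hy))

lemma step1 {R : Type} [CommRing R] [IsNoetherianRing R] [IsLocalRing R] [IsDomain R]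
    {J p : Ideal R} [p.IsPrime] (hJ : J ≤ p) {x : R} (hxm : x ∈ maximalIdeal R)
    (hx : maximalIdeal R ≤ (J ⊔ Ideal.span {x}).radical) (hpm : p ≠ maximalIdeal R) (hp0 : p ≠ ⊥) :
    ∃ y z : R, z ∉ p ∧ y * z ∈ J.radical ∧ y ≠ 0 ∧ y ∈ maximalIdeal R ∧
      p ≤ (Ideal.span {y * x} ⊔ J).radical := by
  classical
  have hpmin : ∀ q : Ideal R, q.IsPrime → J ≤ q → q ≤ p → q = p := by
    intro q hq hJq hqp
    by_contra hne
    exact hpm (eq_max hJq (lt_of_le_of_ne hqp hne) hxm hx)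
  have hfin := J.finite_minimalPrimes_of_isNoetherianRing R
  have hT : (J.minimalPrimes \ {p}).Finite := hfin.subset Set.diff_subset
  obtain ⟨y, hyp, hy⟩ := avoid p (S := insert ⊥ (J.minimalPrimes \ {p})) (hT.insert _) (by
    rintro q (rfl | hq)
    · exact Ideal.isPrime_bot
    · exact hq.1.1.1) (by
    rintro q (rfl | hq) hle
    · exact hp0 (le_bot_iff.1 hle)
    · exact hq.2 (le_antisymm (hq.1.2 ⟨‹p.IsPrime›, hJ⟩ hle) hle))
  have hz : ¬ (hT.toFinset.inf id ≤ p) := by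
    intro h
    obtain ⟨q, hq, hqp⟩ := (Ideal.IsPrime.inf_le' ‹p.IsPrime›).1 h
    simp only [Set.Finite.mem_toFinset] at hq
    exact hq.2 (hpmin q hq.1.1.1 hq.1.1.2 hqp)
  obtain ⟨z, hzT, hzp⟩ := SetLike.not_le_iff_exists.1 hz
  refine ⟨y, z, hzp, ?_, ?_, le_maximalIdeal (Ideal.IsPrime.ne_top ‹_›) hyp, ?_⟩
  · rw [← Ideal.sInf_minimalPrimes, Ideal.mem_sInf]
    intro q hq
    by_cases h : q = p
    · rw [h]; exact p.mul_mem_right _ hyp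
    · refine q.mul_mem_left _ ?_
      have := Finset.inf_le (f := id) (hT.mem_toFinset.2 ⟨hq, h⟩)
      exact this hzT
  · intro h
    exact hy ⊥ (Set.mem_insert _ _) (by simp [h])
  · rw [Ideal.radical_eq_sInf]
    refine le_sInf ?_
    rintro Q ⟨hle, hQ⟩
    have hJQ : J ≤ Q := le_sup_right.trans hle
    have hyx : y * x ∈ Q := hle (Ideal.mem_sup_left (Ideal.mem_span_singleton_self _))
    rcases hQ.mem_or_mem hyx with h | h
    · obtain ⟨q, hq, hqQ⟩ := Ideal.exists_minimalPrimes_le hJQ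
      by_cases hqp : q = p
      · rwa [← hqp]
      · have hlt : q < Q := lt_of_le_of_ne hqQ (by
          rintro rfl
          exact hy q (Set.mem_insert_of_mem _ ⟨hq, hqp⟩) h)
        haveI := hq.1.1
        rw [eq_max hq.1.2 hlt hxm hx]
        exact le_maximalIdeal (Ideal.IsPrime.ne_top ‹_›)
    · refine (le_maximalIdeal (Ideal.IsPrime.ne_top ‹p.IsPrime›)).trans (hx.trans ?_)
      exact hQ.radical_le_iff.2 (sup_le hJQ (by rwa [Ideal.span_singleton_le_iff_mem]))

/-- dimension bound -/
def DL {R : Type} [CommRing R] (d : ℕ) (J : Ideal R) : Prop :=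
  ∀ Q : PrimeSpectrum R, J ≤ Q.asIdeal → Order.coheight Q ≤ d

lemma DL_step {R : Type} [CommRing R] {d : ℕ} {J : Ideal R} (h : DL (d+1) J) {x : R}
    (hx : ∀ Q : PrimeSpectrum R, Q.asIdeal ∈ J.minimalPrimes → Order.coheight Q = (d+1 : ℕ) → x ∉ Q.asIdeal) :
    DL d (J ⊔ Ideal.span {x}) := by
  intro Q hQ
  have hJQ : J ≤ Q.asIdeal := le_sup_left.trans hQ
  have hxQ : x ∈ Q.asIdeal := hQ (Ideal.mem_sup_right (Ideal.mem_span_singleton_self _))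
  obtain ⟨q, hq, hqQ⟩ := Ideal.exists_minimalPrimes_le hJQ
  let q' : PrimeSpectrum R := ⟨q, hq.1.1⟩
  have hq' := h q' hq.1.2
  have hle : q' ≤ Q := hqQ
  rcases hle.lt_or_eq with hlt | heq
  · have := (Order.coheight_add_one_le hlt).trans hq'
    rw [Nat.cast_add, Nat.cast_one] at this
    exact (ENat.add_le_add_iff_right (by simp)).1 this
  · have h3 : Order.coheight q' ≠ (d+1 : ℕ) := fun h4 => hx q' hq h4 (by rw [heq]; exact hxQ)
    rw [← heq]
    have := lt_of_le_of_ne hq' h3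
    rw [Nat.cast_add, Nat.cast_one] at this
    exact ENat.lt_add_one_iff (by simp) |>.1 this

lemma DL_chain {R : Type} [CommRing R] [IsNoetherianRing R] [IsDomain R] {I : Ideal R} (hI : I ≠ ⊥)
    {e : ℕ} (d : ℕ) : ∀ {J : Ideal R} (_ : DL (d+e) J)
    (_ : ∀ Q : PrimeSpectrum R, J ≤ Q.asIdeal → I ≤ Q.asIdeal → Order.coheight Q ≤ e),
    ∃ x : Fin d → R, (∀ i, x i ∈ I) ∧ (∀ i, x i ≠ 0) ∧ DL e (J ⊔ Ideal.span (Set.range x)) := by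
  induction d with
  | zero =>
    intro J h _
    refine ⟨Fin.elim0, fun i => i.elim0, fun i => i.elim0, ?_⟩
    intro Q hQ
    simpa using h Q (le_sup_left.trans hQ)
  | succ d ih =>
    intro J h hh
    have hfin := J.finite_minimalPrimes_of_isNoetherianRing R
    let S : Set (Ideal R) := {q | ∃ Q : PrimeSpectrum R, Q.asIdeal = q ∧ q ∈ J.minimalPrimes ∧ Order.coheight Q = (d+e+1 : ℕ)}
    have hS : S.Finite := hfin.subset (by rintro q ⟨Q, -, h, -⟩; exact h)
    obtain ⟨x, hxI, hx⟩ := avoid I (S := insert ⊥ S) (hS.insert _) (by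
      rintro q (rfl | ⟨Q, rfl, -⟩)
      · exact Ideal.isPrime_bot
      · exact Q.isPrime) (by
      rintro q (rfl | ⟨Q, rfl, h1, h2⟩) hle
      · exact hI (le_bot_iff.1 hle)
      · have := hh Q h1.1.2 hle
        rw [h2] at this
        have : d + e + 1 ≤ e := by exact_mod_cast this
        omega)
    have h1 : DL (d+e) (J ⊔ Ideal.span {x}) := by
      refine DL_step (by rwa [show d + e + 1 = d + 1 + e by ring]) ?_
      intro Q hQ hc
      exact hx _ (Set.mem_insert_of_mem _ ⟨Q, rfl, hQ, hc⟩)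
    obtain ⟨x', hx'I, hx'0, hx'⟩ := ih h1 (fun Q hQ => hh Q (le_sup_left.trans hQ))
    refine ⟨Fin.cons x x', ?_, ?_, ?_⟩
    · intro i; refine Fin.cases ?_ ?_ i
      · simpa using hxI
      · simpa using hx'I
    · intro i; refine Fin.cases ?_ ?_ i
      · have := hx ⊥ (Set.mem_insert _ _)
        simpa using this
      · simpa using hx'0
    · rwa [Fin.range_cons, Ideal.span_insert, ← sup_assoc]

lemma DL_zero {R : Type} [CommRing R] [IsLocalRing R] {J : Ideal R} (h : DL 0 J) :
    maximalIdeal R ≤ J.radical := by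
  rw [Ideal.radical_eq_sInf]
  refine le_sInf ?_
  rintro Q ⟨hle, hQ⟩
  have h1 := h ⟨Q, hQ⟩ hle
  simp only [Nat.cast_zero, nonpos_iff_eq_zero, Order.coheight_eq_zero] at h1
  exact h1 (b := ⟨maximalIdeal R, inferInstance⟩) (le_maximalIdeal hQ.ne_top)

lemma DL_bot {R : Type} [CommRing R] [IsDomain R] {n : ℕ} (h : ringKrullDim R = n) :
    DL n (⊥ : Ideal R) := by
  intro Q _
  have := Order.coheight_le_krullDim Q
  rw [show Order.krullDim (PrimeSpectrum R) = n from h] at this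
  exact_mod_cast this

end LC
end

section
namespace LC
open IsLocalRing

lemma coh_max {R : Type} [CommRing R] [IsLocalRing R] (Q : PrimeSpectrum R)
    (h : maximalIdeal R ≤ Q.asIdeal) : Order.coheight Q = 0 := by
  rw [Order.coheight_eq_zero]
  intro b _
  exact (le_maximalIdeal b.isPrime.ne_top).trans h

lemma coh_one {R : Type} [CommRing R] [IsLocalRing R] {p : Ideal R}
    (hp : ∀ Q : Ideal R, Q.IsPrime → p ≤ Q → Q = p ∨ Q = maximalIdeal R)
    (Q : PrimeSpectrum R) (h : p ≤ Q.asIdeal) : Order.coheight Q ≤ 1 := by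
  refine Order.coheight_le_iff'.2 ?_
  intro l hl
  by_contra hlt
  have h2 : 2 ≤ l.length := by
    by_contra h2
    exact hlt (by exact_mod_cast (by omega : l.length ≤ 1))
  have hlen : 1 < l.length + 1 := by omega
  have a0 : l ⟨0, by omega⟩ < l ⟨1, by omega⟩ := l.strictMono (by simp [Fin.lt_def])
  have a1 : l ⟨1, by omega⟩ < l ⟨2, by omega⟩ := l.strictMono (by simp [Fin.lt_def])
  have e0 : l ⟨0, by omega⟩ = Q := hl
  rw [e0] at a0
  have b1 : p < (l ⟨1, by omega⟩).asIdeal := lt_of_le_of_lt h a0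
  rcases hp _ (l ⟨1, by omega⟩).isPrime b1.le with h3 | h3
  · exact b1.ne h3.symm
  · have : (l ⟨1, by omega⟩).asIdeal < (l ⟨2, by omega⟩).asIdeal := a1
    rw [h3] at this
    exact absurd (le_maximalIdeal (l ⟨2, by omega⟩).isPrime.ne_top) (not_le_of_gt this)

lemma choose_x {R : Type} [CommRing R] [IsNoetherianRing R] [IsLocalRing R] [IsDomain R] {n : ℕ}
    (hn : 1 ≤ n) (hdim : ringKrullDim R = ((n+1 : ℕ) : WithBot ℕ∞)) {w : R} (hw : w ∈ maximalIdeal R)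
    (hw0 : w ≠ 0) {p : Ideal R} [p.IsPrime] (hpm : p ≠ maximalIdeal R)
    (hp : ∀ Q : Ideal R, Q.IsPrime → p ≤ Q → Q = p ∨ Q = maximalIdeal R) :
    ∃ x : Option (Fin n) → R, x none = w ∧ (∀ i, x i ∈ maximalIdeal R) ∧ (∀ i, x i ≠ 0) ∧
      maximalIdeal R ≤ (Ideal.span (Set.range x)).radical ∧
      ∃ i0, (∀ i, i ≠ i0 → x i ∈ p) ∧ ∃ y z : R, z ∉ p ∧
        y * z ∈ (Ideal.span (x '' {i | i ≠ i0})).radical ∧ y ≠ 0 ∧ y ∈ maximalIdeal R ∧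
        p ≤ (Ideal.span {y * x i0} ⊔ Ideal.span (x '' {i | i ≠ i0})).radical := by
  have hp0 : p ≠ ⊥ := by
    rintro rfl
    have h1 := coh_one hp (⊥ : PrimeSpectrum R) bot_le
    have h2 := Order.coheight_bot_eq_krullDim (α := PrimeSpectrum R)
    rw [show Order.krullDim (PrimeSpectrum R) = _ from hdim] at h2
    have h3 : Order.coheight (⊥ : PrimeSpectrum R) = ((n+1 : ℕ) : ℕ∞) := by exact_mod_cast h2
    rw [h3] at h1
    have : n + 1 ≤ 1 := by exact_mod_cast h1
    omega
  have hplt : p ≤ maximalIdeal R := le_maximalIdeal (Ideal.IsPrime.ne_top ‹_›)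
  have hm0 : maximalIdeal R ≠ ⊥ := by
    intro h
    exact hp0 (le_bot_iff.1 (h ▸ hplt))
  have hDw : DL n (Ideal.span {w}) := by
    have := DL_step (DL_bot hdim) (x := w) (by
      intro Q hQ _ hwQ
      have : Q.asIdeal = ⊥ := le_bot_iff.1 (hQ.2 ⟨Ideal.isPrime_bot, le_rfl⟩ bot_le)
      rw [this] at hwQ
      exact hw0 (by simpa using hwQ))
    rwa [bot_sup_eq] at this
  -- finishing
  have fin : ∀ (x : Option (Fin n) → R) (i0 : Option (Fin n)), x none = w → (∀ i, x i ∈ maximalIdeal R) →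
      (∀ i, x i ≠ 0) → (∀ i, i ≠ i0 → x i ∈ p) → DL 0 (Ideal.span (Set.range x)) →
    ∃ x : Option (Fin n) → R, x none = w ∧ (∀ i, x i ∈ maximalIdeal R) ∧ (∀ i, x i ≠ 0) ∧
      maximalIdeal R ≤ (Ideal.span (Set.range x)).radical ∧
      ∃ i0, (∀ i, i ≠ i0 → x i ∈ p) ∧ ∃ y z : R, z ∉ p ∧
        y * z ∈ (Ideal.span (x '' {i | i ≠ i0})).radical ∧ y ≠ 0 ∧ y ∈ maximalIdeal R ∧
        p ≤ (Ideal.span {y * x i0} ⊔ Ideal.span (x '' {i | i ≠ i0})).radical := by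
    intro x i0 h1 h2 h3 h4 h5
    have h6 := DL_zero h5
    refine ⟨x, h1, h2, h3, h6, i0, h4, ?_⟩
    refine step1 (J := Ideal.span (x '' {i | i ≠ i0})) ?_ (h2 i0) ?_ hpm hp0
    · rw [Ideal.span_le]
      rintro _ ⟨i, hi, rfl⟩
      exact h4 i hi
    · refine h6.trans (Ideal.radical_mono ?_)
      rw [Ideal.span_le]
      rintro _ ⟨i, rfl⟩
      by_cases hi : i = i0
      · rw [hi]; exact Ideal.mem_sup_right (Ideal.mem_span_singleton_self _)
      · exact Ideal.mem_sup_left (Ideal.subset_span ⟨i, hi, rfl⟩)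
  by_cases hwp : w ∈ p
  · obtain ⟨k, rfl⟩ : ∃ k, n = k + 1 := ⟨n-1, by omega⟩
    obtain ⟨x', h1, h2, h3⟩ := DL_chain hp0 (e := 1) k hDw (fun Q _ h => by simpa using coh_one hp Q h)
    obtain ⟨x'', g1, g2, g3⟩ := DL_chain hm0 (e := 0) 1 (by simpa using h3)
      (fun Q _ h => by simp [coh_max Q h])
    refine fin (fun i => i.elim w (Fin.cons (x'' 0) x' : Fin (k+1) → R)) (some 0) rfl ?_ ?_ ?_ ?_
    · rintro (_ | i)
      · exact hw
      · refine Fin.cases ?_ ?_ i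
        · simpa using g1 0
        · intro i; simpa using hplt (h1 i)
    · rintro (_ | i)
      · exact hw0
      · refine Fin.cases ?_ ?_ i
        · simpa using g2 0
        · intro i; simpa using h2 i
    · rintro (_ | i)
      · intro _; exact hwp
      · refine Fin.cases ?_ ?_ i
        · simp
        · intro i _; simpa using h1 i
    · intro Q hQ
      refine g3 Q (le_trans ?_ hQ)
      have hs : ∀ i : Option (Fin (_)), (i.elim w (Fin.cons (x'' 0) x' : Fin (k+1) → R) : R) ∈ Ideal.span (Set.range (fun i : Option (Fin (k+1)) => (i.elim w (Fin.cons (x'' 0) x' : Fin (k+1) → R) : R))) :=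
        fun i => Ideal.subset_span ⟨i, rfl⟩
      refine sup_le (sup_le ?_ ?_) ?_
      · rw [Ideal.span_singleton_le_iff_mem]; exact hs none
      · rw [Ideal.span_le]; rintro _ ⟨i, rfl⟩; simpa using hs (some i.succ)
      · rw [Ideal.span_le]; rintro _ ⟨i, rfl⟩
        rw [Subsingleton.elim i 0]; simpa using hs (some 0)
  · obtain ⟨x', h1, h2, h3⟩ := DL_chain hp0 (e := 0) n hDw (fun Q hwQ h => by
      rcases hp Q.asIdeal Q.isPrime h with h | h
      · rw [h, Ideal.span_singleton_le_iff_mem] at hwQ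
        exact absurd hwQ hwp
      · rw [coh_max Q h.ge]; simp)
    refine fin (fun i => i.elim w x') none rfl ?_ ?_ ?_ ?_
    · rintro (_ | i)
      · exact hw
      · exact hplt (h1 i)
    · rintro (_ | i)
      · exact hw0
      · exact h2 i
    · rintro (_ | i)
      · intro h; exact absurd rfl h
      · intro _; exact h1 i
    · intro Q hQ
      refine h3 Q (le_trans ?_ hQ)
      have hs : ∀ i : Option (Fin (_)), (i.elim w x' : R) ∈ Ideal.span (Set.range (fun i : Option (Fin n) => (i.elim w x' : R))) :=
        fun i => Ideal.subset_span ⟨i, rfl⟩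
      refine sup_le ?_ ?_
      · rw [Ideal.span_singleton_le_iff_mem]; exact hs none
      · rw [Ideal.span_le]; rintro _ ⟨i, rfl⟩; exact hs (some i)

end LC
end

section
namespace LC
open IsLocalRing

lemma hl_all {R : Type} [CommRing R] [IsNoetherianRing R] [IsLocalRing R] [IsDomain R]
    [IsAdicComplete (maximalIdeal R) R] (ρ : Res R) {n : ℕ}
    (hn : 1 ≤ n) (hdim : ringKrullDim R = ((n+1 : ℕ) : WithBot ℕ∞))
    {p : Ideal R} [p.IsPrime] (hpm : p ≠ maximalIdeal R)
    (hp : ∀ Q : Ideal R, Q.IsPrime → p ≤ Q → Q = p ∨ Q = maximalIdeal R) :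
    (∀ u ∈ ρ.Zc (maximalIdeal R) (n+1), u ∈ ρ.Bd p (n+1)) ∧ ¬ ρ.Van (maximalIdeal R) (n+1) := by
  have hm0 : maximalIdeal R ≠ ⊥ := by
    intro h
    apply hpm
    rw [h]
    exact le_bot_iff.1 (h ▸ (le_maximalIdeal (Ideal.IsPrime.ne_top ‹p.IsPrime›)))
  obtain ⟨t, ht, ht0⟩ := Submodule.exists_mem_ne_zero_of_ne_bot hm0
  obtain ⟨V, _, _, _, π, ψ, _, hπ, hsur, hw, hw0⟩ := coeff_dvr R t ht ht0
  obtain ⟨x, hxn, hxm, hx0, hxr, i0, hxp, y, z, hz, hyz, hy0, hym, hpp⟩ := choose_x hn hdim hw hw0 hpm hp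
  have hspan : Ideal.span (Set.range x) ≤ Ideal.span (Set.range fun i : Fin n => x (some i)) ⊔ Ideal.span {ψ π} := by
    rw [Ideal.span_le]
    rintro _ ⟨_ | i, rfl⟩
    · rw [hxn]; exact Ideal.mem_sup_right (Ideal.mem_span_singleton_self _)
    · exact Ideal.mem_sup_left (Ideal.subset_span ⟨i, rfl⟩)
  obtain ⟨e, he⟩ := Ideal.exists_pow_le_of_le_radical_of_fg hxr (IsNoetherian.noetherian _)
  obtain ⟨F, hFC, hFX, hfin⟩ := norm_exists R π ψ hsur hw (fun i : Fin n => x (some i)) (fun i => hxm _) e (he.trans hspan)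
  have hxF : ∀ i, x i = F (uu π i) := by
    rintro (_ | i)
    · rw [hxn]; exact (hFC π).symm
    · exact (hFX i).symm
  have hcard : Fintype.card (Fin n) = n := Fintype.card_fin n
  have hinj := norm_inj hπ F hfin (by rw [hcard]; exact hdim)
  constructor
  · have := hl_final ρ hπ F hfin hxF hx0 i0 p hxp y z hz hyz hy0 (hxr hym) hpp hxm
    rwa [hcard] at this
  · have := nonvan ρ hπ F hfin hinj hxF hx0
    rw [hcard] at this
    intro h
    refine this (ρ.Van_congr ?_ h)
    refine le_antisymm ?_ ?_
    · exact Ideal.radical_le_radical_iff.2 hxr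
    · exact Ideal.radical_mono (by rw [Ideal.span_le]; rintro _ ⟨i, rfl⟩; exact hxm i)

/-- a nonprimary ideal is contained in a prime which is maximal among nonmaximal primes -/
lemma exists_p {R : Type} [CommRing R] [IsNoetherianRing R] [IsLocalRing R] {a : Ideal R}
    (ha : ¬ maximalIdeal R ≤ a.radical) : ∃ p : Ideal R, p.IsPrime ∧ a ≤ p ∧ p ≠ maximalIdeal R ∧
    ∀ Q : Ideal R, Q.IsPrime → p ≤ Q → Q = p ∨ Q = maximalIdeal R := by
  have h1 : {p : Ideal R | p.IsPrime ∧ a ≤ p ∧ p ≠ maximalIdeal R}.Nonempty := by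
    by_contra h
    apply ha
    rw [Ideal.radical_eq_sInf]
    refine le_sInf ?_
    rintro Q ⟨hle, hQ⟩
    by_contra hne
    exact h ⟨Q, hQ, hle, fun h => hne h.ge⟩
  obtain ⟨p, ⟨h1, h2, h3⟩, hmax⟩ := set_has_maximal_iff_noetherian.2 ‹IsNoetherianRing R› _ h1
  refine ⟨p, h1, h2, h3, fun Q hQ hle => ?_⟩
  by_contra! h
  exact hmax Q ⟨hQ, h2.trans hle, h.2⟩ (lt_of_le_of_ne hle h.1.symm)

lemma Bd_anti {R : Type} [CommRing R] (ρ : Res R) {a p : Ideal R} (h : a ≤ p) {j : ℕ} {u : ρ.I (j+1)}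
    (hu : u ∈ ρ.Bd p (j+1)) : u ∈ ρ.Bd a (j+1) := by
  obtain ⟨v, hv, hvu⟩ := hu
  exact ⟨v, Gam.mono h hv, hvu⟩

lemma conn {R : Type} [CommRing R] [IsNoetherianRing R] [IsLocalRing R] [IsDomain R]
    [IsAdicComplete (maximalIdeal R) R] (ρ : Res R) {n : ℕ}
    (hdim : ringKrullDim R = ((n+2 : ℕ) : WithBot ℕ∞)) {a b : Ideal R}
    (ha : ¬ maximalIdeal R ≤ a.radical) (hb : ¬ maximalIdeal R ≤ b.radical)
    (hab : maximalIdeal R ≤ (a ⊔ b).radical) : ¬ ρ.Van (a ⊓ b) (n+1) := by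
  intro H
  obtain ⟨p, hp1, hp2, hp3, hp4⟩ := exists_p ha
  obtain ⟨q, hq1, hq2, hq3, hq4⟩ := exists_p hb
  obtain ⟨A1, A2⟩ := hl_all ρ (n := n+1) (by omega) hdim hp3 hp4
  obtain ⟨B1, -⟩ := hl_all ρ (n := n+1) (by omega) hdim hq3 hq4
  refine A2 (ρ.mv n hab ?_ ?_ H ?_ ?_)
  · exact (hp2.trans (le_maximalIdeal hp1.ne_top)).trans Ideal.le_radical
  · exact (hq2.trans (le_maximalIdeal hq1.ne_top)).trans Ideal.le_radical
  · intro u hu; exact Bd_anti ρ hp2 (A1 u hu)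
  · intro u hu; exact Bd_anti ρ hq2 (B1 u hu)

end LC
end

section
namespace LC
open IsLocalRing

lemma DL_quot {R : Type} [CommRing R] {I : Ideal R} {d : ℕ} (h : ringKrullDim (R ⧸ I) = d) : DL d I := by
  intro Q hQ
  rw [ringKrullDim_quotient] at h
  have h1 : (Order.coheight Q : WithBot ℕ∞) ≤ d := by
    rw [Order.coheight_eq_krullDim_Ici, ← h]
    refine Order.krullDim_le_of_strictMono
      (fun P : Set.Ici Q => (⟨P.1, ?_⟩ : PrimeSpectrum.zeroLocus (I : Set R))) ?_
    · exact hQ.trans P.2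
    · intro P P' hP
      exact hP
  exact_mod_cast h1

lemma dim_zero {R : Type} [CommRing R] [IsLocalRing R] {J : Ideal R} (h : maximalIdeal R ≤ J.radical) :
    ringKrullDim (R ⧸ J) ≤ 0 := by
  rw [ringKrullDim_quotient, Order.krullDim_nonpos_iff_forall_isMax]
  intro P Q _
  change Q.1.asIdeal ≤ P.1.asIdeal
  exact (le_maximalIdeal Q.1.isPrime.ne_top).trans (h.trans (P.1.isPrime.radical_le_iff.2 P.2))

lemma not_prim {R : Type} [CommRing R] [IsNoetherianRing R] [IsLocalRing R] {a : Ideal R} {d : ℕ}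
    (h : (d : WithBot ℕ∞) < ringKrullDim (R ⧸ a)) {y : Fin d → R} (hy : ∀ i, y i ∈ maximalIdeal R) :
    ¬ maximalIdeal R ≤ (a ⊔ Ideal.span (Set.range y)).radical := by
  intro hm
  have h0 := dim_zero hm
  have h1 := ringKrullDim_le_ringKrullDim_quotient_add_encard
    (Ideal.Quotient.mk a '' Set.range y) (by
      rintro _ ⟨_, ⟨i, rfl⟩, rfl⟩
      haveI : RingHomSurjective (Ideal.Quotient.mk a) := ⟨Ideal.Quotient.mk_surjective⟩
      refine Ring.le_comap_jacobson (Ideal.Quotient.mk a) ?_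
      rw [IsLocalRing.ringJacobson_eq_maximalIdeal]
      exact hy i)
  rw [← Ideal.map_span, ringKrullDim_eq_of_ringEquiv (DoubleQuot.quotQuotEquivQuotSup a _)] at h1
  have h2 : (Ideal.Quotient.mk a '' Set.range y).encard ≤ d := by
    refine (Set.encard_image_le _ _).trans ?_
    rw [← Set.image_univ]
    refine (Set.encard_image_le _ _).trans ?_
    simp
  have h3 : ringKrullDim (R ⧸ a) ≤ 0 + (d : WithBot ℕ∞) :=
    h1.trans (add_le_add h0 (by exact_mod_cast h2))
  rw [zero_add] at h3
  exact absurd h (not_lt_of_ge h3)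

lemma rad_eq {R : Type} [CommRing R] (a b Y : Ideal R) :
    (Y ⊔ (a ⊓ b)).radical = ((a ⊔ Y) ⊓ (b ⊔ Y)).radical := by
  refine le_antisymm (Ideal.radical_mono ?_) ?_
  · exact sup_le (le_inf le_sup_right le_sup_right)
      (le_inf (inf_le_left.trans le_sup_left) (inf_le_right.trans le_sup_left))
  · rw [Ideal.radical_inf, ← Ideal.radical_mul]
    refine Ideal.radical_mono ?_
    refine Ideal.mul_le.2 fun r hr s hs => ?_
    obtain ⟨r1, hr1, r2, hr2, rfl⟩ := Submodule.mem_sup.1 hr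
    obtain ⟨s1, hs1, s2, hs2, rfl⟩ := Submodule.mem_sup.1 hs
    rw [show (r1 + r2) * (s1 + s2) = (r1 * s2 + r2 * (s1 + s2)) + r1 * s1 by ring]
    exact Submodule.add_mem_sup (Y.add_mem (Y.mul_mem_left _ hs2) (Y.mul_mem_right _ hr2))
      ⟨a.mul_mem_right _ hr1, b.mul_mem_left _ hs1⟩

lemma main_dim {R : Type} [CommRing R] [IsNoetherianRing R] [IsLocalRing R] [IsDomain R]
    [IsAdicComplete (maximalIdeal R) R] (ρ : Res R) {n d : ℕ}
    (hdim : ringKrullDim R = n) {a b : Ideal R} (hd : ringKrullDim (R ⧸ (a ⊔ b)) = d)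
    (ha : (d : WithBot ℕ∞) < ringKrullDim (R ⧸ a)) (hb : (d : WithBot ℕ∞) < ringKrullDim (R ⧸ b)) :
    ∃ k, n = d + 2 + k ∧ ¬ ∀ i ≥ k + 1, ρ.Van (a ⊓ b) i := by
  have ha0 : a ≠ ⊥ := by
    rintro rfl
    rw [bot_sup_eq] at hd
    exact absurd hd hb.ne'
  have hat : a ≠ ⊤ := by
    rintro rfl
    rw [ringKrullDim_eq_bot_of_subsingleton] at ha
    exact absurd ha not_lt_bot
  obtain ⟨w, hwa, hw0⟩ := Submodule.exists_mem_ne_zero_of_ne_bot ha0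
  have hle : d + 2 ≤ n := by
    have h1 := ringKrullDim_quotient_succ_le_of_nonZeroDivisor (R := R) (r := w)
      (mem_nonZeroDivisors_of_ne_zero hw0)
    have h2 : ringKrullDim (R ⧸ a) ≤ ringKrullDim (R ⧸ Ideal.span {w}) :=
      ringKrullDim_le_of_surjective (Ideal.Quotient.factor (by rwa [Ideal.span_singleton_le_iff_mem]))
        (Ideal.Quotient.factor_surjective _)
    have h3 : ((d + 1 : ℕ) : WithBot ℕ∞) ≤ ringKrullDim (R ⧸ a) := by
      push_cast
      exact ENat.WithBot.add_one_le_iff.2 ha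
    rw [hdim] at h1
    have h4 : ((d + 1 : ℕ) : WithBot ℕ∞) + 1 ≤ n := (add_le_add_left (h3.trans h2) 1).trans h1
    have : d + 1 + 1 ≤ n := by exact_mod_cast h4
    omega
  obtain ⟨k, hk⟩ := Nat.exists_eq_add_of_le hle
  refine ⟨k, hk, fun H => ?_⟩
  have hm0 : maximalIdeal R ≠ ⊥ := by
    intro h
    exact ha0 (le_bot_iff.1 (h ▸ le_maximalIdeal hat))
  obtain ⟨y, hym, -, hy⟩ := DL_chain hm0 (e := 0) d (DL_quot hd) (fun Q _ h => by simp [coh_max Q h])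
  have hab := DL_zero hy
  let Y := Ideal.span (Set.range y)
  have hY : Ideal.ofList (List.ofFn y) = Y := by
    simp only [Ideal.ofList, List.mem_ofFn, Y]
    rfl
  refine conn ρ (n := d + k) (a := a ⊔ Y) (b := b ⊔ Y) (by rw [hdim, hk]; congr 1; push_cast; ring) (not_prim ha hym) (not_prim hb hym) ?_ ?_
  · refine hab.trans (Ideal.radical_mono (sup_le (sup_le ?_ ?_) ?_))
    · exact le_sup_left.trans le_sup_left
    · exact le_sup_left.trans le_sup_right
    · exact le_sup_right.trans le_sup_left
  · have := ρ.ystep_list H (List.ofFn y) (d + k + 1) (by simp; omega)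
    rw [hY] at this
    exact ρ.Van_congr (rad_eq a b Y) this

end LC
end

namespace LC
open IsLocalRing

lemma topDim_eq {A : Type} [CommRing A] {k : ℕ} (h : ringKrullDim A = k) :
    topDim (PrimeSpectrum A) = k := by
  rw [← PrimeSpectrum.topologicalKrullDim_eq_ringKrullDim] at h
  change Order.krullDim _ = _ at h
  refine IsGreatest.csSup_eq ⟨Or.inr ⟨k, rfl, ?_⟩, ?_⟩
  · obtain ⟨l, hl⟩ := Order.le_krullDim_iff.1 h.ge
    subst hl
    exact ⟨l.toFun, l.strictMono⟩
  · rintro d (hd | ⟨n, rfl, c, hc⟩)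
    · rw [Set.mem_singleton_iff] at hd
      omega
    · have h1 := Order.LTSeries.length_le_krullDim (LTSeries.mk n c hc)
      rw [h] at h1
      have h2 : n ≤ k := by exact_mod_cast h1
      exact_mod_cast h2

lemma topDim_sub {A : Type} [CommRing A] [Subsingleton A] : topDim (PrimeSpectrum A) = -1 := by
  refine IsGreatest.csSup_eq ⟨Or.inl rfl, ?_⟩
  rintro d (hd | ⟨n, rfl, c, hc⟩)
  · exact le_of_eq hd
  · obtain ⟨x, -⟩ := (c 0).isIrreducible.nonempty
    exact isEmptyElim x

lemma dim_nat {R : Type} [CommRing R] [IsNoetherianRing R] [IsLocalRing R] {I : Ideal R} (hI : I ≠ ⊤) :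
    ∃ k : ℕ, ringKrullDim (R ⧸ I) = k := by
  haveI : Nontrivial (R ⧸ I) := Ideal.Quotient.nontrivial_iff.2 hI
  have h1 : ringKrullDim (R ⧸ I) < ⊤ := lt_of_le_of_lt
    (ringKrullDim_le_of_surjective (Ideal.Quotient.mk I) Ideal.Quotient.mk_surjective) ringKrullDim_lt_top
  have h2 : ringKrullDim (R ⧸ I) ≠ ⊥ := fun h => absurd (ringKrullDim_nonneg_of_nontrivial (R := R ⧸ I)) (by rw [h]; simp)
  obtain ⟨x, hx⟩ := WithBot.ne_bot_iff_exists.1 h2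
  rw [← hx] at h1
  have h3 : x ≠ ⊤ := by
    rintro rfl
    exact absurd h1 (lt_irrefl _)
  obtain ⟨k, rfl⟩ := ENat.ne_top_iff_exists.1 h3
  exact ⟨k, hx.symm⟩

end LC

/-- Let `(R, m)` be a complete noetherian local domain of dimension `n`
and let `a, b ⊆ R` be ideals with `min { dim R/a, dim R/b } > dim R/(a + b)`.
Then `cd(R, a ∩ b) ≥ n − dim R/(a + b) − 1`. -/
theorem stmt_4 (R : Type) [CommRing R] [IsNoetherianRing R] [IsLocalRing R] [IsDomain R]
    [IsAdicComplete (IsLocalRing.maximalIdeal R) R] (n : ℤ)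
    (hn : topDim (PrimeSpectrum R) = n) (a b : Ideal R)
    (hab : min (topDim (PrimeSpectrum (R ⧸ a))) (topDim (PrimeSpectrum (R ⧸ b))) >
      topDim (PrimeSpectrum (R ⧸ (a + b)))) :
    cohDim R (a ⊓ b) R ≥ n - topDim (PrimeSpectrum (R ⧸ (a + b))) - 1 := by
  classical
  have hI : a ⊔ b ≠ ⊤ := by
    intro h
    rw [Submodule.add_eq_sup, h] at hab
    haveI : Subsingleton (R ⧸ (⊤ : Ideal R)) := Ideal.Quotient.subsingleton_iff.2 rfl
    have h1 : a = ⊤ ∨ b = ⊤ := by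
      by_contra! hne
      exact (IsLocalRing.maximalIdeal.isMaximal R).ne_top (top_le_iff.1 (h ▸ sup_le
        (IsLocalRing.le_maximalIdeal hne.1) (IsLocalRing.le_maximalIdeal hne.2)))
    rcases h1 with rfl | rfl
    · exact absurd hab (not_lt_of_ge (min_le_left _ _))
    · exact absurd hab (not_lt_of_ge (min_le_right _ _))
  have hat : a ≠ ⊤ := by rintro rfl; exact hI (top_sup_eq _)
  have hbt : b ≠ ⊤ := by rintro rfl; exact hI (sup_top_eq _)
  obtain ⟨d, hd⟩ := LC.dim_nat hI
  obtain ⟨da, hda⟩ := LC.dim_nat hat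
  obtain ⟨db, hdb⟩ := LC.dim_nat hbt
  obtain ⟨n', hn'⟩ := LC.dim_nat (R := R) (I := ⊥) bot_ne_top
  rw [ringKrullDim_eq_of_ringEquiv (RingEquiv.quotientBot R)] at hn'
  rw [LC.topDim_eq hn'] at hn
  rw [Submodule.add_eq_sup, LC.topDim_eq hda, LC.topDim_eq hdb, LC.topDim_eq hd] at hab
  rw [Submodule.add_eq_sup, LC.topDim_eq hd]
  obtain ⟨h1, h2⟩ := lt_min_iff.1 hab
  have h1' : d < da := by exact_mod_cast h1
  have h2' : d < db := by exact_mod_cast h2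
  obtain ⟨I, dd, ε, f1, f2, f3, f4, hvan⟩ := LC.exists_res R
  let ρ : LC.Res R := ⟨I, dd, ε, f1, f2, f3, f4⟩
  obtain ⟨k, hk, hnv⟩ := LC.main_dim ρ hn' hd (by rw [hda]; exact_mod_cast h1') (by rw [hdb]; exact_mod_cast h2')
  have hvan' : ∀ j : ℕ, Subsingleton ((localCohomology (a ⊓ b) (j+1)).obj (ModuleCat.of R R)) ↔
      ρ.Van (a ⊓ b) (j+1) := by
    intro j
    rw [hvan (a ⊓ b) j]
    constructor
    · intro h u hu
      exact h u hu.2 hu.1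
    · intro h u hu hg
      exact h (x := u) ⟨hg, hu⟩
  obtain ⟨s, hs⟩ := (IsNoetherian.noetherian (a ⊓ b) : (a ⊓ b).FG)
  have hls : Ideal.ofList (s.toList) = a ⊓ b := by
    rw [← hs]
    simp only [Ideal.ofList, Finset.mem_toList]
    rfl
  have hbdd : BddAbove {d : ℤ | ∃ i : ℕ, d = (i : ℤ) ∧
      Nontrivial ((localCohomology (a ⊓ b) i).obj (ModuleCat.of R R))} := by
    refine ⟨((1 + s.toList.length : ℕ) : ℤ), ?_⟩
    rintro _ ⟨i, rfl, hi⟩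
    by_contra hlt
    have hlt' : 1 + s.toList.length < i := by
      by_contra h
      exact hlt (by exact_mod_cast (not_lt.1 h))
    obtain ⟨j, rfl⟩ : ∃ j, i = j + 1 := ⟨i - 1, by omega⟩
    have h3 := ρ.van_list s.toList (j+1) hlt'.le
    rw [hls] at h3
    exact not_subsingleton_iff_nontrivial.2 hi ((hvan' j).2 h3)
  by_contra hlt
  apply hnv
  intro i hi
  obtain ⟨j, rfl⟩ : ∃ j, i = j + 1 := ⟨i - 1, by omega⟩
  rw [← hvan' j]
  by_contra hns
  have h5 := le_csSup hbdd ⟨j+1, rfl, not_subsingleton_iff_nontrivial.1 hns⟩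
  change ((j + 1 : ℕ) : ℤ) ≤ cohDim R (a ⊓ b) R at h5
  push_cast at h5
  omega
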